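/- Assume ZF + I_{0,λ} where λ is even. Then for every A ∈ V_{λ+1}, the sharp A^# exists; that is, there is a nontrivial elementary embedding of L(A) into L(A) with critical point above rank(A) (equivalently, a closed unbounded proper class of Silver indiscernibles for L(V_λ, A)). -/

import Mathlib

set_option autoImplicit false
set_option maxHeartbeats 1000000
namespace ZFI0
inductive Fml : ℕ → Type where
  | mem : {n : ℕ} → Fin n → Fin n → Fml n
  | equ : {n : ℕ} → Fin n → Fin n → Fml n
  | aux : {n : ℕ} → Fin n → Fml n
  | impl : {n : ℕ} → Fml n → Fml n → Fml n
  | neg : {n : ℕ} → Fml n → Fml n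
  | all : {n : ℕ} → Fml (n + 1) → Fml n
  | ex : {n : ℕ} → Fml (n + 1) → Fml n
  | allb : {n : ℕ} → Fin n → Fml (n + 1) → Fml n
def IsDelta0 : {n : ℕ} → Fml n → Prop
  | _, Fml.mem _ _ => True
  | _, Fml.equ _ _ => True
  | _, Fml.aux _ => True
  | _, Fml.impl f g => IsDelta0 f ∧ IsDelta0 g
  | _, Fml.neg f => IsDelta0 f
  | _, Fml.all _ => False
  | _, Fml.ex _ => False
  | _, Fml.allb _ f => IsDelta0 f
inductive IsSigma1 : {n : ℕ} → Fml n → Prop where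
  | base : ∀ {n : ℕ} (f : Fml n), IsDelta0 f → IsSigma1 f
  | exI : ∀ {n : ℕ} (f : Fml (n + 1)), IsSigma1 f → IsSigma1 (Fml.ex f)
variable {M : Type}
def Eval (E : M → M → Prop) (P : M → Prop) (C : M → Prop) :
    {n : ℕ} → Fml n → (Fin n → M) → Prop
  | _, Fml.mem i j, v => E (v i) (v j)
  | _, Fml.equ i j, v => v i = v j
  | _, Fml.aux i, v => P (v i)
  | _, Fml.impl f g, v => Eval E P C f v → Eval E P C g v
  | _, Fml.neg f, v => ¬ Eval E P C f v
  | _, Fml.all f, v => ∀ x : M, C x → Eval E P C f (Fin.cons x v)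
  | _, Fml.ex f, v => ∃ x : M, C x ∧ Eval E P C f (Fin.cons x v)
  | _, Fml.allb i f, v => ∀ x : M, C x → E x (v i) → Eval E P C f (Fin.cons x v)
def NoAux : M → Prop := fun _ => False
def AllSets : M → Prop := fun _ => True
def SubsetE (E : M → M → Prop) (x y : M) : Prop := ∀ z, E z x → E z y
def TransClass (E : M → M → Prop) (C : M → Prop) : Prop :=
  ∀ x y, C x → E y x → C y
structure SatZF (E : M → M → Prop) (P : M → Prop) : Prop where
  ext : ∀ x y : M, (∀ z, E z x ↔ E z y) → x = y
  found : ∀ x : M, (∃ y, E y x) → ∃ y, E y x ∧ ∀ z, E z y → ¬ E z x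
  pair : ∀ x y : M, ∃ p, ∀ z, E z p ↔ (z = x ∨ z = y)
  union : ∀ x : M, ∃ u, ∀ z, E z u ↔ ∃ y, E y x ∧ E z y
  power : ∀ x : M, ∃ p, ∀ z, E z p ↔ SubsetE E z x
  infty : ∃ w : M, (∃ z, E z w ∧ ∀ u, ¬ E u z) ∧
    ∀ x, E x w → ∃ s, E s w ∧ ∀ z, E z s ↔ (E z x ∨ z = x)
  sep : ∀ {n : ℕ} (f : Fml (n + 1)) (v : Fin n → M) (a : M),
    ∃ b, ∀ z, E z b ↔ (E z a ∧ Eval E P AllSets f (Fin.cons z v))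
  repl : ∀ {n : ℕ} (f : Fml (n + 2)) (v : Fin n → M) (a : M),
    (∀ x, E x a → ∃! y, Eval E P AllSets f (Fin.cons x (Fin.cons y v))) →
    ∃ b, ∀ y, E y b ↔ ∃ x, E x a ∧ Eval E P AllSets f (Fin.cons x (Fin.cons y v))
def ClassSatZF (E : M → M → Prop) (P : M → Prop) (C : M → Prop) : Prop :=
  SatZF (M := {x : M // C x}) (fun a b => E a.1 b.1) (fun a => P a.1)
def TransSet (E : M → M → Prop) (x : M) : Prop := ∀ y, E y x → SubsetE E y x
def IsOrd (E : M → M → Prop) (x : M) : Prop :=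
  TransSet E x ∧ ∀ y z, E y x → E z x → (E y z ∨ y = z ∨ E z y)
def IsZero (E : M → M → Prop) (x : M) : Prop := IsOrd E x ∧ ∀ y, ¬ E y x
def IsSuccOf (E : M → M → Prop) (x s : M) : Prop := ∀ z, E z s ↔ (E z x ∨ z = x)
def IsLimitOrd (E : M → M → Prop) (x : M) : Prop :=
  IsOrd E x ∧ (∃ y, E y x) ∧ ∀ y, E y x → ∃ s, E s x ∧ IsSuccOf E y s
def OrdIter (E : M → M → Prop) : ℕ → M → M → Prop
  | 0, x, y => x = y
  | n + 1, x, y => ∃ s, IsSuccOf E x s ∧ OrdIter E n s y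
def IsEvenOrd (E : M → M → Prop) (l : M) : Prop :=
  ∃ (h : M) (n : ℕ), (IsZero E h ∨ IsLimitOrd E h) ∧ OrdIter E (2 * n) h l
def IsOmegaOrd (E : M → M → Prop) (w : M) : Prop :=
  IsLimitOrd E w ∧ ∀ z, E z w → ¬ IsLimitOrd E z
def IsNextLimit (E : M → M → Prop) (u w : M) : Prop :=
  IsLimitOrd E w ∧ E u w ∧ ∀ z, IsLimitOrd E z → E u z → (w = z ∨ E w z)
def IsUPair (E : M → M → Prop) (p x y : M) : Prop := ∀ z, E z p ↔ (z = x ∨ z = y)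
def IsKPair (E : M → M → Prop) (p x y : M) : Prop :=
  ∃ a b, IsUPair E a x x ∧ IsUPair E b x y ∧ IsUPair E p a b
def IsKTriple (E : M → M → Prop) (t u v w : M) : Prop :=
  ∃ q, IsKPair E q v w ∧ IsKPair E t u q
def PairIn (E : M → M → Prop) (f x y : M) : Prop := ∃ p, E p f ∧ IsKPair E p x y
def IsFunc (E : M → M → Prop) (f : M) : Prop :=
  (∀ p, E p f → ∃ x y, IsKPair E p x y) ∧
  (∀ x y y', PairIn E f x y → PairIn E f x y' → y = y')
def IsFuncOn (E : M → M → Prop) (f d : M) : Prop :=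
  IsFunc E f ∧ ∀ x, (∃ y, PairIn E f x y) ↔ E x d
def MapsTo (E : M → M → Prop) (f a b : M) : Prop :=
  IsFuncOn E f a ∧ ∀ x y, PairIn E f x y → E y b
def SurjOn (E : M → M → Prop) (f a b : M) : Prop :=
  MapsTo E f a b ∧ ∀ y, E y b → ∃ x, PairIn E f x y
def IsRestrOfFn (E : M → M → Prop) (f d r : M) : Prop :=
  IsFuncOn E r d ∧ ∀ x y, PairIn E r x y ↔ (E x d ∧ PairIn E f x y)
def SatAC (E : M → M → Prop) : Prop :=
  ∀ x, (∀ y, E y x → ∃ z, E z y) →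
    ∃ f, IsFuncOn E f x ∧ ∀ y z, PairIn E f y z → E z y
def IsVHier (E : M → M → Prop) (H a : M) : Prop :=
  IsOrd E a ∧ IsFunc E H ∧ (∀ b, (∃ y, PairIn E H b y) ↔ (E b a ∨ b = a)) ∧
  ∀ b w, PairIn E H b w →
    ∀ x, E x w ↔ ∃ c u, E c b ∧ PairIn E H c u ∧ SubsetE E x u
def IsVStage (E : M → M → Prop) (a v : M) : Prop := ∃ H, IsVHier E H a ∧ PairIn E H a v
def VAt (E : M → M → Prop) (l : M) (n : ℕ) (v : M) : Prop :=
  ∃ s, OrdIter E n l s ∧ IsVStage E s v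
def IsRankOf (E : M → M → Prop) (x r : M) : Prop :=
  IsOrd E r ∧ (∃ v, IsVStage E r v ∧ SubsetE E x v) ∧
  ∀ r' v', IsOrd E r' → IsVStage E r' v' → SubsetE E x v' → (r = r' ∨ E r r')
def IsGProd (E : M → M → Prop) (z x y : M) : Prop :=
  ∀ w, E w z ↔ ∃ u v, E u x ∧ E v y ∧ IsKPair E w u v
def IsGMemRel (E : M → M → Prop) (z x y : M) : Prop :=
  ∀ w, E w z ↔ ∃ u v, E u x ∧ E v y ∧ E u v ∧ IsKPair E w u v
def IsGDiff (E : M → M → Prop) (z x y : M) : Prop := ∀ w, E w z ↔ (E w x ∧ ¬ E w y)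
def IsGInter (E : M → M → Prop) (z x y : M) : Prop := ∀ w, E w z ↔ (E w x ∧ E w y)
def IsGUnionSet (E : M → M → Prop) (z x : M) : Prop := ∀ w, E w z ↔ ∃ u, E u x ∧ E w u
def IsGDom (E : M → M → Prop) (z x : M) : Prop :=
  ∀ w, E w z ↔ ∃ p u, E p x ∧ IsKPair E p w u
def IsGConv (E : M → M → Prop) (z x : M) : Prop :=
  ∀ w, E w z ↔ ∃ u v p, E p x ∧ IsKPair E p u v ∧ IsKPair E w v u
def IsGPerm1 (E : M → M → Prop) (z x : M) : Prop :=
  ∀ t, E t z ↔ ∃ u v w t', E t' x ∧ IsKTriple E t' u w v ∧ IsKTriple E t u v w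
def IsGPerm2 (E : M → M → Prop) (z x : M) : Prop :=
  ∀ t, E t z ↔ ∃ u v w t', E t' x ∧ IsKTriple E t' v w u ∧ IsKTriple E t u v w
def GClosed (E : M → M → Prop) (c : M) : Prop :=
  (∀ x y z, E x c → E y c →
    (IsUPair E z x y ∨ IsGProd E z x y ∨ IsGMemRel E z x y ∨
      IsGDiff E z x y ∨ IsGInter E z x y) → E z c) ∧
  (∀ x z, E x c →
    (IsGUnionSet E z x ∨ IsGDom E z x ∨ IsGConv E z x ∨
      IsGPerm1 E z x ∨ IsGPerm2 E z x) → E z c)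
def IsGClOf (E : M → M → Prop) (b c : M) : Prop :=
  SubsetE E b c ∧ GClosed E c ∧ ∀ c', SubsetE E b c' → GClosed E c' → SubsetE E c c'
def IsDefSetOf (E : M → M → Prop) (l d : M) : Prop :=
  ∃ lp c, (∀ z, E z lp ↔ (E z l ∨ z = l)) ∧ IsGClOf E lp c ∧
    ∀ y, E y d ↔ (SubsetE E y l ∧ E y c)
def IsTransClOf (E : M → M → Prop) (x t : M) : Prop :=
  SubsetE E x t ∧ TransSet E t ∧ ∀ t', SubsetE E x t' → TransSet E t' → SubsetE E t t'
def IsTCSing (E : M → M → Prop) (x t : M) : Prop :=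
  E x t ∧ TransSet E t ∧ ∀ t', E x t' → TransSet E t' → SubsetE E t t'
def IsLZero (E : M → M → Prop) (b z : M) : Prop :=
  ∃ t, IsTransClOf E b t ∧ ∀ x, E x z ↔ (E x t ∨ x = b)
def IsLHier (E : M → M → Prop) (b H a : M) : Prop :=
  IsOrd E a ∧ IsFunc E H ∧ (∀ c, (∃ y, PairIn E H c y) ↔ (E c a ∨ c = a)) ∧
  (∀ c z, IsZero E c → PairIn E H c z → IsLZero E b z) ∧
  (∀ c s z w, IsSuccOf E c s → PairIn E H c z → PairIn E H s w → IsDefSetOf E z w) ∧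
  (∀ c z, IsLimitOrd E c → PairIn E H c z →
    ∀ x, E x z ↔ ∃ d u, E d c ∧ PairIn E H d u ∧ E x u)
def IsLStage (E : M → M → Prop) (b a l : M) : Prop :=
  ∃ H, IsLHier E b H a ∧ PairIn E H a l
def InL (E : M → M → Prop) (b x : M) : Prop := ∃ a l, IsLStage E b a l ∧ E x l
def IsV2L (E : M → M → Prop) (v1 w : M) : Prop :=
  ∀ x, E x w ↔ (InL E v1 x ∧ SubsetE E x v1)
def ClassFun (C : M → Prop) (J : M → M → Prop) : Prop :=
  (∀ x, C x → ∃ y, J x y) ∧ (∀ x y, J x y → C x ∧ C y) ∧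
  (∀ x y y', J x y → J x y' → y = y')
def ElemOn (E : M → M → Prop) (C : M → Prop) (J : M → M → Prop) : Prop :=
  ClassFun C J ∧ ∀ {n : ℕ} (f : Fml n) (v w : Fin n → M),
    (∀ i, J (v i) (w i)) → (Eval E NoAux C f v ↔ Eval E NoAux C f w)
def ElemBetween (E : M → M → Prop) (C D : M → Prop) (J : M → M → Prop) : Prop :=
  (∀ x, C x → ∃ y, J x y) ∧ (∀ x y, J x y → C x ∧ D y) ∧
  (∀ x y y', J x y → J x y' → y = y') ∧
  ∀ {n : ℕ} (f : Fml n) (v w : Fin n → M),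
    (∀ i, J (v i) (w i)) → (Eval E NoAux C f v ↔ Eval E NoAux D f w)
def Sigma1ElemOn (E : M → M → Prop) (C : M → Prop) (J : M → M → Prop) : Prop :=
  ClassFun C J ∧ ∀ {n : ℕ} (f : Fml n), IsSigma1 f → ∀ (v w : Fin n → M),
    (∀ i, J (v i) (w i)) → (Eval E NoAux C f v ↔ Eval E NoAux C f w)
def SetElemEmbOn (E : M → M → Prop) (a k : M) : Prop :=
  MapsTo E k a a ∧ ∀ {n : ℕ} (f : Fml n) (v w : Fin n → M),
    (∀ i, PairIn E k (v i) (w i)) →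
    (Eval E NoAux (fun z => E z a) f v ↔ Eval E NoAux (fun z => E z a) f w)
def SetSigma1ElemEmbOn (E : M → M → Prop) (a k : M) : Prop :=
  MapsTo E k a a ∧ ∀ {n : ℕ} (f : Fml n), IsSigma1 f → ∀ (v w : Fin n → M),
    (∀ i, PairIn E k (v i) (w i)) →
    (Eval E NoAux (fun z => E z a) f v ↔ Eval E NoAux (fun z => E z a) f w)
def NontrivialRel (J : M → M → Prop) : Prop := ∃ x y, J x y ∧ x ≠ y
def CritBelow (E : M → M → Prop) (J : M → M → Prop) (l : M) : Prop :=
  ∃ k, IsOrd E k ∧ E k l ∧ ¬ J k k ∧ ∀ b, IsOrd E b → E b k → J b b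
def I0Emb (E : M → M → Prop) (l v1 : M) (J : M → M → Prop) : Prop :=
  ElemOn E (InL E v1) J ∧ CritBelow E J l
def JPred (E : M → M → Prop) (J : M → M → Prop) : M → Prop :=
  fun p => ∃ x y, IsKPair E p x y ∧ J x y
def CodesRestr (E : M → M → Prop) (J : M → M → Prop) (a r : M) : Prop :=
  IsFuncOn E r a ∧ ∀ x y, PairIn E r x y → J x y
def IsMuSet (E : M → M → Prop) (J : M → M → Prop) (vl v1 m : M) : Prop :=
  ∀ X, E X m ↔ (InL E v1 X ∧ SubsetE E X v1 ∧
    ∃ r Y, CodesRestr E J vl r ∧ J X Y ∧ E r Y)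
def RelComp (J1 J0 : M → M → Prop) : M → M → Prop := fun x z => ∃ y, J0 x y ∧ J1 y z
def IncrTuple (E : M → M → Prop) {n : ℕ} (v : Fin n → M) : Prop :=
  ∀ i j : Fin n, i < j → E (v i) (v j)
def IsSilverClass (E : M → M → Prop) (v1 : M) (I : M → Prop) : Prop :=
  (∀ x, I x → IsOrd E x) ∧
  (∀ a, IsOrd E a → ∃ i, I i ∧ E a i) ∧
  (∀ a, IsLimitOrd E a → (∀ b, E b a → ∃ i, I i ∧ E b i ∧ E i a) → I a) ∧
  (∀ {n m : ℕ} (f : Fml (n + m)) (p : Fin m → M) (s t : Fin n → M),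
    (∀ i, E (p i) v1) → (∀ i, I (s i)) → (∀ i, I (t i)) →
    IncrTuple E s → IncrTuple E t →
    (Eval E NoAux (InL E v1) f (Fin.append s p) ↔
      Eval E NoAux (InL E v1) f (Fin.append t p))) ∧
  (∀ x, InL E v1 x → ∃ (n m : ℕ) (f : Fml (n + m + 1)) (p : Fin m → M) (s : Fin n → M),
    (∀ i, E (p i) v1) ∧ (∀ i, I (s i)) ∧
    ∀ y, InL E v1 y →
      (Eval E NoAux (InL E v1) f (Fin.cons y (Fin.append s p)) ↔ y = x))
def SharpEmb (E : M → M → Prop) (l v1 : M) (J : M → M → Prop) : Prop :=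
  ElemOn E (InL E v1) J ∧ NontrivialRel J ∧
  ∀ b, IsOrd E b → (E b l ∨ b = l) → J b b
def DefClassRel (E : M → M → Prop) (P : M → Prop) (R : M → M → Prop) : Prop :=
  ∃ (n : ℕ) (f : Fml (n + 2)) (p : Fin n → M),
    ∀ x y, R x y ↔ Eval E P AllSets f (Fin.cons x (Fin.cons y p))
def DefOverClassRel (E : M → M → Prop) (W : M → Prop) (R : M → M → Prop) : Prop :=
  ∃ (n : ℕ) (f : Fml (n + 2)) (p : Fin n → M), (∀ i, W (p i)) ∧
    ∀ x y, W x → W y → (R x y ↔ Eval E NoAux W f (Fin.cons x (Fin.cons y p)))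
def SharpExists (E : M → M → Prop) (P : M → Prop) (l v1 : M) : Prop :=
  ∃ J, DefClassRel E P J ∧ SharpEmb E l v1 J
def ProperEmb (E : M → M → Prop) (P : M → Prop) (l v1 : M) (J : M → M → Prop) : Prop :=
  ¬ SharpExists E P l v1 ∨
    (SharpExists E P l v1 ∧ ∀ I, IsSilverClass E v1 I → ∀ x, I x → J x x)
def StdDecomp (E : M → M → Prop) (P : M → Prop) (l v1 : M)
    (J J0 J1 : M → M → Prop) : Prop :=
  ElemOn E (InL E v1) J0 ∧ ElemOn E (InL E v1) J1 ∧
  (∀ x z, InL E v1 x → (J x z ↔ RelComp J1 J0 x z)) ∧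
  ProperEmb E P l v1 J0 ∧
  (∀ b, IsOrd E b → E b l → J1 b b) ∧
  (¬ SharpExists E P l v1 → ∀ x, InL E v1 x → J1 x x)
def IsVSharpSet (E : M → M → Prop) (v1 sh : M) : Prop :=
  SubsetE E sh v1 ∧ ¬ InL E v1 sh ∧ ∃ I, IsSilverClass E v1 I
def IsThetaOf (E : M → M → Prop) (W : M → Prop) (v th : M) : Prop :=
  IsOrd E th ∧
  (∀ a, E a th → ∃ b f, (E a b ∨ a = b) ∧ W f ∧ SurjOn E f v b) ∧
  (∀ a f, IsOrd E a → W f → SurjOn E f v a → E a th)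
def RegularIn (E : M → M → Prop) (W : M → Prop) (th : M) : Prop :=
  ¬ ∃ a f, IsOrd E a ∧ E a th ∧ W f ∧ MapsTo E f a th ∧
    ∀ b, E b th → ∃ x y, PairIn E f x y ∧ (E b y ∨ b = y)
def CofinalOmegaSeq (E : M → M → Prop) (th : M) : Prop :=
  ∃ f : ℕ → M, (∀ n, IsOrd E (f n) ∧ E (f n) th) ∧
    ∀ b, E b th → ∃ n, E b (f n) ∨ b = f n
def IsTreeOn (E : M → M → Prop) (T h X : M) : Prop :=
  (∀ f, E f T → ∃ b, IsOrd E b ∧ E b h ∧ MapsTo E f b X) ∧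
  (∀ f d b r, E f T → IsFuncOn E f d → E b d → IsRestrOfFn E f b r → E r T)
def IsMaxBranch (E : M → M → Prop) (T h X b : M) : Prop :=
  ∃ a, IsOrd E a ∧ (E a h ∨ a = h) ∧ MapsTo E b a X ∧
    ((E b T ∧ ¬ ∃ g dg, E g T ∧ IsFuncOn E g dg ∧ E a dg ∧ IsRestrOfFn E g a b) ∨
     ((IsZero E a ∨ IsLimitOrd E a) ∧ ¬ E b T ∧
       ∀ c, E c a → ∃ r, E r T ∧ IsRestrOfFn E b c r))
def DCOn (E : M → M → Prop) (h : M) (W : M → Prop) : Prop :=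
  ∀ X T, W X → W T → IsTreeOn E T h X → ∃ b, W b ∧ IsMaxBranch E T h X b
def DCAt (E : M → M → Prop) (h : M) : Prop := DCOn E h AllSets
def ODIn (E : M → M → Prop) (C : M → Prop) (Xc : M → Prop) (x : M) : Prop :=
  ∃ (n : ℕ) (f : Fml (n + 1)) (p : Fin n → M),
    (∀ i, C (p i)) ∧ (∀ i, IsOrd E (p i) ∨ Xc (p i)) ∧
    ∀ z, C z → (Eval E NoAux C f (Fin.cons z p) ↔ z = x)
def HODIn (E : M → M → Prop) (C : M → Prop) (Xc : M → Prop) (x : M) : Prop :=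
  ∀ t, IsTCSing E x t → ∀ y, E y t → ODIn E C Xc y
def InHull (E : M → M → Prop) (D : M → Prop) (Xp : M → Prop) (y : M) : Prop :=
  ∃ (n : ℕ) (f : Fml (n + 1)) (p : Fin n → M), (∀ i, Xp (p i)) ∧
    ∀ z, D z → (Eval E NoAux D f (Fin.cons z p) ↔ z = y)
def FnInto (E : M → M → Prop) (C : M → Prop) (v f : M) : Prop :=
  C f ∧ IsFuncOn E f v ∧ ∀ x y, PairIn E f x y → C y
def MeasOne (E : M → M → Prop) (mu : M → Prop) (v : M) (Q : M → Prop) : Prop :=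
  ∃ X, (∀ z, E z X ↔ (E z v ∧ Q z)) ∧ mu X
def UltSat (E : M → M → Prop) (C : M → Prop) (v : M) (mu : M → Prop) :
    {n : ℕ} → Fml n → (Fin n → M) → Prop
  | _, Fml.mem i j, fs => MeasOne E mu v (fun k =>
      ∃ y z, PairIn E (fs i) k y ∧ PairIn E (fs j) k z ∧ E y z)
  | _, Fml.equ i j, fs => MeasOne E mu v (fun k =>
      ∃ y z, PairIn E (fs i) k y ∧ PairIn E (fs j) k z ∧ y = z)
  | _, Fml.aux _, _ => False
  | _, Fml.impl f g, fs => UltSat E C v mu f fs → UltSat E C v mu g fs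
  | _, Fml.neg f, fs => ¬ UltSat E C v mu f fs
  | _, Fml.all f, fs => ∀ g, FnInto E C v g → UltSat E C v mu f (Fin.cons g fs)
  | _, Fml.ex f, fs => ∃ g, FnInto E C v g ∧ UltSat E C v mu f (Fin.cons g fs)
  | _, Fml.allb i f, fs => ∀ g, FnInto E C v g →
      MeasOne E mu v (fun k => ∃ y z, PairIn E g k y ∧ PairIn E (fs i) k z ∧ E y z) →
      UltSat E C v mu f (Fin.cons g fs)
def LosOK (E : M → M → Prop) (C : M → Prop) (v : M) (mu : M → Prop) : Prop :=
  ∀ {n : ℕ} (f : Fml n) (fs : Fin n → M), (∀ i, FnInto E C v (fs i)) →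
    (UltSat E C v mu f fs ↔ MeasOne E mu v (fun k =>
      ∃ ys : Fin n → M, (∀ i, PairIn E (fs i) k (ys i)) ∧ Eval E NoAux C f ys))
def UltRepOKB (E : M → M → Prop) (C D : M → Prop) (v : M) (mu : M → Prop)
    (Rep : M → M → Prop) (Jm : M → M → Prop) : Prop :=
  (∀ f, FnInto E C v f → ∃ x, D x ∧ Rep f x) ∧
  (∀ f x, Rep f x → FnInto E C v f ∧ D x) ∧
  (∀ x, D x → ∃ f, Rep f x) ∧
  (∀ {n : ℕ} (f : Fml n) (fs xs : Fin n → M), (∀ i, Rep (fs i) (xs i)) →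
    (Eval E NoAux D f xs ↔ MeasOne E mu v (fun k =>
      ∃ ys : Fin n → M, (∀ i, PairIn E (fs i) k (ys i)) ∧ Eval E NoAux C f ys))) ∧
  (∀ x y, C x → (Jm x y ↔ ∃ f, (∀ p, E p f ↔ ∃ k, E k v ∧ IsKPair E p k x) ∧ Rep f y))
def UltRepOK (E : M → M → Prop) (C : M → Prop) (v : M) (mu : M → Prop)
    (Rep : M → M → Prop) (Jm : M → M → Prop) : Prop :=
  UltRepOKB E C C v mu Rep Jm
def IsUltPowMap (E : M → M → Prop) (C : M → Prop) (v : M) (mu : M → Prop)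
    (Jm : M → M → Prop) : Prop :=
  ∃ Rep, UltRepOK E C v mu Rep Jm
def IsUltPowMapB (E : M → M → Prop) (C D : M → Prop) (v : M) (mu : M → Prop)
    (Jm : M → M → Prop) : Prop :=
  ∃ Rep, UltRepOKB E C D v mu Rep Jm
structure IterData (M : Type) where
  cls : M → M → Prop
  meas : M → M → Prop
  emb : M → M → M → Prop
  imap : M → M → M → M → Prop
def IterMeasStep (E : M → M → Prop) (S : IterData M) (z0 v1 v2L a tgt Y : M) : Prop :=
  ∃ v1a v2a pi Xr jX, S.imap z0 a v1 v1a ∧ S.imap z0 a v2L v2a ∧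
    S.cls a pi ∧ MapsTo E pi v1a v2a ∧
    (∀ z, E z Xr ↔ (S.meas a z ∧ ∃ x, PairIn E pi x z)) ∧
    S.imap a tgt Xr jX ∧ E Y jX
def IsIterSys (E : M → M → Prop) (C0 : M → Prop) (mu0 : M → Prop)
    (z0 v1 v2L d : M) (S : IterData M) : Prop :=
  IsZero E z0 ∧
  (∀ x, S.cls z0 x ↔ C0 x) ∧ (∀ X, S.meas z0 X ↔ mu0 X) ∧
  (∀ a, IsOrd E a → (E a d ∨ a = d) → ∀ x y, S.imap a a x y ↔ (S.cls a x ∧ x = y)) ∧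
  (∀ a b c, IsOrd E a → IsOrd E b → IsOrd E c → (E a b ∨ a = b) → (E b c ∨ b = c) →
    (E c d ∨ c = d) → ∀ x z, S.imap a c x z ↔ ∃ y, S.imap a b x y ∧ S.imap b c y z) ∧
  (∀ a b, IsOrd E a → IsOrd E b → (E a b ∨ a = b) → (E b d ∨ b = d) →
    ElemBetween E (S.cls a) (S.cls b) (S.imap a b)) ∧
  (∀ a s, IsOrd E a → IsSuccOf E a s → (E s d ∨ s = d) →
    (∀ x, S.cls s x ↔ S.cls a x) ∧
    (∀ x y, S.imap a s x y ↔ S.emb a x y) ∧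
    (∀ Y, S.meas s Y ↔ IterMeasStep E S z0 v1 v2L a s Y)) ∧
  (∀ a v1a, IsOrd E a → (E a d ∨ a = d) → S.imap z0 a v1 v1a →
    IsUltPowMap E (S.cls a) v1a (S.meas a) (S.emb a)) ∧
  (∀ h, IsLimitOrd E h → (E h d ∨ h = d) →
    (∀ x, S.cls h x → ∃ a x0, IsOrd E a ∧ E a h ∧ S.imap a h x0 x) ∧
    (∀ Y, S.meas h Y ↔ ∃ a, IsOrd E a ∧ E a h ∧ IterMeasStep E S z0 v1 v2L a h Y))
def LinMeasAt (E : M → M → Prop) (S : IterData M) (z0 m a : M) : M → Prop :=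
  fun X => ∃ ma, S.imap z0 a m ma ∧ E X ma
def IsLinIterSys (E : M → M → Prop) (C0 : M → Prop) (z0 v1 m d : M)
    (S : IterData M) : Prop :=
  IsZero E z0 ∧ (∀ x, S.cls z0 x ↔ C0 x) ∧
  (∀ a, IsOrd E a → (E a d ∨ a = d) → ∀ x y, S.imap a a x y ↔ (S.cls a x ∧ x = y)) ∧
  (∀ a b c, IsOrd E a → IsOrd E b → IsOrd E c → (E a b ∨ a = b) → (E b c ∨ b = c) →
    (E c d ∨ c = d) → ∀ x z, S.imap a c x z ↔ ∃ y, S.imap a b x y ∧ S.imap b c y z) ∧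
  (∀ a b, IsOrd E a → IsOrd E b → (E a b ∨ a = b) → (E b d ∨ b = d) →
    ElemBetween E (S.cls a) (S.cls b) (S.imap a b)) ∧
  (∀ a s, IsOrd E a → IsSuccOf E a s → (E s d ∨ s = d) →
    (∀ x y, S.imap a s x y ↔ S.emb a x y) ∧
    ∀ v1a, S.imap z0 a v1 v1a →
      IsUltPowMapB E (S.cls a) (S.cls s) v1a (LinMeasAt E S z0 m a) (S.emb a)) ∧
  (∀ h, IsLimitOrd E h → (E h d ∨ h = d) →
    ∀ x, S.cls h x → ∃ a x0, IsOrd E a ∧ E a h ∧ S.imap a h x0 x)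
structure OmegaIterData (M : Type) where
  meas : ℕ → M → Prop
  emb : ℕ → M → M → Prop
  limC : M → Prop
  limMap : ℕ → M → M → Prop
  limMeas : M → Prop
  limEmb : M → M → Prop
def OmegaMeasStep (E : M → M → Prop) (C0 : M → Prop) (mu : M → Prop)
    (Jn : M → M → Prop) (v1 v2L Y : M) : Prop :=
  ∃ pi Xr jX, C0 pi ∧ MapsTo E pi v1 v2L ∧
    (∀ z, E z Xr ↔ (mu z ∧ ∃ x, PairIn E pi x z)) ∧ Jn Xr jX ∧ E Y jX
def IsOmegaIter (E : M → M → Prop) (v1 v2L : M) (mu0 : M → Prop)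
    (S : OmegaIterData M) : Prop :=
  (∀ X, S.meas 0 X ↔ mu0 X) ∧
  (∀ n Y, S.meas (n + 1) Y ↔
    OmegaMeasStep E (InL E v1) (S.meas n) (S.emb n) v1 v2L Y) ∧
  (∀ n, IsUltPowMap E (InL E v1) v1 (S.meas n) (S.emb n)) ∧
  (∀ n x y, S.limMap n x y ↔ ∃ z, S.emb n x z ∧ S.limMap (n + 1) z y) ∧
  (∀ y, S.limC y ↔ ∃ n x, S.limMap n x y) ∧
  (∀ n, ElemBetween E (InL E v1) S.limC (S.limMap n)) ∧
  (∀ Y, S.limMeas Y ↔ ∃ n pi Xr jX, InL E v1 pi ∧ MapsTo E pi v1 v2L ∧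
    (∀ z, E z Xr ↔ (S.meas n z ∧ ∃ x, PairIn E pi x z)) ∧
    S.limMap n Xr jX ∧ E Y jX) ∧
  (∀ v1w, S.limMap 0 v1 v1w → IsUltPowMap E S.limC v1w S.limMeas S.limEmb)
def IsPosetOn (E : M → M → Prop) (P le : M) : Prop :=
  (∀ q, E q le → ∃ x y, IsKPair E q x y ∧ E x P ∧ E y P) ∧
  (∀ p, E p P → PairIn E le p p) ∧
  (∀ p q r, PairIn E le p q → PairIn E le q r → PairIn E le p r) ∧
  (∀ p q, PairIn E le p q → PairIn E le q p → p = q)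
def CompatIn (E : M → M → Prop) (P le p q : M) : Prop :=
  ∃ r, E r P ∧ PairIn E le r p ∧ PairIn E le r q
def IsDenseIn (E : M → M → Prop) (P le D : M) : Prop :=
  SubsetE E D P ∧ ∀ p, E p P → ∃ q, E q D ∧ PairIn E le q p
def IsFilterCl (E : M → M → Prop) (P le : M) (G : M → Prop) : Prop :=
  (∀ p, G p → E p P) ∧ (∃ p, G p) ∧
  (∀ p q, G p → G q → ∃ r, G r ∧ PairIn E le r p ∧ PairIn E le r q) ∧
  (∀ p q, G p → E q P → PairIn E le p q → G q)
def IsGenericOver (E : M → M → Prop) (W : M → Prop) (P le : M) (G : M → Prop) : Prop :=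
  IsFilterCl E P le G ∧ ∀ D, W D → IsDenseIn E P le D → ∃ p, G p ∧ E p D
def IsAntichainIn (E : M → M → Prop) (P le A : M) : Prop :=
  SubsetE E A P ∧ ∀ p q, E p A → E q A → p ≠ q → ¬ CompatIn E P le p q
def ExtEquals (E : M → M → Prop) (W : M → Prop) (G : M → Prop) (Wx : M → Prop) : Prop :=
  (∀ x, W x → Wx x) ∧ TransClass E Wx ∧ ClassSatZF E NoAux Wx ∧
  (∃ g, Wx g ∧ ∀ x, E x g ↔ G x) ∧
  ∀ C : M → Prop, TransClass E C → ClassSatZF E NoAux C → (∀ x, W x → C x) →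
    (∀ g, (∀ x, E x g ↔ G x) → C g) → ∀ x, Wx x → C x
def IsSetGenExt (E : M → M → Prop) (W Wx : M → Prop) : Prop :=
  ∃ P le G, W P ∧ W le ∧ IsPosetOn E P le ∧ IsGenericOver E W P le G ∧
    ExtEquals E W G Wx
def LamAlphaOmega (E : M → M → Prop) (l a g : M) : Prop :=
  ∃ F s, IsSuccOf E a s ∧ IsFuncOn E F s ∧
    (∀ z y, IsZero E z → PairIn E F z y → y = l) ∧
    (∀ c sc u w, IsSuccOf E c sc → E sc s → PairIn E F c u → PairIn E F sc w →
      IsNextLimit E u w) ∧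
    (∀ c w, IsLimitOrd E c → PairIn E F c w →
      ∀ x, E x w ↔ ∃ dd u, E dd c ∧ PairIn E F dd u ∧ E x u) ∧
    PairIn E F a g
def IsTjNode (E : M → M → Prop) (l v1 th lth j t : M) : Prop :=
  ∃ a b ga gb la el,
    IsLimitOrd E a ∧ E a th ∧ IsLimitOrd E b ∧ E b th ∧
    LamAlphaOmega E l a ga ∧ LamAlphaOmega E l b gb ∧
    MapsTo E t ga gb ∧
    IsLStage E v1 a la ∧ IsFuncOn E el la ∧
    (∀ x y, PairIn E j x y → PairIn E el x y) ∧
    (∀ x y, PairIn E t x y → PairIn E el x y) ∧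
    (∀ x y, PairIn E el x y → E y lth) ∧
    (∀ {n : ℕ} (f : Fml n), IsSigma1 f → ∀ v w : Fin n → M,
      (∀ i, PairIn E el (v i) (w i)) →
      (Eval E NoAux (fun z => E z lth) f v ↔ Eval E NoAux (fun z => E z lth) f w))
def IsTjSet (E : M → M → Prop) (l v1 th lth j T : M) : Prop :=
  ∀ t, E t T ↔ IsTjNode E l v1 th lth j t
def NodeExtends (E : M → M → Prop) (s t : M) : Prop :=
  ∃ dt, IsFuncOn E t dt ∧ IsRestrOfFn E s dt t
def IsDerivOf (E : M → M → Prop) (th T T' : M) : Prop :=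
  ∀ t, E t T' ↔ (E t T ∧ ∀ b, E b th →
    ∃ s ds, E s T ∧ IsFuncOn E s ds ∧ NodeExtends E s t ∧ (E b ds ∨ b = ds))
def IsDerivHier (E : M → M → Prop) (th T0 H a : M) : Prop :=
  IsOrd E a ∧ IsFunc E H ∧ (∀ c, (∃ y, PairIn E H c y) ↔ (E c a ∨ c = a)) ∧
  (∀ c z, IsZero E c → PairIn E H c z → z = T0) ∧
  (∀ c s z w, IsSuccOf E c s → PairIn E H c z → PairIn E H s w → IsDerivOf E th z w) ∧
  (∀ c z, IsLimitOrd E c → PairIn E H c z →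
    ∀ x, E x z ↔ ∀ dd u, E dd c → PairIn E H dd u → E x u)
def IsTjDerivAt (E : M → M → Prop) (th T0 a T : M) : Prop :=
  ∃ H, IsDerivHier E th T0 H a ∧ PairIn E H a T
def InTjInfty (E : M → M → Prop) (th T0 t : M) : Prop :=
  E t T0 ∧ ∀ a T, IsOrd E a → IsTjDerivAt E th T0 a T → E t T
def IsThBranchCl (E : M → M → Prop) (th T : M) (B : M → Prop) : Prop :=
  (∀ t, B t → E t T) ∧
  (∀ t s, B t → B s → NodeExtends E s t ∨ NodeExtends E t s) ∧
  (∀ b, E b th → ∃ t ds, B t ∧ IsFuncOn E t ds ∧ (E b ds ∨ b = ds))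
def IsThBranchSet (E : M → M → Prop) (th T Bs : M) : Prop :=
  (∀ t, E t Bs → E t T) ∧
  (∀ t s, E t Bs → E s Bs → NodeExtends E s t ∨ NodeExtends E t s) ∧
  (∀ b, E b th → ∃ t ds, E t Bs ∧ IsFuncOn E t ds ∧ (E b ds ∨ b = ds))
set_option linter.all false
class ZM (M : Type) where
  E : M → M → Prop
  P : M → Prop
  ax : SatZF E P
infix:50 "ε" => ZM.E
def upr {n m : ℕ} (r : Fin n → Fin m) : Fin (n+1) → Fin (m+1) :=
  Fin.cons 0 (fun i => (r i).succ)
def ren : {n m : ℕ} → (Fin n → Fin m) → Fml n → Fml m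
  | _, _, r, Fml.mem i j => Fml.mem (r i) (r j)
  | _, _, r, Fml.equ i j => Fml.equ (r i) (r j)
  | _, _, r, Fml.aux i => Fml.aux (r i)
  | _, _, r, Fml.impl f g => Fml.impl (ren r f) (ren r g)
  | _, _, r, Fml.neg f => Fml.neg (ren r f)
  | _, _, r, Fml.all f => Fml.all (ren (upr r) f)
  | _, _, r, Fml.ex f => Fml.ex (ren (upr r) f)
  | _, _, r, Fml.allb i f => Fml.allb (r i) (ren (upr r) f)
theorem cons_upr {n m : ℕ} (r : Fin n → Fin m) (x : M) (v : Fin m → M) :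
    (fun i => (Fin.cons x v : Fin (m+1) → M) (upr r i)) = Fin.cons x (fun i => v (r i)) := by
  funext i; refine Fin.cases ?_ (fun i => ?_) i <;> simp [upr]
theorem Eval_ren (E : M → M → Prop) (P C : M → Prop) {n : ℕ} (f : Fml n) :
    ∀ {m : ℕ} (r : Fin n → Fin m) (v : Fin m → M),
      Eval E P C (ren r f) v ↔ Eval E P C f (fun i => v (r i)) := by
  induction f with
  | mem | equ | aux => intros; rfl
  | impl f g hf hg => intro m r v; simp only [ren, Eval, hf, hg]
  | neg f hf => intro m r v; simp only [ren, Eval, hf]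
  | all f hf => intro m r v; simp only [ren, Eval, hf, cons_upr]
  | ex f hf => intro m r v; simp only [ren, Eval, hf, cons_upr]
  | allb i f hf => intro m r v; simp only [ren, Eval, hf, cons_upr]
def Tp : M → Prop := fun _ => True
def Bt : M → Prop := fun _ => False
class Df [ZM M] (S : M → Prop) {n : ℕ} (R : (Fin n → M) → Prop) : Prop where
  h : ∃ (k : ℕ) (f : Fml (n+k)) (p : Fin k → M), (∀ i, S (p i)) ∧
    ∀ v, R v ↔ Eval ZM.E ZM.P AllSets f (Fin.append v p)
class DfF [ZM M] (S : M → Prop) {n : ℕ} (t : (Fin n → M) → M) : Prop where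
  h : Df S (fun w : Fin (n+1) → M => w 0 = t (fun i => w i.succ))
class Cst (S : M → Prop) (c : M) : Prop where
  h : S c
instance (c : M) : Cst Tp c := ⟨trivial⟩
section
variable [ZM M] {S : M → Prop} {n : ℕ}
theorem Df.congr {R R' : (Fin n → M) → Prop} (h : Df S R) (e : ∀ v, R' v ↔ R v) : Df S R' := by
  obtain ⟨k, f, p, hp, h⟩ := h.h
  exact ⟨k, f, p, hp, fun v => (e v).trans (h v)⟩
theorem Df.mono {S' : M → Prop} {R : (Fin n → M) → Prop} (h : Df S R) (e : ∀ x, S x → S' x) :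
    Df S' R := by
  obtain ⟨k, f, p, hp, h⟩ := h.h
  exact ⟨k, f, p, fun i => e _ (hp i), h⟩
theorem Df.two {R R' : (Fin n → M) → Prop} (h : Df S R) (h' : Df S R') :
    ∃ (k : ℕ) (f g : Fml (n+k)) (p : Fin k → M), (∀ i, S (p i)) ∧
    (∀ v, R v ↔ Eval ZM.E ZM.P AllSets f (Fin.append v p)) ∧
    (∀ v, R' v ↔ Eval ZM.E ZM.P AllSets g (Fin.append v p)) := by
  obtain ⟨k, f, p, hp, h⟩ := h.h
  obtain ⟨l, g, q, hq, h'⟩ := h'.h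
  refine ⟨k+l, ren (Fin.addCases (Fin.castAdd _) (fun i => Fin.natAdd n (Fin.castAdd l i))) f,
    ren (Fin.addCases (Fin.castAdd _) (fun i => Fin.natAdd n (Fin.natAdd k i))) g,
    Fin.append p q, ?_, ?_, ?_⟩
  · intro i; refine Fin.addCases (fun i => ?_) (fun i => ?_) i <;> simp [hp, hq]
  · intro v; rw [h, Eval_ren]
    have : Fin.append v p = fun i => Fin.append v (Fin.append p q)
      (Fin.addCases (Fin.castAdd _) (fun i => Fin.natAdd n (Fin.castAdd l i)) i) := by
      funext i; refine Fin.addCases (fun i => ?_) (fun i => ?_) i <;> simp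
    grind
  · intro v; rw [h', Eval_ren]
    have : Fin.append v q = fun i => Fin.append v (Fin.append p q)
      (Fin.addCases (Fin.castAdd _) (fun i => Fin.natAdd n (Fin.natAdd k i)) i) := by
      funext i; refine Fin.addCases (fun i => ?_) (fun i => ?_) i <;> simp
    grind
instance Df.imp {A B : (Fin n → M) → Prop} [a : Df S A] [b : Df S B] :
    Df S (fun v => A v → B v) := by
  obtain ⟨k, f, g, p, hp, h, h'⟩ := a.two b
  exact ⟨k, f.impl g, p, hp, fun v => by simp only [Eval, h, h']⟩
instance Df.not {A : (Fin n → M) → Prop} [a : Df S A] : Df S (fun v => ¬ A v) := by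
  obtain ⟨k, f, p, hp, h⟩ := a.h
  exact ⟨k, f.neg, p, hp, fun v => by simp only [Eval, h]⟩
instance Df.and {A B : (Fin n → M) → Prop} [a : Df S A] [b : Df S B] :
    Df S (fun v => A v ∧ B v) :=
  Df.congr (Df.not (A := fun v => A v → ¬ B v)) (fun v => by tauto)
instance Df.or {A B : (Fin n → M) → Prop} [a : Df S A] [b : Df S B] :
    Df S (fun v => A v ∨ B v) :=
  Df.congr (Df.imp (A := fun v => ¬ A v) (B := B)) (fun v => by tauto)
instance Df.iff {A B : (Fin n → M) → Prop} [a : Df S A] [b : Df S B] :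
    Df S (fun v => A v ↔ B v) :=
  Df.congr (Df.and (A := fun v => A v → B v) (B := fun v => B v → A v)) (fun v => by tauto)
theorem cons_app {k : ℕ} (x : M) (v : Fin n → M) (p : Fin k → M) :
    (Fin.append (Fin.cons x v : Fin (n+1) → M) p) = fun i =>
      (Fin.cons x (Fin.append v p) : Fin (n+k+1) → M) (Fin.cast (Nat.add_right_comm n 1 k) i) := by
  funext i
  refine Fin.addCases (fun i => ?_) (fun i => ?_) i
  · refine Fin.cases ?_ (fun i => ?_) i
    · rfl
    · rw [Fin.append_left, Fin.cons_succ]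
      have : Fin.cast (Nat.add_right_comm n 1 k) (Fin.castAdd k i.succ) = (Fin.castAdd k i).succ := by grind
      simp_all
  · rw [Fin.append_right]
    have : Fin.cast (Nat.add_right_comm n 1 k) (Fin.natAdd (n+1) i) = (Fin.natAdd n i).succ := by grind
    simp_all
theorem cons_tl (w : Fin (n+1) → M) : Fin.cons (w 0) (fun i => w i.succ) = w := by
  funext i; refine Fin.cases ?_ (fun i => ?_) i <;> simp
instance Df.all {R : (Fin n → M) → M → Prop}
    [a : Df S (fun w : Fin (n+1) → M => R (fun i => w i.succ) (w 0))] :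
    Df S (fun v => ∀ x, R v x) := by
  obtain ⟨k, f, p, hp, h⟩ := a.h
  refine ⟨k, Fml.all (ren (Fin.cast (Nat.add_right_comm n 1 k)) f), p, hp, fun v => ?_⟩
  simp only [Eval, Eval_ren]
  refine forall_congr' fun x => ?_
  have := h (Fin.cons x v)
  simp only [Fin.cons_succ, Fin.cons_zero, cons_app] at this
  rw [this]; simp [AllSets]
instance Df.ex {R : (Fin n → M) → M → Prop}
    [a : Df S (fun w : Fin (n+1) → M => R (fun i => w i.succ) (w 0))] :
    Df S (fun v => ∃ x, R v x) :=
  Df.congr (Df.not (A := fun v => ∀ x, ¬ R v x)) (fun v => by simp)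
theorem Df.rn {m : ℕ} {R : (Fin m → M) → Prop} (a : Df S R) (r : Fin m → Fin n) :
    Df S (fun v : Fin n → M => R (fun i => v (r i))) := by
  obtain ⟨k, f, p, hp, h⟩ := a.h
  refine ⟨k, ren (Fin.addCases (fun i => Fin.castAdd k (r i)) (Fin.natAdd n)) f, p, hp,
    fun v => ?_⟩
  rw [h, Eval_ren]
  have : Fin.append (fun i => v (r i)) p = fun i => Fin.append v p
      (Fin.addCases (fun i => Fin.castAdd k (r i)) (Fin.natAdd n) i) := by
    funext i; refine Fin.addCases (fun i => ?_) (fun i => ?_) i <;> simp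
  grind
theorem Df.vmem (i j : Fin n) : Df S (fun v : Fin n → M => v i ε v j) :=
  ⟨0, Fml.mem (Fin.castAdd 0 i) (Fin.castAdd 0 j), Fin.elim0, fun i => i.elim0, fun v => by
    simp only [Eval, Fin.append_left]⟩
theorem Df.veq (i j : Fin n) : Df S (fun v : Fin n → M => v i = v j) :=
  ⟨0, Fml.equ (Fin.castAdd 0 i) (Fin.castAdd 0 j), Fin.elim0, fun i => i.elim0, fun v => by
    simp only [Eval, Fin.append_left]⟩
theorem Df.vaux (i : Fin n) : Df S (fun v : Fin n → M => ZM.P (v i)) :=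
  ⟨0, Fml.aux (Fin.castAdd 0 i), Fin.elim0, fun i => i.elim0, fun v => by
    simp only [Eval, Fin.append_left]⟩
instance DfF.var (i : Fin n) : DfF S (fun v : Fin n → M => v i) := ⟨Df.veq 0 i.succ⟩
instance (priority := 2000) DfF.cst (c : M) [h : Cst S c] : DfF S (fun _ : Fin n → M => c) :=
  ⟨1, Fml.equ 0 (Fin.natAdd (n+1) 0), fun _ => c, fun _ => h.h, fun v => by
    have : (0 : Fin (n+1+1)) = Fin.castAdd 1 0 := rfl
    simp only [Eval, this, Fin.append_left, Fin.append_right]⟩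
instance (priority := 3000) Df.triv : Df S (fun _ : Fin n → M => True) :=
  ⟨0, Fml.ex (Fml.equ 0 0), Fin.elim0, fun i => i.elim0, fun v => by
    simp only [Eval, true_iff]; have : Nonempty M := ⟨(ZM.ax (M := M)).infty.choose⟩
    exact ⟨this.some, trivial, trivial⟩⟩
theorem Df.fin {m : ℕ} : ∀ {A : Fin m → (Fin n → M) → Prop} (_ : ∀ i, Df S (A i)),
    Df S (fun v => ∀ i, A i v) := by
  induction m with
  | zero => intro A h; exact Df.triv.congr (fun v => by simp)
  | succ m ih => intro A h; simp only [Fin.forall_fin_succ]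
                 have := ih (fun i => h i.succ); infer_instance
theorem Df.exs {m : ℕ} : ∀ {n : ℕ} {Q : (Fin m → M) → (Fin n → M) → Prop}
    (_ : Df S (fun w : Fin (n+m) → M =>
      Q (fun i => w (Fin.natAdd n i)) (fun i => w (Fin.castAdd m i)))),
    Df S (fun v => ∃ u, Q u v) := by
  induction m with
  | zero => intro n Q h; refine h.congr fun v => ?_
            constructor
            · rintro ⟨u, h⟩; convert h; rfl
            · exact fun h => ⟨_, h⟩
  | succ m ih =>
    intro n Q h
    have h1 := ih (Q := fun u w => Q (Fin.cons (w 0) u) (fun i => w i.succ))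
      ((h.rn (Fin.addCases (fun i => Fin.castAdd m i.succ)
        (Fin.cases (Fin.castAdd m 0) (fun i => Fin.natAdd (n+1) i)))).congr fun v => by
        simp only [Fin.addCases_left]
        refine iff_of_eq (congrArg₂ _ ?_ rfl)
        funext i; refine Fin.cases ?_ (fun i => ?_) i <;> simp)
    refine (Df.ex (R := fun v x => ∃ u : Fin m → M, Q (Fin.cons x u) v)).congr fun v => ?_
    constructor
    · rintro ⟨u, h⟩; exact ⟨u 0, fun i => u i.succ, by rwa [cons_tl]⟩
    · grind
theorem DfF.wk {t : (Fin n → M) → M} (ht : DfF S t) {m : ℕ} (r : Fin n → Fin m) :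
    DfF S (fun w : Fin m → M => t (fun j => w (r j))) :=
  ⟨(ht.h.rn (upr r)).congr fun v => by simp [upr]⟩
theorem DfF.gph {t : (Fin n → M) → M} (ht : DfF S t) {m : ℕ} (j : Fin m) (r : Fin n → Fin m) :
    Df S (fun w : Fin m → M => w j = t (fun i => w (r i))) :=
  (ht.h.rn (Fin.cons j r)).congr fun v => by simp
theorem Df.sbs {m : ℕ} {R : (Fin m → M) → Prop} (a : Df S R)
    {t : Fin m → (Fin n → M) → M} (ht : ∀ i, DfF S (t i)) : Df S (fun v => R (fun i => t i v)) := by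
  have h1 := Df.fin (fun i => (ht i).gph (Fin.natAdd n i) (Fin.castAdd m))
  have h2 := a.rn (Fin.natAdd n)
  refine (Df.exs (Q := fun u v => (∀ i, u i = t i v) ∧ R u) Df.and).congr fun v => ?_
  constructor
  · grind
  · rintro ⟨u, h, h'⟩; rwa [← funext h]
theorem DfF.sbs {m : ℕ} {s : (Fin m → M) → M} (a : DfF S s)
    {t : Fin m → (Fin n → M) → M} (ht : ∀ i, DfF S (t i)) : DfF S (fun v => s (fun i => t i v)) :=
  ⟨(Df.sbs a.h (t := Fin.cons (fun w => w 0) (fun i w => t i (fun j => w j.succ)))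
    (fun i => by
      refine Fin.cases ?_ (fun i => ?_) i
      · exact DfF.var 0
      · exact (ht i).wk _)).congr fun v => by simp⟩
class D1 (S : M → Prop) (R : M → Prop) : Prop where
  h : Df S (fun v : Fin 1 → M => R (v 0))
class D2 (S : M → Prop) (R : M → M → Prop) : Prop where
  h : Df S (fun v : Fin 2 → M => R (v 0) (v 1))
class D3 (S : M → Prop) (R : M → M → M → Prop) : Prop where
  h : Df S (fun v : Fin 3 → M => R (v 0) (v 1) (v 2))
class D4 (S : M → Prop) (R : M → M → M → M → Prop) : Prop where
  h : Df S (fun v : Fin 4 → M => R (v 0) (v 1) (v 2) (v 3))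
class F1 (S : M → Prop) (R : M → M) : Prop where
  h : DfF S (fun v : Fin 1 → M => R (v 0))
class F2 (S : M → Prop) (R : M → M → M) : Prop where
  h : DfF S (fun v : Fin 2 → M => R (v 0) (v 1))
class F3 (S : M → Prop) (R : M → M → M → M) : Prop where
  h : DfF S (fun v : Fin 3 → M => R (v 0) (v 1) (v 2))
variable {s t u r : (Fin n → M) → M}
instance (priority := 110) [h : DfF S s] [h' : DfF S t] : Df S (fun v => s v ε t v) :=
  (Df.vmem (n := 2) 0 1).sbs (t := ![s, t]) (by simp [Fin.forall_fin_succ, h, h'])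
instance (priority := 110) [h : DfF S s] [h' : DfF S t] : Df S (fun v => s v = t v) :=
  (Df.veq (n := 2) 0 1).sbs (t := ![s, t]) (by simp [Fin.forall_fin_succ, h, h'])
instance (priority := 110) [h : DfF S s] : Df S (fun v => ZM.P (s v)) :=
  (Df.vaux (n := 1) 0).sbs (t := ![s]) (by simp [Fin.forall_fin_succ, h])
instance (priority := 50) sb1 {R : M → Prop} [a : D1 S R] [h : DfF S s] : Df S (fun v => R (s v)) :=
  a.h.sbs (t := ![s]) (by simp [Fin.forall_fin_succ, h])
instance (priority := 51) sb2 {R : M → M → Prop} [a : D2 S R] [h : DfF S s] [h' : DfF S t] :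
    Df S (fun v => R (s v) (t v)) :=
  a.h.sbs (t := ![s, t]) (by simp [Fin.forall_fin_succ, h, h'])
instance (priority := 52) sb3 {R : M → M → M → Prop} [a : D3 S R] [h : DfF S s] [h' : DfF S t]
    [h'' : DfF S u] : Df S (fun v => R (s v) (t v) (u v)) :=
  a.h.sbs (t := ![s, t, u]) (by simp [Fin.forall_fin_succ, h, h', h''])
instance (priority := 53) sb4 {R : M → M → M → M → Prop} [a : D4 S R] [h : DfF S s] [h' : DfF S t]
    [h'' : DfF S u] [h3 : DfF S r] : Df S (fun v => R (s v) (t v) (u v) (r v)) :=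
  a.h.sbs (t := ![s, t, u, r]) (by simp [Fin.forall_fin_succ, h, h', h'', h3])
instance (priority := 50) sf1 {F : M → M} [a : F1 S F] [h : DfF S s] : DfF S (fun v => F (s v)) :=
  a.h.sbs (t := ![s]) (by simp [Fin.forall_fin_succ, h])
instance (priority := 51) sf2 {F : M → M → M} [a : F2 S F] [h : DfF S s] [h' : DfF S t] :
    DfF S (fun v => F (s v) (t v)) :=
  a.h.sbs (t := ![s, t]) (by simp [Fin.forall_fin_succ, h, h'])
instance (priority := 52) sf3 {F : M → M → M → M} [a : F3 S F] [h : DfF S s] [h' : DfF S t]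
    [h'' : DfF S u] : DfF S (fun v => F (s v) (t v) (u v)) :=
  a.h.sbs (t := ![s, t, u]) (by simp [Fin.forall_fin_succ, h, h', h''])
instance (priority := 10) D1.of {R : M → Prop} [h : Df S (fun v : Fin 1 → M => R (v 0))] : D1 S R := ⟨h⟩
instance (priority := 10) D2.of {R : M → M → Prop} [h : Df S (fun v : Fin 2 → M => R (v 0) (v 1))] :
    D2 S R := ⟨h⟩
instance (priority := 10) D3.of {R : M → M → M → Prop}
    [h : Df S (fun v : Fin 3 → M => R (v 0) (v 1) (v 2))] : D3 S R := ⟨h⟩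
instance (priority := 10) D4.of {R : M → M → M → M → Prop}
    [h : Df S (fun v : Fin 4 → M => R (v 0) (v 1) (v 2) (v 3))] : D4 S R := ⟨h⟩
instance (priority := 10) F1.of {F : M → M} [h : DfF S (fun v : Fin 1 → M => F (v 0))] : F1 S F := ⟨h⟩
instance (priority := 10) F2.of {F : M → M → M} [h : DfF S (fun v : Fin 2 → M => F (v 0) (v 1))] :
    F2 S F := ⟨h⟩
instance (priority := 10) F3.of {F : M → M → M → M}
    [h : DfF S (fun v : Fin 3 → M => F (v 0) (v 1) (v 2))] : F3 S F := ⟨h⟩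
theorem F1.gr {F : M → M} (R : M → M → Prop) (e : ∀ y x, y = F x ↔ R y x) [h : D2 S R] : F1 S F :=
  ⟨⟨h.h.congr fun v => e _ _⟩⟩
theorem F2.gr {F : M → M → M} (R : M → M → M → Prop) (e : ∀ z x y, z = F x y ↔ R z x y)
    [h : D3 S R] : F2 S F :=
  ⟨⟨h.h.congr fun v => e _ _ _⟩⟩
theorem F3.gr {F : M → M → M → M} (R : M → M → M → M → Prop)
    (e : ∀ z x y w, z = F x y w ↔ R z x y w) [h : D4 S R] : F3 S F :=
  ⟨⟨h.h.congr fun v => e _ _ _ _⟩⟩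
open Classical in
instance DfF.ite {A : (Fin n → M) → Prop} [a : Df S A] [h : DfF S s] [h' : DfF S t] :
    DfF S (fun v => if A v then s v else t v) := by
  have h1 := a.rn (n := n+1) Fin.succ
  have h2 := h.h
  have h3 := h'.h
  refine ⟨(Df.and (A := fun w : Fin (n+1) → M => A (fun i => w i.succ) → w 0 = s (fun i => w i.succ))
    (B := fun w => ¬ A (fun i => w i.succ) → w 0 = t (fun i => w i.succ))).congr fun v => ?_⟩
  by_cases h : A (fun i => v i.succ) <;> simp [h]
end
noncomputable section
variable [ZM M] {S : M → Prop} {n : ℕ}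
theorem eqx {x y : M} (h : ∀ z, z ε x ↔ z ε y) : x = y := ZM.ax.ext x y h
open Classical in
noncomputable def st (Q : M → Prop) : M :=
  if h : ∃ b, ∀ z, z ε b ↔ Q z then h.choose else
    (ZM.ax.sep (n := 0) (Fml.neg (Fml.equ 0 0)) Fin.elim0 (ZM.ax (M := M)).infty.choose).choose
theorem st_of {Q : M → Prop} (b : M) (h : ∀ z, z ε b ↔ Q z) : st Q = b := by
  have h' : ∃ b, ∀ z, z ε b ↔ Q z := ⟨b, h⟩
  rw [st, dif_pos h']
  exact eqx fun z => (h'.choose_spec z).trans (h z).symm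
theorem st_no {Q : M → Prop} (h : ¬ ∃ b, ∀ z, z ε b ↔ Q z) (z : M) : ¬ z ε st Q := by
  rw [st, dif_neg h, Exists.choose_spec (ZM.ax.sep (Fml.neg (Fml.equ 0 0)) Fin.elim0
    (ZM.ax).infty.choose)]
  simp [Eval]
theorem st_iff {Q : M → Prop} (y : M) : y = st Q ↔
    (∀ z, z ε y ↔ Q z) ∨ ((¬ ∃ b, ∀ z, z ε b ↔ Q z) ∧ ∀ z, ¬ z ε y) := by
  by_cases h : ∃ b, ∀ z, z ε b ↔ Q z
  · obtain ⟨b, h⟩ := h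
    rw [st_of b h]
    constructor
    · grind
    · rintro (h' | h')
      · exact eqx fun z => (h' z).trans (h z).symm
      · exact absurd ⟨b, h⟩ h'.1
  · constructor
    · rintro rfl; exact .inr ⟨h, st_no h⟩
    · rintro (h' | h')
      · exact absurd ⟨y, h'⟩ h
      · exact eqx fun z => iff_of_false (h'.2 z) (st_no h z)
theorem Df.par {R : (Fin n → M) → M → Prop}
    (h : Df S (fun w : Fin (n+1) → M => R (fun i => w i.succ) (w 0))) {m : ℕ} (r : Fin n → Fin m)
    {t : (Fin m → M) → M} (ht : DfF S t) : Df S (fun w : Fin m → M => R (fun i => w (r i)) (t w)) :=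
  (h.sbs (t := Fin.cons t (fun i w => w (r i))) (fun i => by
    refine Fin.cases ?_ (fun i => ?_) i
    · simp_all
    · exact DfF.var _)).congr fun v => by simp
instance (priority := 200) DfF.st {Q : (Fin n → M) → M → Prop}
    [h : Df S (fun w : Fin (n+1) → M => Q (fun i => w i.succ) (w 0))] :
    DfF S (fun v => st (Q v)) := by
  have h1 := fun m r t (ht : DfF S t) => h.par (m := m) r (t := t) ht
  refine ⟨Df.congr ?_ (fun v => st_iff _)⟩
  have h2 := h1 (n+1+1) (fun i => i.succ.succ) _ (DfF.var 0)
  have h3 := h1 (n+1+1+1) (fun i => i.succ.succ.succ) _ (DfF.var 0)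
  infer_instance
theorem app1 (z : M) {k : ℕ} (p : Fin k → M) : Fin.append (fun _ : Fin 1 => z) p =
    fun i => (Fin.cons z p : Fin (k+1) → M) (Fin.cast (Nat.add_comm 1 k) i) := by
  funext i; refine Fin.addCases (fun i => ?_) (fun i => ?_) i
  · have : Fin.cast (Nat.add_comm 1 k) (Fin.castAdd k i) = 0 := by ext; simp
    rw [this]; simp
  · simp_all
theorem app2 (z y : M) {k : ℕ} (p : Fin k → M) : Fin.append (![z, y] : Fin 2 → M) p =
    fun i => (Fin.cons z (Fin.cons y p) : Fin (k+2) → M) (Fin.cast (Nat.add_comm 2 k) i) := by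
  funext i; refine Fin.addCases (fun i => ?_) (fun i => ?_) i
  · refine Fin.cases ?_ (fun i => ?_) i
    · have : Fin.cast (Nat.add_comm 2 k) (Fin.castAdd k 0) = 0 := by ext; simp
      rw [this]; simp
    · have : Fin.cast (Nat.add_comm 2 k) (Fin.castAdd k i.succ) = Fin.succ 0 := by ext; simp
      simp_all
  · have : Fin.cast (Nat.add_comm 2 k) (Fin.natAdd 2 i) = i.succ.succ := by
      grind
    simp_all
theorem sepx (Q : M → Prop) [h : D1 Tp Q] (a : M) : ∃ b, ∀ z, z ε b ↔ z ε a ∧ Q z := by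
  obtain ⟨k, f, p, -, h⟩ := h.h.h
  obtain ⟨b, hb⟩ := ZM.ax.sep (ren (Fin.cast (Nat.add_comm 1 k)) f) p a
  refine ⟨b, fun z => ?_⟩
  have := h (fun _ => z)
  rw [hb, Eval_ren, this, app1]
theorem mem_st {Q : M → Prop} [D1 Tp Q] (b : M) (hb : ∀ z, Q z → z ε b) {z : M} :
    z ε st Q ↔ Q z := by
  obtain ⟨c, hc⟩ := sepx Q b
  have : ∀ z, z ε c ↔ Q z := fun z => by grind
  rw [st_of c this, this]
theorem mem_st' {Q : M → Prop} {b : M} (h : ∀ z, z ε b ↔ Q z) {z : M} : z ε st Q ↔ Q z := by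
  rw [st_of b h, h]
def emp : M := st (fun _ => False)
def pr (x y : M) : M := st (fun z => z = x ∨ z = y)
def sg (x : M) : M := pr x x
def un (x : M) : M := st (fun z => ∃ y, y ε x ∧ z ε y)
def sub (x y : M) : Prop := ∀ z, z ε x → z ε y
def pw (x : M) : M := st (fun z => sub z x)
def bu (x y : M) : M := un (pr x y)
def sep (a : M) (Q : M → Prop) : M := st (fun z => z ε a ∧ Q z)
def img (a : M) (F : M → M) : M := st (fun z => ∃ x, x ε a ∧ z = F x)
def the (Q : M → Prop) : M := un (st Q)
def kp (x y : M) : M := pr (sg x) (pr x y)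
def ap (f x : M) : M := the (fun y => kp x y ε f)
def gr (a : M) (F : M → M) : M := img a (fun x => kp x (F x))
def fst (p : M) : M := the (fun x => ∃ y, p = kp x y)
def snd (p : M) : M := the (fun y => ∃ x, p = kp x y)
def sc (x : M) : M := bu x (sg x)
def cp (a b : M) : M := un (img a (fun x => img b (fun y => kp x y)))
instance (priority := 4000) emp.df : DfF S (fun _ : Fin n → M => (emp : M)) := by
  have : Df S (fun _ : Fin (n+1) → M => False) := (Df.not (A := fun _ => True)).congr (by simp)
  exact DfF.st (Q := fun _ _ => False)
instance : F2 S pr := by unfold pr; infer_instance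
instance : F1 S sg := by unfold sg; infer_instance
instance : F1 S un := by unfold un; infer_instance
instance : D2 S sub := by unfold sub; infer_instance
instance : F1 S pw := by unfold pw; infer_instance
instance : F2 S bu := by unfold bu; infer_instance
instance : F2 S kp := by unfold kp; infer_instance
instance (priority := 200) {Q : (Fin n → M) → M → Prop} {a : (Fin n → M) → M} [DfF S a]
    [h : Df S (fun w : Fin (n+1) → M => Q (fun i => w i.succ) (w 0))] :
    DfF S (fun v => sep (a v) (Q v)) := by
  have := DfF.wk (S := S) (t := a) inferInstance Fin.succ
  unfold sep; infer_instance
instance (priority := 200) {Q : (Fin n → M) → M → Prop}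
    [h : Df S (fun w : Fin (n+1) → M => Q (fun i => w i.succ) (w 0))] :
    DfF S (fun v => the (Q v)) := by unfold the; infer_instance
theorem DfF.par {R : (Fin n → M) → M → M}
    (h : DfF S (fun w : Fin (n+1) → M => R (fun i => w i.succ) (w 0))) {m : ℕ} (r : Fin n → Fin m)
    {t : (Fin m → M) → M} (ht : DfF S t) : DfF S (fun w : Fin m → M => R (fun i => w (r i)) (t w)) := by
  have := h.sbs (t := Fin.cons t (fun i w => w (r i))) (fun i => by
    refine Fin.cases ?_ (fun i => ?_) i
    · simp_all
    · exact DfF.var _)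
  simp_all
instance (priority := 200) img.df {F : (Fin n → M) → M → M} {a : (Fin n → M) → M} [DfF S a]
    [h : DfF S (fun w : Fin (n+1) → M => F (fun i => w i.succ) (w 0))] :
    DfF S (fun v => img (a v) (F v)) := by
  have := DfF.wk (S := S) (t := a) inferInstance (fun i => i.succ.succ)
  have := h.par (fun i : Fin n => i.succ.succ) (DfF.var 0)
  unfold img; infer_instance
instance (priority := 200) {F : (Fin n → M) → M → M} {a : (Fin n → M) → M} [DfF S a]
    [h : DfF S (fun w : Fin (n+1) → M => F (fun i => w i.succ) (w 0))] :
    DfF S (fun v => gr (a v) (F v)) := by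
  unfold gr; infer_instance
instance : F2 S ap := by unfold ap; infer_instance
instance : F1 S fst := by unfold fst; infer_instance
instance : F1 S snd := by unfold snd; infer_instance
instance : F1 S sc := by unfold sc; infer_instance
instance : F2 S cp := by unfold cp; infer_instance
@[simp] theorem mem_emp {z : M} : z ε emp ↔ False := by
  have : D1 Tp (fun _ : M => False) := ⟨(Df.not (A := fun _ => True)).congr (by simp)⟩
  exact mem_st z (fun _ h => h.elim)
@[simp] theorem mem_pr {x y z : M} : z ε pr x y ↔ z = x ∨ z = y := by
  obtain ⟨b, h⟩ := ZM.ax.pair x y; exact mem_st' h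
@[simp] theorem mem_sg {x z : M} : z ε sg x ↔ z = x := by simp [sg]
@[simp] theorem mem_un {x z : M} : z ε un x ↔ ∃ y, y ε x ∧ z ε y := by
  obtain ⟨b, h⟩ := ZM.ax.union x; exact mem_st' h
@[simp] theorem mem_pw {x z : M} : z ε pw x ↔ sub z x := by
  obtain ⟨b, h⟩ := ZM.ax.power x; exact mem_st' h
@[simp] theorem mem_bu {x y z : M} : z ε bu x y ↔ z ε x ∨ z ε y := by
  simp [bu]
@[simp] theorem mem_sc {x z : M} : z ε sc x ↔ z ε x ∨ z = x := by simp [sc]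
theorem mem_sep {a z : M} {Q : M → Prop} [D1 Tp Q] : z ε sep a Q ↔ z ε a ∧ Q z := by
  obtain ⟨b, h⟩ := sepx Q a; exact mem_st' h
theorem mem_img {a z : M} {F : M → M} [h : F1 Tp F] : z ε img a F ↔ ∃ x, x ε a ∧ z = F x := by
  have h0 : Df Tp (fun v : Fin 2 → M => v 1 = F (v 0)) := inferInstance
  obtain ⟨k, f, p, -, h⟩ := h0.h
  have h1 : ∀ x y, Eval ZM.E ZM.P AllSets (ren (Fin.cast (Nat.add_comm 2 k)) f)
      (Fin.cons x (Fin.cons y p)) ↔ y = F x := fun x y => by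
    have := h ![x, y]
    simp only [app2] at this
    rw [Eval_ren, ← this]; simp
  obtain ⟨b, hb⟩ := ZM.ax.repl (ren (Fin.cast (Nat.add_comm 2 k)) f) p a (by simp_all)
  simp only [h1] at hb
  exact mem_st' hb
theorem the_eq {Q : M → Prop} {y : M} (h : Q y) (h' : ∀ z, Q z → z = y) : the Q = y := by
  have : ∀ z, z ε sg y ↔ Q z := fun z => by rw [mem_sg]; grind
  rw [the, st_of _ this]; exact eqx (by simp)
theorem pr_eq {x y a b : M} : pr x y = pr a b ↔ (x = a ∧ y = b) ∨ (x = b ∧ y = a) := by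
  constructor
  · intro h
    have h1 := (mem_pr).1 (h ▸ mem_pr.2 (.inl rfl))
    have h2 := (mem_pr).1 (h ▸ mem_pr.2 (.inr rfl))
    have h3 := (mem_pr).1 (h.symm ▸ mem_pr.2 (.inl rfl))
    have h4 := (mem_pr).1 (h.symm ▸ mem_pr.2 (.inr rfl))
    grind
  · rintro (⟨rfl, rfl⟩ | ⟨rfl, rfl⟩) <;> refine eqx fun z => ?_ <;> simp [or_comm]
@[simp] theorem kp_eq {x y a b : M} : kp x y = kp a b ↔ x = a ∧ y = b := by
  simp only [kp, sg, pr_eq]; grind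
theorem ap_eq {f x y : M} (h : kp x y ε f) (h' : ∀ z, kp x z ε f → z = y) : ap f x = y := the_eq h h'
@[simp] theorem fst_kp {x y : M} : fst (kp x y) = x := the_eq ⟨y, rfl⟩ (by simp)
@[simp] theorem snd_kp {x y : M} : snd (kp x y) = y := the_eq ⟨x, rfl⟩ (by simp)
theorem mem_gr {a z : M} {F : M → M} [h : F1 Tp F] : z ε gr a F ↔ ∃ x, x ε a ∧ z = kp x (F x) := by
  rw [gr, mem_img]
theorem ap_gr {a x : M} {F : M → M} [h : F1 Tp F] (hx : x ε a) : ap (gr a F) x = F x := by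
  refine ap_eq (mem_gr.2 ⟨x, hx, rfl⟩) fun z hz => ?_
  obtain ⟨y, _, e⟩ := mem_gr.1 hz
  simp_all
theorem gr_eq {a : M} {F G : M → M} (e : ∀ x, x ε a → F x = G x) : gr a F = gr a G := by
  unfold gr img; grind
@[simp] theorem mem_cp {a b z : M} : z ε cp a b ↔ ∃ x y, x ε a ∧ y ε b ∧ z = kp x y := by
  simp only [cp, mem_un, mem_img]
  constructor
  · rintro ⟨_, ⟨x, hx, rfl⟩, h⟩; obtain ⟨y, hy, rfl⟩ := mem_img.1 h; grind
  · rintro ⟨x, y, hx, hy, rfl⟩; exact ⟨_, ⟨x, hx, rfl⟩, mem_img.2 ⟨y, hy, rfl⟩⟩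
theorem sub_ext {x y : M} (h : sub x y) (h' : sub y x) : x = y := eqx fun z => ⟨h z, h' z⟩
theorem fnd {a : M} (h : ∃ x, x ε a) : ∃ x, x ε a ∧ ∀ z, z ε x → ¬ z ε a := ZM.ax.found a h
theorem nmem_self {x : M} : ¬ x ε x := fun h => by
  obtain ⟨y, hy, h'⟩ := fnd (a := sg x) ⟨x, by simp⟩
  simp at hy; subst hy; exact h' y h (by simp)
theorem nmem2 {x y : M} (h : x ε y) : ¬ y ε x := fun h2 => by
  obtain ⟨z, hz, h'⟩ := fnd (a := pr x y) ⟨x, by simp⟩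
  rcases mem_pr.1 hz with rfl | rfl
  · exact h' _ h2 (by simp)
  · exact h' _ h (by simp)
theorem nmem3 {x y w : M} (h : x ε y) (h2 : y ε w) : ¬ w ε x := fun h3 => by
  obtain ⟨z, hz, h'⟩ := fnd (a := bu (sg w) (pr x y)) ⟨x, by simp⟩
  rcases (by simpa using hz) with rfl | rfl | rfl
  · exact h' _ h2 (by simp)
  · exact h' _ h3 (by simp)
  · exact h' _ h (by simp)
def Tr (x : M) : Prop := ∀ y, y ε x → sub y x
def On (x : M) : Prop := Tr x ∧ ∀ y z, y ε x → z ε x → (y ε z ∨ y = z ∨ z ε y)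
instance : D1 S Tr := by unfold Tr; infer_instance
instance : D1 S On := by unfold On; infer_instance
theorem on_iff {x : M} : IsOrd ZM.E x ↔ On x := Iff.rfl
theorem On.mem {a x : M} (h : On a) (hx : x ε a) : On x := by
  refine ⟨fun y hy z hz => ?_, fun y z hy hz => h.2 _ _ (h.1 _ hx _ hy) (h.1 _ hx _ hz)⟩
  have hy' := h.1 _ hx _ hy
  rcases h.2 z x (h.1 _ hy' _ hz) hx with h1 | h1 | h1
  · grind
  · subst h1; exact absurd hz (nmem2 hy)
  · exact absurd h1 (nmem3 hz hy)
theorem On.tri {a b : M} (ha : On a) (hb : On b) : a ε b ∨ a = b ∨ b ε a := by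
  have key : ∀ a b : M, On a → On b → sub a b → a = b ∨ a ε b := by
    intro a b ha hb h
    by_cases e : a = b; · exact .inl e
    have : ∃ x, x ε sep b (fun x => ¬ x ε a) := by
      by_contra h2; push Not at h2
      exact e (sub_ext h fun z hz => by by_contra h3; exact h2 z (mem_sep.2 ⟨hz, h3⟩))
    obtain ⟨x, hx, hm⟩ := fnd this
    simp only [mem_sep] at hx hm
    right
    have : x = a := sub_ext
      (fun z hz => by by_contra h3; exact hm z hz ⟨hb.1 _ hx.1 _ hz, h3⟩)
      (fun z hz => by
        rcases hb.2 z x (h _ hz) hx.1 with h1 | h1 | h1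
        · exact h1
        · grind
        · exact absurd (ha.1 _ hz _ h1) hx.2)
    exact this ▸ hx.1
  set c := sep a (fun x => x ε b) with hc
  have hcm : ∀ z, z ε c ↔ z ε a ∧ z ε b := fun z => mem_sep
  have hco : On c := ⟨fun y hy z hz => (hcm z).2 ⟨ha.1 _ ((hcm y).1 hy).1 _ hz,
    hb.1 _ ((hcm y).1 hy).2 _ hz⟩, fun y z hy hz => ha.2 _ _ ((hcm y).1 hy).1 ((hcm z).1 hz).1⟩
  rcases key c a hco ha (fun z hz => ((hcm z).1 hz).1) with h1 | h1 <;>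
  rcases key c b hco hb (fun z hz => ((hcm z).1 hz).2) with h2 | h2
  · grind
  · left; rwa [← h1]
  · grind
  · exact absurd ((hcm c).2 ⟨h1, h2⟩) nmem_self
def le (a b : M) : Prop := a ε b ∨ a = b
instance : D2 S le := by unfold le; infer_instance
theorem le_iff {a b : M} (ha : On a) (hb : On b) : le a b ↔ sub a b := by
  constructor
  · rintro (h | rfl)
    · exact hb.1 _ h
    · exact fun _ h => h
  · intro h
    rcases ha.tri hb with h1 | h1 | h1
    · exact .inl h1
    · exact .inr h1
    · exact absurd (h _ h1) nmem_self
theorem nlt {a b : M} (ha : On a) (hb : On b) : ¬ a ε b ↔ le b a := by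
  have := ha.tri hb
  constructor
  · tauto
  · rintro (h | rfl) h'
    · exact nmem2 h h'
    · exact nmem_self h'
theorem on_emp : On (emp : M) := ⟨fun y h => by simp_all, fun y z h => by simp_all⟩
theorem On.sc {a : M} (h : On a) : On (sc a) := by
  refine ⟨fun y hy z hz => ?_, fun y z hy hz => ?_⟩
  · rcases mem_sc.1 hy with hy | rfl
    · exact mem_sc.2 (.inl (h.1 _ hy _ hz))
    · simp_all
  · rcases mem_sc.1 hy with hy | rfl <;> rcases mem_sc.1 hz with hz | rfl
    · exact h.2 _ _ hy hz
    · grind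
    · grind
    · grind
theorem on_of {a : M} (h : Tr a) (h' : ∀ x, x ε a → On x) : On a :=
  ⟨h, fun y z hy hz => (h' y hy).tri (h' z hz)⟩
theorem on_un {a : M} (h' : ∀ x, x ε a → On x) : On (un a) :=
  on_of (fun y hy z hz => by
    obtain ⟨w, hw, hy⟩ := mem_un.1 hy; exact mem_un.2 ⟨w, hw, (h' _ hw).1 _ hy _ hz⟩)
    (fun y hy => by obtain ⟨w, hw, hy⟩ := mem_un.1 hy; exact (h' _ hw).mem hy)
theorem mem_sc_le {a b : M} : a ε sc b ↔ le a b := mem_sc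
theorem sc_le {a b : M} (ha : On a) (hb : On b) : le (sc a) b ↔ a ε b := by
  rw [le_iff ha.sc hb]
  exact ⟨fun h => h _ (by simp), fun h z hz => by
    rcases mem_sc.1 hz with hz | rfl
    · exact hb.1 _ h _ hz
    · grind⟩
theorem lt_of_le_of_lt' {a b c : M} (hc : On c) (h : le a b) (h' : b ε c) : a ε c := by
  rcases h with h | rfl
  · exact hc.1 _ h' _ h
  · grind
theorem lt_of_lt_of_le' {a b c : M} (hc : On c) (h : a ε b) (h' : le b c) : a ε c := by
  rcases h' with h' | rfl
  · exact hc.1 _ h' _ h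
  · grind
theorem lst (Q : M → Prop) [D1 Tp Q] {a : M} (ha : On a) (h : Q a) :
    ∃ b, On b ∧ Q b ∧ (∀ c, c ε b → ¬ Q c) ∧ le b a := by
  obtain ⟨x, hx, hm⟩ := fnd (a := sep (sc a) Q) ⟨a, mem_sep.2 ⟨by simp, h⟩⟩
  simp only [mem_sep] at hx hm
  refine ⟨x, ha.sc.mem hx.1, hx.2, fun c hc hq => hm c hc ⟨ha.sc.1 _ hx.1 _ hc, hq⟩, mem_sc.1 hx.1⟩
theorem oind (Q : M → Prop) [D1 Tp Q] (h : ∀ a, On a → (∀ b, b ε a → Q b) → Q a) {a : M} (ha : On a) :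
    Q a := by
  by_contra h'
  obtain ⟨b, hb, hq, hm, _⟩ := lst (fun x => ¬ Q x) ha h'
  grind
def Lim (a : M) : Prop := On a ∧ (∃ y, y ε a) ∧ ∀ y, y ε a → sc y ε a
instance : D1 S Lim := by unfold Lim; infer_instance
theorem succ_iff {x s : M} : IsSuccOf ZM.E x s ↔ s = sc x :=
  ⟨fun h => eqx fun z => by rw [h z, mem_sc], by rintro rfl z; simp_all⟩
theorem lim_iff {x : M} : IsLimitOrd ZM.E x ↔ Lim x := by
  simp [IsLimitOrd, Lim, succ_iff, on_iff]
theorem zero_iff {x : M} : IsZero ZM.E x ↔ x = emp :=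
  ⟨fun h => eqx fun z => by simp [h.2 z], by rintro rfl; exact ⟨on_emp, by simp⟩⟩
theorem ocase {a : M} (h : On a) : a = emp ∨ (∃ b, b ε a ∧ On b ∧ a = sc b) ∨ Lim a := by
  by_cases h0 : ∃ y, y ε a
  · by_cases h1 : ∀ y, y ε a → sc y ε a
    · exact .inr (.inr ⟨h, h0, h1⟩)
    · push Not at h1; obtain ⟨y, hy, h1⟩ := h1
      refine .inr (.inl ⟨y, hy, h.mem hy, ?_⟩)
      rcases (sc_le (h.mem hy) h).2 hy with h2 | h2
      · grind
      · grind
  · exact .inl (eqx fun z => by simp_all)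
theorem ex_lim : ∃ w : M, Lim w ∧ ∀ x, x ε w → ¬ Lim x := by
  obtain ⟨w, ⟨z, hz, hz0⟩, hs⟩ := (ZM.ax (M := M)).infty
  have hs' : ∀ x, x ε w → sc x ε w := fun x hx => by
    obtain ⟨s, h, h'⟩ := hs x hx; rwa [succ_iff.1 h'] at h
  have hz : emp ε w := by
    have : z = emp := eqx fun u => by simp_all
    grind
  set o := sep w (fun x => On x ∧ ∀ y, y ε x → y ε w)
  have ho : ∀ x, x ε o ↔ x ε w ∧ On x ∧ ∀ y, y ε x → y ε w := fun x => mem_sep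
  have hl : Lim o := by
    refine ⟨on_of (fun y hy z hz' => ?_) (fun x hx => ((ho x).1 hx).2.1), ⟨emp, ?_⟩, fun y hy => ?_⟩
    · obtain ⟨h1, h2, h3⟩ := (ho y).1 hy
      exact (ho z).2 ⟨h3 _ hz', h2.mem hz', fun u hu => h3 _ (h2.1 _ hz' _ hu)⟩
    · exact (ho _).2 ⟨hz, on_emp, by simp⟩
    · obtain ⟨h1, h2, h3⟩ := (ho y).1 hy
      refine (ho _).2 ⟨hs' _ h1, h2.sc, fun u hu => ?_⟩
      rcases mem_sc.1 hu with hu | rfl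
      · grind
      · exact h1
  obtain ⟨b, hb, h1, h2, _⟩ := lst Lim hl.1 hl
  grind
def om : M := the (fun w => Lim w ∧ ∀ x, x ε w → ¬ Lim x)
instance (priority := 4000) om.df : DfF S (fun _ : Fin n → M => (om : M)) := by unfold om; infer_instance
theorem om_spec : Lim (om : M) ∧ ∀ x : M, x ε om → ¬ Lim x := by
  obtain ⟨w, h⟩ := ex_lim (M := M)
  have : om = w := the_eq h fun z hz => by
    rcases hz.1.1.tri h.1.1 with h1 | h1 | h1
    · grind
    · grind
    · grind
  grind
theorem emp_lim {a : M} (h : Lim a) : emp ε a := by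
  rcases h.1.tri on_emp with h1 | h1 | h1
  · simp_all
  · obtain ⟨y, hy⟩ := h.2.1; simp_all
  · grind
theorem emp_om : emp ε (om : M) := emp_lim om_spec.1
theorem sc_om {x : M} (h : x ε om) : sc x ε om := om_spec.1.2.2 _ h
theorem nind (Q : M → Prop) [D1 Tp Q] (h0 : Q emp) (hs : ∀ x, x ε om → Q x → Q (sc x)) {x : M} (hx : x ε om) :
    Q x := by
  refine oind (fun a => a ε om → Q a) (fun a ha ih hm => ?_) (om_spec.1.1.mem hx) hx
  rcases ocase ha with rfl | ⟨b, hb, _, rfl⟩ | hl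
  · grind
  · have := om_spec.1.1.1 _ hm _ hb; grind
  · exact absurd hl (om_spec.2 _ hm)
theorem on_max {a b : M} (ha : On a) (hb : On b) : On (bu a b) :=
  on_un (by simp_all)
theorem le_max {a b : M} (ha : On a) (hb : On b) : le a (bu a b) ∧ le b (bu a b) :=
  ⟨(le_iff ha (on_max ha hb)).2 fun z h => by simp_all, (le_iff hb (on_max ha hb)).2 fun z h => by simp_all⟩
end
noncomputable section
variable [ZM M] {S : M → Prop} {n : ℕ}
def att (pd : M → M → M) (G : M → M → M → M) (p d f : M) : Prop :=
  ∀ x, x ε d → sub (pd p x) d ∧ ap f x = G p x (gr (pd p x) (ap f))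
def wrec (pd : M → M → M) (G : M → M → M → M) (p x : M) : M :=
  the (fun y => ∃ d f, att pd G p d f ∧ x ε d ∧ y = ap f x)
section
variable {pd : M → M → M} {G : M → M → M → M}
instance [F2 S pd] [F3 S G] : D3 S (att pd G) := by unfold att; infer_instance
instance [F2 S pd] [F3 S G] : F2 S (wrec pd G) := by unfold wrec; infer_instance
variable [F2 Tp pd] [F3 Tp G] {Q : M → Prop} {p : M}
theorem att_uniq (hm : ∀ d, (∃ x, x ε d) → (∀ x, x ε d → Q x) → ∃ x, x ε d ∧ ∀ y, y ε pd p x → ¬ y ε d)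
    {d f d' f' x : M} (h : att pd G p d f) (h' : att pd G p d' f')
    (hd : ∀ x, x ε d → Q x) (hx : x ε d) (hx' : x ε d') : ap f x = ap f' x := by
  by_contra hne
  obtain ⟨z, hz, hm⟩ := hm (sep d (fun x => x ε d' ∧ ¬ ap f x = ap f' x)) ⟨x, mem_sep.2 ⟨hx, hx', hne⟩⟩
    (fun x hx => hd x (mem_sep.1 hx).1)
  simp only [mem_sep] at hz hm
  refine hz.2.2 ?_
  rw [(h z hz.1).2, (h' z hz.2.1).2, gr_eq]
  intro y hy
  by_contra hne
  exact hm y hy ⟨(h z hz.1).1 y hy, (h' z hz.2.1).1 y hy, hne⟩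
theorem wrec_att (hc : ∀ x, Q x → ∃ d, x ε d ∧ ∀ y, y ε d → Q y ∧ sub (pd p y) d)
    (hm : ∀ d, (∃ x, x ε d) → (∀ x, x ε d → Q x) → ∃ x, x ε d ∧ ∀ y, y ε pd p x → ¬ y ε d)
    {d f x : M} (h : att pd G p d f) (hx : x ε d) (hq : Q x) : wrec pd G p x = ap f x := by
  refine the_eq ⟨d, f, h, hx, rfl⟩ ?_
  rintro _ ⟨d', f', h', hx', rfl⟩
  obtain ⟨e, he, hc⟩ := hc x hq
  have hr : att pd G p (sep d (fun x => x ε e)) f := fun x hx => by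
    simp only [mem_sep] at hx
    exact ⟨fun y hy => mem_sep.2 ⟨(h x hx.1).1 y hy, (hc x hx.2).2 y hy⟩, (h x hx.1).2⟩
  exact (att_uniq hm hr h' (fun x hx => (hc x (mem_sep.1 hx).2).1) (mem_sep.2 ⟨hx, he⟩) hx').symm
theorem wrec_eq (hc : ∀ x, Q x → ∃ d, x ε d ∧ ∀ y, y ε d → Q y ∧ sub (pd p y) d)
    (hm : ∀ d, (∃ x, x ε d) → (∀ x, x ε d → Q x) → ∃ x, x ε d ∧ ∀ y, y ε pd p x → ¬ y ε d)
    {x : M} (hq : Q x) : wrec pd G p x = G p x (gr (pd p x) (wrec pd G p)) := by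
  have key : ∀ x, Q x → (∃ d f, att pd G p d f ∧ x ε d) → wrec pd G p x = G p x (gr (pd p x) (wrec pd G p)) := by
    rintro x hq ⟨d, f, h, hx⟩
    rw [wrec_att hc hm h hx hq, (h x hx).2, gr_eq (F := ap f)]
    intro y hy
    obtain ⟨e, he, hc'⟩ := hc x hq
    exact (wrec_att hc hm h ((h x hx).1 y hy) (hc' y ((hc' x he).2 y hy)).1).symm
  refine key x hq ?_
  obtain ⟨e, he, hc'⟩ := hc x hq
  by_contra hne
  obtain ⟨z, hz, hm'⟩ := hm (sep e (fun x => ¬ ∃ d f, att pd G p d f ∧ x ε d)) ⟨x, mem_sep.2 ⟨he, hne⟩⟩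
    (fun x hx => (hc' x (mem_sep.1 hx).1).1)
  simp only [mem_sep] at hz hm'
  have hcov : ∀ y, y ε pd p z → ∃ d f, att pd G p d f ∧ y ε d := fun y hy => by
    by_contra hh; exact hm' y hy ⟨(hc' z hz.1).2 y hy, hh⟩
  set d0 := sep e (fun x => ∃ d f, att pd G p d f ∧ x ε d) with hd0
  have md0 : ∀ x, x ε d0 ↔ x ε e ∧ ∃ d f, att pd G p d f ∧ x ε d := fun x => mem_sep
  refine hz.2 ⟨bu d0 (sg z), gr (bu d0 (sg z)) (fun y => G p y (gr (pd p y) (wrec pd G p))), ?_, by simp⟩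
  have hsub : ∀ y, y ε bu d0 (sg z) → ∀ u, u ε pd p y → u ε d0 := by
    intro y hy u hu
    rcases (by simpa using hy) with h1 | rfl
    · obtain ⟨h2, d, f, h3, h4⟩ := (md0 y).1 h1
      exact (md0 u).2 ⟨(hc' y h2).2 u hu, d, f, h3, (h3 y h4).1 u hu⟩
    · exact (md0 u).2 ⟨(hc' y hz.1).2 u hu, hcov u hu⟩
  intro y hy
  refine ⟨fun u hu => by simp [hsub y hy u hu], ?_⟩
  rw [ap_gr hy, gr_eq]
  intro u hu
  have h1 := hsub y hy u hu
  rw [ap_gr (by simp [h1])]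
  grind
end
def hG (F : M → M) (x a r : M) : M := bu x (un (img a (fun m => F (ap r m))))
def hr (F : M → M) (x a : M) : M := wrec (fun _ a => a) (hG F) x a
section
variable {F : M → M}
instance [F1 S F] : F3 S (hG F) := by unfold hG; infer_instance
instance [F1 S F] : F2 S (hr F) := by unfold hr; infer_instance
variable [F1 Tp F] {x a b z : M}
theorem ohc : ∀ a : M, On a → ∃ d, a ε d ∧ ∀ y, y ε d → On y ∧ sub y d := fun a h =>
  ⟨sc a, by simp, fun y hy => ⟨h.sc.mem hy, h.sc.1 y hy⟩⟩
theorem hr_eq (ha : On a) : hr F x a = hG F x a (gr a (hr F x)) :=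
  wrec_eq ohc (fun d h _ => fnd h) ha
theorem mem_hr (ha : On a) : z ε hr F x a ↔ z ε x ∨ ∃ m, m ε a ∧ z ε F (hr F x m) := by
  rw [hr_eq ha, hG, mem_bu, mem_un]
  refine or_congr Iff.rfl ⟨?_, ?_⟩
  · rintro ⟨y, h, h'⟩
    obtain ⟨m, hm, rfl⟩ := mem_img.1 h
    rw [ap_gr hm] at h'; grind
  · rintro ⟨m, hm, h⟩
    exact ⟨_, mem_img.2 ⟨m, hm, rfl⟩, by rwa [ap_gr hm]⟩
theorem hr_sub (hb : On b) (h : sub a b) (ha : On a) : sub (hr F x a) (hr F x b) := fun z hz => by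
  rw [mem_hr ha] at hz; rw [mem_hr hb]
  rcases hz with hz | ⟨m, hm, hz⟩
  · grind
  · exact .inr ⟨m, h _ hm, hz⟩
theorem hr_le (ha : On a) (hb : On b) (h : le a b) : sub (hr F x a) (hr F x b) :=
  hr_sub hb ((le_iff ha hb).1 h) ha
theorem hr_emp : hr F x emp = x := eqx fun z => by rw [mem_hr on_emp]; simp
theorem hr_base (ha : On a) : sub x (hr F x a) := fun z h => (mem_hr ha).2 (.inl h)
theorem hr_sc (ha : On a) : hr F x (sc a) = bu (hr F x a) (F (hr F x a)) := eqx fun z => by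
  rw [mem_hr ha.sc, mem_bu, mem_hr ha]
  constructor
  · rintro (h | ⟨m, hm, h⟩)
    · grind
    · rcases mem_sc.1 hm with hm | rfl
      · grind
      · grind
  · rintro ((h | ⟨m, hm, h⟩) | h)
    · grind
    · exact .inr ⟨m, by simp_all⟩
    · simp_all
theorem hr_lim (ha : Lim a) : z ε hr F x a ↔ ∃ m, m ε a ∧ z ε hr F x m := by
  constructor
  · intro h
    rcases (mem_hr ha.1).1 h with h | ⟨m, hm, h⟩
    · obtain ⟨y, hy⟩ := ha.2.1; exact ⟨y, hy, hr_base (ha.1.mem hy) _ h⟩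
    · exact ⟨sc m, ha.2.2 _ hm, by rw [hr_sc (ha.1.mem hm)]; simp_all⟩
  · rintro ⟨m, hm, h⟩; exact hr_le (ha.1.mem hm) ha.1 (.inl hm) _ h
theorem hr_lim2 (ha : Lim a) {w : M} (hz : z ε hr F x a) (hw : w ε hr F x a) :
    ∃ m, m ε a ∧ z ε hr F x m ∧ w ε hr F x m := by
  obtain ⟨m, hm, hz⟩ := (hr_lim ha).1 hz
  obtain ⟨m', hm', hw⟩ := (hr_lim ha).1 hw
  have o := ha.1.mem hm; have o' := ha.1.mem hm'
  rcases o.tri o' with h | rfl | h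
  · exact ⟨m', hm', hr_le o o' (.inl h) _ hz, hw⟩
  · grind
  · exact ⟨m, hm, hz, hr_le o' o (.inl h) _ hw⟩
theorem hr_cl (Q : M → Prop) [D1 Tp Q] (hx : ∀ z, z ε x → Q z)
    (hF : ∀ m, On m → (∀ z, z ε hr F x m → Q z) → ∀ z, z ε F (hr F x m) → Q z) (ha : On a) : ∀ z, z ε hr F x a → Q z := by
  refine oind (fun a => ∀ z, z ε hr F x a → Q z) (fun a ha ih z hz => ?_) ha
  rcases (mem_hr ha).1 hz with h | ⟨m, hm, h⟩
  · grind
  · exact hF m (ha.mem hm) (ih m hm) z h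
theorem hr_tr (hx : Tr x) (hF : ∀ c, Tr c → ∀ y, y ε F c → sub y c) (ha : On a) : Tr (hr F x a) := by
  refine oind (fun a => Tr (hr F x a)) (fun a ha ih y hy => ?_) ha
  rcases (mem_hr ha).1 hy with h | ⟨m, hm, h⟩
  · exact fun z hz => hr_base ha _ (hx y h z hz)
  · exact fun z hz => hr_le (ha.mem hm) ha (.inl hm) _ (hF _ (ih m hm) _ h z hz)
end
def trc (x : M) : M := hr un x om
instance : F1 S trc := by unfold trc; infer_instance
theorem omn : On (om : M) := om_spec.1.1
theorem tr_trc (x : M) : Tr (trc x) := fun y hy z hz => by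
  obtain ⟨m, hm, h⟩ := (hr_lim om_spec.1).1 hy
  exact (hr_lim om_spec.1).2 ⟨sc m, sc_om hm, by rw [hr_sc (omn.mem hm)]; simp; grind⟩
theorem sub_trc (x : M) : sub x (trc x) := hr_base omn
theorem trc_least {x t : M} (h : sub x t) (ht : Tr t) : sub (trc x) t :=
  hr_cl (fun z => z ε t) h (fun m hm h z hz => by
    obtain ⟨y, hy, hz⟩ := mem_un.1 hz; exact ht _ (h y hy) _ hz) omn
theorem einduct (Q : M → Prop) [D1 Tp Q] (h : ∀ x, (∀ y, y ε x → Q y) → Q x) (x : M) : Q x := by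
  by_contra hx
  obtain ⟨y, hy, hm⟩ := fnd (a := sep (trc (sg x)) (fun y => ¬ Q y))
    ⟨x, mem_sep.2 ⟨sub_trc _ _ (by simp), hx⟩⟩
  simp only [mem_sep] at hy hm
  exact hy.2 (h y fun z hz => by by_contra hh; exact hm z hz ⟨tr_trc _ _ hy.1 _ hz, hh⟩)
theorem ehc (Q : M → Prop) {pd : M → M → M} {p : M} (hp : ∀ x, sub (pd p x) x) :
    ∀ x : M, True → ∃ d, x ε d ∧ ∀ y, y ε d → True ∧ sub (pd p y) d := fun x _ =>
  ⟨trc (sg x), sub_trc _ _ (by simp), fun y hy => ⟨trivial, fun z hz => tr_trc _ _ hy _ (hp _ _ hz)⟩⟩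
theorem erec_eq {pd : M → M → M} {G : M → M → M → M} [F2 Tp pd] [F3 Tp G] {p : M}
    (hp : ∀ x, sub (pd p x) x) (x : M) : wrec pd G p x = G p x (gr (pd p x) (wrec pd G p)) :=
  wrec_eq (ehc (fun _ => True) hp)
    (fun d h _ => by obtain ⟨x, hx, h⟩ := fnd h; exact ⟨x, hx, fun y hy => h y (hp _ _ hy)⟩) trivial
def dif (x y : M) : M := sep x (fun z => ¬ z ε y)
def int (x y : M) : M := sep x (fun z => z ε y)
def mmr (x y : M) : M := sep (cp x y) (fun p => fst p ε snd p)
def fld (x : M) : M := un (un x)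
def dmn (x : M) : M := sep (fld x) (fun z => ∃ y, kp z y ε x)
def cnv (x : M) : M := sep (cp (fld x) (fld x)) (fun z => kp (snd z) (fst z) ε x)
def fl2 (x : M) : M := cp (bu (fld x) (fld (fld x))) (cp (bu (fld x) (fld (fld x))) (bu (fld x) (fld (fld x))))
def pm1 (x : M) : M := sep (fl2 x) (fun z => kp (fst z) (kp (snd (snd z)) (fst (snd z))) ε x)
def pm2 (x : M) : M := sep (fl2 x) (fun z => kp (fst (snd z)) (kp (snd (snd z)) (fst z)) ε x)
instance : F2 S dif := by unfold dif; infer_instance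
instance : F2 S int := by unfold int; infer_instance
instance : F2 S mmr := by unfold mmr; infer_instance
instance : F1 S fld := by unfold fld; infer_instance
instance : F1 S fl2 := by unfold fl2; infer_instance
instance : F1 S dmn := by unfold dmn; infer_instance
instance : F1 S cnv := by unfold cnv; infer_instance
instance : F1 S pm1 := by unfold pm1; infer_instance
instance : F1 S pm2 := by unfold pm2; infer_instance
theorem mem_dif {x y z : M} : z ε dif x y ↔ z ε x ∧ ¬ z ε y := mem_sep
theorem mem_int {x y z : M} : z ε int x y ↔ z ε x ∧ z ε y := mem_sep
theorem mem_mmr {x y z : M} : z ε mmr x y ↔ ∃ u v, u ε x ∧ v ε y ∧ u ε v ∧ z = kp u v := by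
  simp only [mmr, mem_sep]
  constructor
  · simp_all
  · simp_all
theorem fld1 {x u v : M} (h : kp u v ε x) : u ε fld x ∧ v ε fld x := by
  simp only [fld, mem_un]
  exact ⟨⟨_, ⟨_, h, mem_pr.2 (.inl rfl)⟩, by simp⟩, ⟨_, ⟨_, h, mem_pr.2 (.inr rfl)⟩, by simp⟩⟩
theorem mem_dmn {x z : M} : z ε dmn x ↔ ∃ y, kp z y ε x := by
  rw [dmn, mem_sep]; exact ⟨fun h => h.2, fun ⟨y, h⟩ => ⟨(fld1 h).1, y, h⟩⟩
theorem mem_cnv {x z : M} : z ε cnv x ↔ ∃ u v, kp u v ε x ∧ z = kp v u := by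
  simp only [cnv, mem_sep, mem_cp]
  constructor
  · simp_all
  · rintro ⟨u, v, h, rfl⟩; exact ⟨⟨_, _, (fld1 h).2, (fld1 h).1, rfl⟩, by simpa⟩
theorem fld2 {x u v w a b c : M} (h : kp u (kp v w) ε x) (ha : a = u ∨ a = v ∨ a = w) (hb : b = u ∨ b = v ∨ b = w)
    (hc : c = u ∨ c = v ∨ c = w) : kp a (kp b c) ε fl2 x := by
  have h1 : ∀ a, (a = u ∨ a = v ∨ a = w) → a ε bu (fld x) (fld (fld x)) := by
    rintro a (rfl | rfl | rfl)
    · exact mem_bu.2 (.inl (fld1 h).1)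
    · exact mem_bu.2 (.inr (fld1 (fld1 h).2).1)
    · exact mem_bu.2 (.inr (fld1 (fld1 h).2).2)
  exact mem_cp.2 ⟨_, _, h1 a ha, mem_cp.2 ⟨_, _, h1 b hb, h1 c hc, rfl⟩, rfl⟩
theorem mem_pm1 {x z : M} : z ε pm1 x ↔ ∃ u v w, kp u (kp w v) ε x ∧ z = kp u (kp v w) := by
  rw [pm1, mem_sep]
  constructor
  · rintro ⟨h, h'⟩
    obtain ⟨u, p, hu, hp, rfl⟩ := mem_cp.1 h; obtain ⟨v, w, hv, hw, rfl⟩ := mem_cp.1 hp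
    simp_all
  · rintro ⟨u, v, w, h, rfl⟩; exact ⟨fld2 h (by simp) (by simp) (by simp), by simpa⟩
theorem mem_pm2 {x z : M} : z ε pm2 x ↔ ∃ u v w, kp v (kp w u) ε x ∧ z = kp u (kp v w) := by
  rw [pm2, mem_sep]
  constructor
  · rintro ⟨h, h'⟩
    obtain ⟨u, p, hu, hp, rfl⟩ := mem_cp.1 h; obtain ⟨v, w, hv, hw, rfl⟩ := mem_cp.1 hp
    simp_all
  · rintro ⟨u, v, w, h, rfl⟩; exact ⟨fld2 h (by simp) (by simp) (by simp), by simpa⟩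
def gop : Fin 10 → M → M → M :=
  ![pr, cp, mmr, dif, int, fun x _ => un x, fun x _ => dmn x, fun x _ => cnv x, fun x _ => pm1 x, fun x _ => pm2 x]
instance gop.df (i : Fin 10) : F2 S (gop i : M → M → M) := match i with
  | 0 => (inferInstance : F2 S pr)
  | 1 => (inferInstance : F2 S cp)
  | 2 => (inferInstance : F2 S mmr)
  | 3 => (inferInstance : F2 S dif)
  | 4 => (inferInstance : F2 S int)
  | 5 => (inferInstance : F2 S (fun x _ => un x))
  | 6 => (inferInstance : F2 S (fun x _ => dmn x))
  | 7 => (inferInstance : F2 S (fun x _ => cnv x))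
  | 8 => (inferInstance : F2 S (fun x _ => pm1 x))
  | 9 => (inferInstance : F2 S (fun x _ => pm2 x))
def gnot (z x y : M) : Prop := ∀ i, ¬ z = gop i x y
instance : D3 S gnot := ⟨Df.fin fun i => inferInstance⟩
def gst (c : M) : M := st (fun z => ∃ x y, x ε c ∧ y ε c ∧ ¬ gnot z x y)
instance : F1 S gst := by unfold gst; infer_instance
theorem mem_gst {c z : M} : z ε gst c ↔ ∃ x y, x ε c ∧ y ε c ∧ ∃ i, z = gop i x y := by
  let g : Fin 10 → M := fun i => img (cp c c) (fun p => gop i (fst p) (snd p))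
  rw [gst, mem_st (bu (bu (bu (g 0) (g 1)) (bu (g 2) (g 3))) (bu (bu (g 4) (g 5)) (bu (bu (g 6) (g 7)) (bu (g 8) (g 9)))))]
  · simp [gnot]
  · rintro z ⟨x, y, hx, hy, h⟩
    simp only [gnot, not_forall, not_not] at h
    obtain ⟨i, rfl⟩ := h
    have h2 : gop i x y ε g i := mem_img.2 ⟨kp x y, mem_cp.2 ⟨x, y, hx, hy, rfl⟩, by simp⟩
    fin_cases i <;> simp only [mem_bu] <;> tauto
def gcl (b : M) : M := hr gst b om
instance : F1 S gcl := by unfold gcl; infer_instance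
def gcd (c : M) : Prop := ∀ i x y, x ε c → y ε c → gop i x y ε c
theorem gcd_gcl (b : M) : gcd (gcl b) := fun i x y hx hy => by
  obtain ⟨m, hm, h, h'⟩ := hr_lim2 om_spec.1 hx hy
  exact (hr_lim om_spec.1).2 ⟨sc m, sc_om hm, by
    rw [hr_sc (omn.mem hm), mem_bu]; exact .inr (mem_gst.2 ⟨x, y, h, h', i, rfl⟩)⟩
theorem sub_gcl (b : M) : sub b (gcl b) := hr_base omn
theorem gcl_least {b c : M} (h : sub b c) (hc : gcd c) : sub (gcl b) c :=
  hr_cl (fun z => z ε c) h (fun m hm h z hz => by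
    obtain ⟨x, y, hx, hy, i, rfl⟩ := mem_gst.1 hz; exact hc i x y (h x hx) (h y hy)) omn
def dfs (l : M) : M := sep (pw l) (fun y => y ε gcl (sc l))
instance : F1 S dfs := by unfold dfs; infer_instance
theorem mem_dfs {l y : M} : y ε dfs l ↔ sub y l ∧ y ε gcl (sc l) := by rw [dfs, mem_sep, mem_pw]
def L0 (b : M) : M := bu (trc b) (sg b)
instance : F1 S L0 := by unfold L0; infer_instance
def Lf (b a : M) : M := hr dfs (L0 b) a
instance : F2 S Lf := by unfold Lf; infer_instance
def Vf (a : M) : M := hr pw emp a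
instance : F1 S Vf := by unfold Vf; infer_instance
theorem tr_L0 (b : M) : Tr (L0 b) := fun y hy z hz => by
  rcases (by simpa [L0] using hy) with h | rfl
  · simp [L0, tr_trc _ _ h _ hz]
  · simp [L0, sub_trc _ _ hz]
theorem mem_L0 (b : M) : b ε L0 b := by simp [L0]
theorem tr_Lf {b a : M} (ha : On a) : Tr (Lf b a) :=
  hr_tr (tr_L0 b) (fun c _ y hy => (mem_dfs.1 hy).1) ha
theorem tr_Vf {a : M} (ha : On a) : Tr (Vf a) :=
  hr_tr (by intro y h; simp at h) (fun c _ y hy => mem_pw.1 hy) ha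
theorem Lf_sc {b a : M} (ha : On a) : Lf b (sc a) = dfs (Lf b a) := by
  rw [Lf, hr_sc ha]
  refine eqx fun z => ?_
  rw [mem_bu]
  refine or_iff_right_of_imp fun h => mem_dfs.2 ⟨tr_Lf ha _ h, sub_gcl _ _ (mem_sc.2 (.inl h))⟩
theorem Vf_sc {a : M} (ha : On a) : Vf (sc a) = pw (Vf a) := by
  rw [Vf, hr_sc ha]
  refine eqx fun z => ?_
  rw [mem_bu]
  refine or_iff_right_of_imp fun h => mem_pw.2 (tr_Vf ha _ h)
end
noncomputable section
section
variable [ZM M] {S : M → Prop} {n : ℕ}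
theorem mem_ap {f x z : M} : z ε ap f x ↔ ∃ y, kp x y ε f ∧ z ε y := by
  rw [ap, the, mem_un]
  constructor
  · rintro ⟨y, h, hz⟩; exact ⟨y, (mem_st (fld f) (fun z h => (fld1 h).2)).1 h, hz⟩
  · rintro ⟨y, h, hz⟩; exact ⟨y, (mem_st (fld f) (fun z h => (fld1 h).2)).2 h, hz⟩
def IL (b x : M) : Prop := ∃ a, On a ∧ x ε Lf b a
instance : D2 S IL := by unfold IL; infer_instance
end
structure Tri {T M : Type} [ZM T] [ZM M] (ι : T → M) : Prop where
  e : ∀ x y, ι x ε ι y ↔ x ε y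
  t : ∀ x y, y ε ι x → ∃ z, y = ι z
namespace Tri
variable {T M : Type} [ZM T] [ZM M] {ι : T → M} (h : Tri ι)
include h
theorem inj {x y : T} : ι x = ι y ↔ x = y :=
  ⟨fun e => eqx fun z => by rw [← h.e, ← h.e, e], fun e => e ▸ rfl⟩
theorem eq {x : T} {y : M} (h1 : ∀ z, ι z ε y ↔ z ε x) (h2 : ∀ w, w ε y → ∃ z, w = ι z) : ι x = y :=
  eqx fun z => ⟨fun hz => by obtain ⟨w, rfl⟩ := h.t _ _ hz; exact (h1 w).2 ((h.e _ _).1 hz),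
    fun hz => by obtain ⟨w, rfl⟩ := h2 _ hz; exact (h.e _ _).2 ((h1 w).1 hz)⟩
theorem all {x : T} {Q : M → Prop} : (∀ y, y ε ι x → Q y) ↔ ∀ y, y ε x → Q (ι y) :=
  ⟨fun k y hy => k _ ((h.e _ _).2 hy), fun k y hy => by
    obtain ⟨z, rfl⟩ := h.t _ _ hy; exact k z ((h.e _ _).1 hy)⟩
theorem ex {x : T} {Q : M → Prop} : (∃ y, y ε ι x ∧ Q y) ↔ ∃ y, y ε x ∧ Q (ι y) :=
  ⟨fun ⟨y, hy, k⟩ => by obtain ⟨z, rfl⟩ := h.t _ _ hy; exact ⟨z, (h.e _ _).1 hy, k⟩,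
    fun ⟨y, hy, k⟩ => ⟨_, (h.e _ _).2 hy, k⟩⟩
theorem sub {x y : T} : sub (ι x) (ι y) ↔ sub x y := by
  unfold ZFI0.sub; rw [h.all]; simp only [h.e]
theorem emp : ι emp = emp := h.eq (fun z => by simp) (fun w hw => by simp_all)
theorem pr (x y : T) : ι (pr x y) = pr (ι x) (ι y) :=
  h.eq (fun z => by simp [h.inj]) (fun w hw => by
    rcases mem_pr.1 hw with rfl | rfl
    exacts [⟨_, rfl⟩, ⟨_, rfl⟩])
theorem sg (x : T) : ι (sg x) = sg (ι x) := h.pr x x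
theorem un (x : T) : ι (un x) = un (ι x) :=
  h.eq (fun z => by rw [mem_un, mem_un, h.ex]; simp only [h.e]) (fun w hw => by
    obtain ⟨y, hy, hw⟩ := mem_un.1 hw
    obtain ⟨y, rfl⟩ := h.t _ _ hy; exact h.t _ _ hw)
theorem bu (x y : T) : ι (bu x y) = bu (ι x) (ι y) := by
  unfold ZFI0.bu; rw [h.un, h.pr]
theorem kp (x y : T) : ι (kp x y) = kp (ι x) (ι y) := by
  unfold ZFI0.kp; rw [h.pr, h.sg, h.pr]
theorem sc (x : T) : ι (sc x) = sc (ι x) := by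
  unfold ZFI0.sc; rw [h.bu, h.sg]
theorem kpm {x y f : T} : ZFI0.kp (ι x) (ι y) ε ι f ↔ ZFI0.kp x y ε f := by rw [← h.kp, h.e]
theorem kpi {x y z : T} : ι z = ZFI0.kp (ι x) (ι y) ↔ z = ZFI0.kp x y := by rw [← h.kp, h.inj]
theorem kpr {u v : M} {f : T} (k : ZFI0.kp u v ε ι f) : ∃ x y, u = ι x ∧ v = ι y := by
  have := fld1 k
  unfold fld at this
  rw [← h.un, ← h.un] at this
  obtain ⟨x, hx⟩ := h.t _ _ this.1
  obtain ⟨y, hy⟩ := h.t _ _ this.2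
  grind
theorem kpr3 {u v w : M} {f : T} (k : ZFI0.kp u (ZFI0.kp v w) ε ι f) : ∃ x y z, u = ι x ∧ v = ι y ∧ w = ι z := by
  obtain ⟨x, p, rfl, h2⟩ := h.kpr k
  have : ZFI0.kp v w ε ι (ZFI0.sg p) := by rw [h.sg, ← h2]; simp
  obtain ⟨y, z, rfl, rfl⟩ := h.kpr this
  grind
theorem cp (x y : T) : ι (cp x y) = cp (ι x) (ι y) :=
  h.eq (fun z => by
    rw [mem_cp, mem_cp]
    constructor
    · rintro ⟨u, v, hu, hv, e⟩
      obtain ⟨u, rfl⟩ := h.t _ _ hu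
      obtain ⟨v, rfl⟩ := h.t _ _ hv
      exact ⟨u, v, (h.e _ _).1 hu, (h.e _ _).1 hv, h.kpi.1 e⟩
    · rintro ⟨u, v, hu, hv, rfl⟩
      exact ⟨_, _, (h.e _ _).2 hu, (h.e _ _).2 hv, h.kp _ _⟩) (fun w hw => by
    obtain ⟨u, v, hu, hv, rfl⟩ := mem_cp.1 hw
    obtain ⟨u, rfl⟩ := h.t _ _ hu
    obtain ⟨v, rfl⟩ := h.t _ _ hv
    exact ⟨_, (h.kp _ _).symm⟩)
theorem ap (x y : T) : ι (ap x y) = ap (ι x) (ι y) :=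
  h.eq (fun z => by
    rw [mem_ap, mem_ap]
    constructor
    · rintro ⟨u, hu, hv⟩
      obtain ⟨_, u, _, rfl⟩ := h.kpr hu
      exact ⟨u, h.kpm.1 hu, (h.e _ _).1 hv⟩
    · rintro ⟨u, hu, hv⟩
      exact ⟨_, h.kpm.2 hu, (h.e _ _).2 hv⟩) (fun w hw => by
    obtain ⟨u, hu, hv⟩ := mem_ap.1 hw
    obtain ⟨_, u, _, rfl⟩ := h.kpr hu
    exact h.t _ _ hv)
theorem dif (x y : T) : ι (dif x y) = dif (ι x) (ι y) :=
  h.eq (fun z => by rw [mem_dif, mem_dif, h.e, h.e]) (fun w hw => h.t _ _ (mem_dif.1 hw).1)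
theorem int (x y : T) : ι (int x y) = int (ι x) (ι y) :=
  h.eq (fun z => by rw [mem_int, mem_int, h.e, h.e]) (fun w hw => h.t _ _ (mem_int.1 hw).1)
theorem mmr (x y : T) : ι (mmr x y) = mmr (ι x) (ι y) :=
  h.eq (fun z => by
    rw [mem_mmr, mem_mmr]
    constructor
    · rintro ⟨u, v, hu, hv, k, e⟩
      obtain ⟨u, rfl⟩ := h.t _ _ hu
      obtain ⟨v, rfl⟩ := h.t _ _ hv
      exact ⟨u, v, (h.e _ _).1 hu, (h.e _ _).1 hv, (h.e _ _).1 k, h.kpi.1 e⟩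
    · rintro ⟨u, v, hu, hv, k, rfl⟩
      exact ⟨_, _, (h.e _ _).2 hu, (h.e _ _).2 hv, (h.e _ _).2 k, h.kp _ _⟩) (fun w hw => by
    obtain ⟨u, v, hu, hv, _, rfl⟩ := mem_mmr.1 hw
    obtain ⟨u, rfl⟩ := h.t _ _ hu
    obtain ⟨v, rfl⟩ := h.t _ _ hv
    exact ⟨_, (h.kp _ _).symm⟩)
theorem dmn (x : T) : ι (dmn x) = dmn (ι x) :=
  h.eq (fun z => by
    rw [mem_dmn, mem_dmn]
    exact ⟨fun ⟨y, hy⟩ => by obtain ⟨_, u, _, rfl⟩ := h.kpr hy; exact ⟨u, h.kpm.1 hy⟩,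
      fun ⟨y, hy⟩ => ⟨_, h.kpm.2 hy⟩⟩) (fun w hw => by
    obtain ⟨y, hy⟩ := mem_dmn.1 hw; obtain ⟨u, _, rfl, _⟩ := h.kpr hy; grind)
theorem cnv (x : T) : ι (cnv x) = cnv (ι x) :=
  h.eq (fun z => by
    rw [mem_cnv, mem_cnv]
    constructor
    · rintro ⟨u, v, k, e⟩
      obtain ⟨u, v, rfl, rfl⟩ := h.kpr k
      exact ⟨u, v, h.kpm.1 k, h.kpi.1 e⟩
    · rintro ⟨u, v, k, rfl⟩
      exact ⟨_, _, h.kpm.2 k, h.kp _ _⟩) (fun w hw => by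
    obtain ⟨u, v, k, rfl⟩ := mem_cnv.1 hw
    obtain ⟨u, v, rfl, rfl⟩ := h.kpr k
    exact ⟨_, (h.kp _ _).symm⟩)
theorem pm1 (x : T) : ι (pm1 x) = pm1 (ι x) :=
  h.eq (fun z => by
    rw [mem_pm1, mem_pm1]
    constructor
    · rintro ⟨u, v, w, k, e⟩
      obtain ⟨u, w, v, rfl, rfl, rfl⟩ := h.kpr3 k
      rw [← h.kp, h.kpm] at k; rw [← h.kp, h.kpi] at e
      grind
    · rintro ⟨u, v, w, k, rfl⟩
      exact ⟨ι u, ι v, ι w, by rw [← h.kp, h.kpm]; exact k, by rw [h.kp, h.kp]⟩) (fun w hw => by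
    obtain ⟨u, v, w, k, rfl⟩ := mem_pm1.1 hw
    obtain ⟨u, w, v, rfl, rfl, rfl⟩ := h.kpr3 k
    exact ⟨_, by rw [← h.kp, ← h.kp]⟩)
theorem pm2 (x : T) : ι (pm2 x) = pm2 (ι x) :=
  h.eq (fun z => by
    rw [mem_pm2, mem_pm2]
    constructor
    · rintro ⟨u, v, w, k, e⟩
      obtain ⟨v, w, u, rfl, rfl, rfl⟩ := h.kpr3 k
      rw [← h.kp, h.kpm] at k; rw [← h.kp, h.kpi] at e
      grind
    · rintro ⟨u, v, w, k, rfl⟩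
      exact ⟨ι u, ι v, ι w, by rw [← h.kp, h.kpm]; exact k, by rw [h.kp, h.kp]⟩) (fun w hw => by
    obtain ⟨u, v, w, k, rfl⟩ := mem_pm2.1 hw
    obtain ⟨u, w, v, rfl, rfl, rfl⟩ := h.kpr3 k
    exact ⟨_, by rw [← h.kp, ← h.kp]⟩)
theorem gop (i : Fin 10) (x y : T) : ι (gop i x y) = gop i (ι x) (ι y) := match i with
  | 0 => h.pr x y
  | 1 => h.cp x y
  | 2 => h.mmr x y
  | 3 => h.dif x y
  | 4 => h.int x y
  | 5 => h.un x
  | 6 => h.dmn x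
  | 7 => h.cnv x
  | 8 => h.pm1 x
  | 9 => h.pm2 x
theorem gst (c : T) : ι (gst c) = gst (ι c) :=
  h.eq (fun z => by
    rw [mem_gst, mem_gst]
    constructor
    · rintro ⟨u, v, hu, hv, i, e⟩
      obtain ⟨u, rfl⟩ := h.t _ _ hu
      obtain ⟨v, rfl⟩ := h.t _ _ hv
      rw [← h.gop, h.inj] at e
      exact ⟨u, v, (h.e _ _).1 hu, (h.e _ _).1 hv, i, e⟩
    · rintro ⟨u, v, hu, hv, i, rfl⟩
      exact ⟨_, _, (h.e _ _).2 hu, (h.e _ _).2 hv, i, h.gop _ _ _⟩) (fun w hw => by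
    obtain ⟨u, v, hu, hv, i, rfl⟩ := mem_gst.1 hw
    obtain ⟨u, rfl⟩ := h.t _ _ hu
    obtain ⟨v, rfl⟩ := h.t _ _ hv
    exact ⟨_, (h.gop _ _ _).symm⟩)
theorem tr {a : T} : Tr (ι a) ↔ Tr a := by unfold Tr; rw [h.all]; simp only [h.sub]
theorem on {a : T} : On (ι a) ↔ On a := by
  unfold On; rw [h.tr]
  refine and_congr Iff.rfl ⟨fun k y z hy hz => ?_, fun k y z hy hz => ?_⟩
  · have := k _ _ ((h.e _ _).2 hy) ((h.e _ _).2 hz); rwa [h.e, h.e, h.inj] at this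
  · obtain ⟨y, rfl⟩ := h.t _ _ hy
    obtain ⟨z, rfl⟩ := h.t _ _ hz
    rw [h.e, h.e, h.inj]; exact k _ _ ((h.e _ _).1 hy) ((h.e _ _).1 hz)
theorem le {a b : T} : le (ι a) (ι b) ↔ le a b := by unfold ZFI0.le; rw [h.e, h.inj]
theorem lim {a : T} : Lim (ι a) ↔ Lim a := by
  unfold Lim; rw [h.on, h.all]
  refine and_congr Iff.rfl (and_congr ?_ ?_)
  · have := h.ex (x := a) (Q := fun _ => True); grind
  · simp only [← h.sc, h.e]
theorem om : ι om = om := by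
  have k := om_spec (M := T)
  have k' := om_spec (M := M)
  have k1 : Lim (ι ZFI0.om) := h.lim.2 k.1
  rcases k1.1.tri k'.1.1 with h1 | h1 | h1
  · grind
  · grind
  · obtain ⟨z, e⟩ := h.t _ _ h1
    rw [e] at h1 k'
    exact (k.2 _ ((h.e _ _).1 h1) (h.lim.1 k'.1)).elim
theorem hr {F : T → T} {F' : M → M} [F1 Tp F] [F1 Tp F'] (hF : ∀ x, ι (F x) = F' (ι x)) {x a : T} (ha : On a) :
    ι (hr F x a) = hr F' (ι x) (ι a) := by
  let g := ι (gr (ZFI0.sc a) (ZFI0.hr F x))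
  have hg : ∀ m, m ε ZFI0.sc a → ZFI0.ap g (ι m) = ι (ZFI0.hr F x m) := fun m hm => by
    rw [← h.ap, ap_gr hm]
  have key : ∀ m, On m → m ε ι (ZFI0.sc a) → ZFI0.ap g m = ZFI0.hr F' (ι x) m := fun m hm =>
    oind (fun m => m ε ι (ZFI0.sc a) → ZFI0.ap g m = ZFI0.hr F' (ι x) m) (fun m hm ih hma => by
      obtain ⟨m, rfl⟩ := h.t _ _ hma
      have hma' := (h.e _ _).1 hma
      have hmo := h.on.1 hm
      have ih' : ∀ y, y ε m → ι (ZFI0.hr F x y) = ZFI0.hr F' (ι x) (ι y) := fun y hy => by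
        have hy2 := ha.sc.1 _ hma' _ hy
        rw [← hg y hy2, ih _ ((h.e _ _).2 hy) ((h.e _ _).2 hy2)]
      rw [hg m hma']
      refine h.eq (fun z => ?_) (fun w hw => ?_)
      · rw [mem_hr hm, mem_hr hmo, h.e, h.ex]
        refine or_congr Iff.rfl (exists_congr fun y => and_congr_right fun hy => ?_)
        rw [← ih' y hy, ← hF, h.e]
      · rw [mem_hr hm, h.ex] at hw
        rcases hw with hw | ⟨y, hy, hw⟩
        · exact h.t _ _ hw
        · rw [← ih' y hy, ← hF] at hw; exact h.t _ _ hw) hm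
  rw [← hg a (by simp), key _ (h.on.2 ha) ((h.e _ _).2 (by simp))]
theorem trc (x : T) : ι (trc x) = trc (ι x) := by
  unfold ZFI0.trc; rw [h.hr (F' := ZFI0.un) h.un omn, h.om]
theorem gcl (x : T) : ι (gcl x) = gcl (ι x) := by
  unfold ZFI0.gcl; rw [h.hr (F' := ZFI0.gst) h.gst omn, h.om]
theorem dfs (x : T) : ι (dfs x) = dfs (ι x) :=
  h.eq (fun z => by rw [mem_dfs, mem_dfs, h.sub, ← h.sc, ← h.gcl, h.e]) (fun w hw => by
    rw [mem_dfs, ← h.sc, ← h.gcl] at hw; exact h.t _ _ hw.2)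
theorem L0 (x : T) : ι (L0 x) = L0 (ι x) := by
  unfold ZFI0.L0; rw [h.bu, h.trc, h.sg]
theorem Lf (b : T) {a : T} (ha : On a) : ι (Lf b a) = Lf (ι b) (ι a) := by
  unfold ZFI0.Lf; rw [h.hr (F' := ZFI0.dfs) h.dfs ha, h.L0]
theorem IL (ho : ∀ a : M, On a → ∃ a', a = ι a') (b x : T) : IL (ι b) (ι x) ↔ IL b x := by
  constructor
  · rintro ⟨a, ha, hx⟩
    obtain ⟨a, rfl⟩ := ho a ha
    rw [h.on] at ha
    rw [← h.Lf b ha, h.e] at hx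
    exact ⟨a, ha, hx⟩
  · rintro ⟨a, ha, hx⟩
    exact ⟨ι a, h.on.2 ha, by rwa [← h.Lf b ha, h.e]⟩
theorem ILr (ho : ∀ a : M, On a → ∃ a', a = ι a') (b : T) (x : M) (hx : ZFI0.IL (ι b) x) :
    ∃ y, x = ι y ∧ ZFI0.IL b y := by
  obtain ⟨a, ha, hx'⟩ := id hx
  obtain ⟨a, rfl⟩ := ho a ha
  rw [h.on] at ha
  rw [← h.Lf b ha] at hx'
  obtain ⟨y, rfl⟩ := h.t _ _ hx'
  exact ⟨y, rfl, (h.IL ho b y).1 hx⟩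
end Tri
end
noncomputable section
section
variable [ZM M] {S : M → Prop} {n : ℕ}
abbrev Ev (C : M → Prop) {n : ℕ} (f : Fml n) (v : Fin n → M) : Prop := Eval ZM.E NoAux C f v
theorem Df.rel {C : M → M → Prop} [D2 S C] {n : ℕ} (f : Fml n) : ∀ {m : ℕ} (p : Fin m) (r : Fin n → Fin m),
    Df S (fun v : Fin m → M => Ev (C (v p)) f (fun i => v (r i))) := by
  have q : ∀ {n m : ℕ} {f : Fml (n+1)} {p : Fin m} {r : Fin n → Fin m},
      Df S (fun v : Fin (m+1) → M => Ev (C (v p.succ)) f (fun i => v (upr r i))) →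
      Df S (fun v : Fin (m+1) → M => Ev (C (v p.succ)) f (Fin.cons (v 0) (fun i => v (r i).succ))) :=
    fun {n m f p r} h => h.congr fun v => by
      refine iff_of_eq (congrArg _ ?_)
      funext i; refine Fin.cases ?_ (fun i => ?_) i <;> simp [upr]
  induction f with
  | mem i j => intro m p r; exact Df.vmem _ _
  | equ i j => intro m p r; exact Df.veq _ _
  | aux i => intro m p r; exact (Df.not (A := fun _ => True)).congr fun v => by simp [Ev, Eval, NoAux]
  | impl f g h1 h2 => intro m p r; simp only [Ev, Eval] at *; infer_instance
  | neg f h1 => intro m p r; have := h1 p r; simp only [Ev, Eval] at *; infer_instance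
  | all f h1 => intro m p r; have := q (h1 p.succ (upr r)); simp only [Ev, Eval] at *; infer_instance
  | ex f h1 => intro m p r; have := q (h1 p.succ (upr r)); simp only [Ev, Eval] at *; infer_instance
  | allb i f h1 => intro m p r; have := q (h1 p.succ (upr r)); simp only [Ev, Eval] at *; infer_instance
theorem Df.ev {C : M → M → Prop} [D2 S C] {n m : ℕ} (f : Fml n) {s : (Fin m → M) → M} {t : Fin n → (Fin m → M) → M}
    (hs : DfF S s) (ht : ∀ i, DfF S (t i)) : Df S (fun v : Fin m → M => Ev (C (s v)) f (fun i => t i v)) :=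
  (Df.sbs (Df.rel f 0 (fun i => i.succ)) (t := Fin.cons s t)
    (fun i => by refine Fin.cases ?_ (fun i => ?_) i
                 · simp_all
                 · simp_all))
def tup (o : M) : {n : ℕ} → (Fin n → M) → M
  | 0, _ => o
  | _+1, v => kp (v 0) (tup o (fun i => v i.succ))
theorem tup_inj {o : M} {n : ℕ} {v w : Fin n → M} (h : tup o v = tup o w) : v = w := by
  induction n with
  | zero => funext i; exact i.elim0
  | succ n ih =>
    simp only [tup, kp_eq] at h
    funext i; refine Fin.cases h.1 (fun i => congrFun (ih h.2) i) i
def prj : ℕ → M → M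
  | 0, t => fst t
  | k+1, t => prj k (snd t)
instance prj.df (k : ℕ) : F1 S (prj k : M → M) := by
  induction k with
  | zero => exact (inferInstance : F1 S fst)
  | succ k ih => exact (inferInstance : F1 S (fun t => prj k (snd t)))
theorem prj_tup {o : M} {n : ℕ} (v : Fin n → M) (i : Fin n) : prj i (tup o v) = v i := by
  induction n with
  | zero => exact i.elim0
  | succ n ih => refine Fin.cases ?_ (fun i => ?_) i
                 · simp [prj, tup]
                 · simp [prj, tup, ih]
inductive GT where
  | v : GT
  | o : Fin 10 → GT → GT → GT
def GT.ev : GT → M → M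
  | .v, u => u
  | .o i a b, u => gop i (a.ev u) (b.ev u)
theorem GT.mem (t : GT) {c u : M} (hc : gcd c) (hu : u ε c) : t.ev u ε c := by
  induction t with
  | v => exact hu
  | o i a b ha hb => exact hc i _ _ ha hb
theorem GT.hom {T : Type} [ZM T] {j : T → M} (hj : ∀ i x y, j (gop i x y) = gop i (j x) (j y)) (t : GT) (u : T) :
    j (t.ev u) = t.ev (j u) := by
  induction t with
  | v => rfl
  | o i a b ha hb => simp only [GT.ev]; grind
instance GT.df (t : GT) : F1 S (t.ev : M → M) := by
  induction t with
  | v => exact (inferInstance : F1 S (fun x => x))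
  | o i a b ha hb => exact (inferInstance : F1 S (fun x => gop i (a.ev x) (b.ev x)))
def Rp (u X : M) {n : ℕ} (Q : (Fin n → M) → Prop) : Prop :=
  ∀ z, z ε X ↔ ∃ w, (∀ i, w i ε u) ∧ z = tup emp w ∧ Q w
theorem Rp.congr {u X : M} {n : ℕ} {Q Q' : (Fin n → M) → Prop} (h : Rp u X Q)
    (e : ∀ w, (∀ i, w i ε u) → (Q' w ↔ Q w)) : Rp u X Q' := fun z => (h z).trans
  (exists_congr fun w => and_congr_right fun hw => and_congr_right fun _ => (e w hw).symm)
theorem Rp.iff {u X : M} {n : ℕ} {Q : (Fin n → M) → Prop} (h : Rp u X Q) {w : Fin n → M} (hw : ∀ i, w i ε u) :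
    tup emp w ε X ↔ Q w := by
  rw [h]; exact ⟨fun ⟨w', _, e, q⟩ => by rwa [tup_inj e], fun q => ⟨w, hw, rfl, q⟩⟩
theorem Rp.dif {u X Y : M} {n : ℕ} {Q Q' : (Fin n → M) → Prop} (h : Rp u X Q) (h' : Rp u Y Q') :
    Rp u (dif X Y) (fun w => Q w ∧ ¬ Q' w) := fun z => by
  rw [mem_dif, h]
  constructor
  · rintro ⟨⟨w, hw, rfl, q⟩, k⟩; rw [h'.iff hw] at k; grind
  · rintro ⟨w, hw, rfl, q, k⟩; rw [h'.iff hw]; grind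
theorem Rp.int {u X Y : M} {n : ℕ} {Q Q' : (Fin n → M) → Prop} (h : Rp u X Q) (h' : Rp u Y Q') :
    Rp u (int X Y) (fun w => Q w ∧ Q' w) := fun z => by
  rw [mem_int, h]
  constructor
  · rintro ⟨⟨w, hw, rfl, q⟩, k⟩; rw [h'.iff hw] at k; grind
  · rintro ⟨w, hw, rfl, q, k⟩; rw [h'.iff hw]; grind
theorem cons_in {u y : M} {n : ℕ} {w : Fin n → M} (hy : y ε u) (hw : ∀ i, w i ε u) :
    ∀ i, (Fin.cons y w : Fin (n+1) → M) i ε u := fun i => by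
  refine Fin.cases ?_ (fun i => ?_) i
  · simp_all
  · simp_all
theorem tup_cons {o y : M} {n : ℕ} {w : Fin n → M} : tup o (Fin.cons y w : Fin (n+1) → M) = kp y (tup o w) := rfl
theorem Rp.ran {u X : M} {n : ℕ} {Q : (Fin (n+1) → M) → Prop} (h : Rp u X Q) :
    Rp u (dmn (cnv X)) (fun w : Fin n → M => ∃ y, y ε u ∧ Q (Fin.cons y w)) := fun z => by
  rw [mem_dmn]; simp only [mem_cnv, kp_eq]
  constructor
  · rintro ⟨y, a, b, k, rfl, rfl⟩
    obtain ⟨w, hw, e, q⟩ := (h _).1 k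
    rw [tup, kp_eq] at e
    refine ⟨_, fun i => hw i.succ, e.2, w 0, hw 0, by rwa [cons_tl]⟩
  · rintro ⟨w, hw, rfl, y, hy, q⟩
    exact ⟨y, y, _, (h _).2 ⟨_, cons_in hy hw, by rw [tup_cons], q⟩, rfl, rfl⟩
abbrev GT.d (a b : GT) : GT := .o 3 a b
abbrev GT.r (a : GT) : GT := .o 6 (.o 7 a a) a
theorem dif_self' (u : M) : dif u u = emp := eqx fun z => by simp [mem_dif]
def gU : ℕ → GT
  | 0 => .o 0 (.o 3 .v .v) (.o 3 .v .v)
  | n+1 => .o 1 .v (gU n)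
theorem gU_rp (u : M) (n : ℕ) : Rp u ((gU n).ev u) (fun _ : Fin n → M => True) := by
  induction n with
  | zero => intro z; show z ε pr (dif u u) (dif u u) ↔ _
            rw [dif_self']; simp [tup]
  | succ n ih =>
    intro z; show z ε cp u ((gU n).ev u) ↔ _
    rw [mem_cp]
    constructor
    · rintro ⟨x, t, hx, ht, rfl⟩
      obtain ⟨w, hw, rfl, -⟩ := (ih _).1 ht
      exact ⟨_, cons_in hx hw, tup_cons.symm, trivial⟩
    · rintro ⟨w, hw, rfl, -⟩
      exact ⟨_, _, hw 0, (ih _).2 ⟨_, fun i => hw i.succ, rfl, trivial⟩, rfl⟩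
def gB : (n : ℕ) → ℕ → GT
  | 0, _ => .v
  | n+1, 0 => .o 9 (.o 9 (.o 1 (gU n) (.o 2 .v .v)) .v) .v
  | n+1, j+1 => .o 9 (.o 8 (.o 1 .v (gB n j)) .v) .v
theorem gB_rp (u : M) : ∀ {n : ℕ} (j : Fin n), Rp u ((gB n j).ev u) (fun w : Fin (n+1) → M => w 0 ε w j.succ) := by
  intro n
  induction n with
  | zero => intro j; grind
  | succ n ih =>
    intro j z
    refine Fin.cases ?_ (fun j => ?_) j
    · show z ε pm2 (pm2 (cp ((gU n).ev u) (mmr u u))) ↔ _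
      simp only [mem_pm2, mem_cp, mem_mmr, kp_eq]
      constructor
      · rintro ⟨y, x, t, ⟨a, b, c, ⟨d, e, hd, ⟨f, g, hf, hg, hfg, rfl⟩, rfl, h1⟩, rfl, rfl, rfl⟩, rfl⟩
        obtain ⟨w, hw, rfl, -⟩ := (gU_rp u n _).1 hd
        simp_all
        exact ⟨_, cons_in hf (cons_in hg hw), by rw [tup_cons, tup_cons], hfg⟩
      · rintro ⟨w, hw, rfl, k⟩
        exact ⟨_, _, _, ⟨_, _, _, ⟨_, _, (gU_rp u n _).2 ⟨fun i => w i.succ.succ, fun i => hw _, rfl, trivial⟩,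
          ⟨w 0, w 1, hw 0, hw 1, k, rfl⟩, rfl, rfl⟩, rfl, rfl, rfl⟩, rfl⟩
    · show z ε pm2 (pm1 (cp u ((gB n j).ev u))) ↔ _
      simp only [mem_pm2, mem_pm1, mem_cp, kp_eq]
      constructor
      · rintro ⟨y, x, t, ⟨a, b, c, ⟨d, e, hd, he, rfl, h1⟩, rfl, rfl, rfl⟩, rfl⟩
        obtain ⟨w, hw, rfl, k⟩ := (ih j _).1 he
        rw [tup, kp_eq] at h1
        obtain ⟨rfl, rfl⟩ := h1
        exact ⟨_, cons_in (hw 0) (cons_in hd (fun i => hw i.succ)), by rw [tup_cons, tup_cons], k⟩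
      · rintro ⟨w, hw, rfl, k⟩
        exact ⟨_, _, _, ⟨_, _, _, ⟨_, _, hw 1, (ih j _).2 ⟨Fin.cons (w 0) (fun i => w i.succ.succ),
          cons_in (hw 0) (fun i => hw _), rfl, k⟩, rfl, tup_cons⟩, rfl, rfl, rfl⟩, rfl⟩
def gQ (n i j : ℕ) : GT := .d (.d (gU n) (.r (.d (gB n i) (gB n j)))) (.r (.d (gB n j) (gB n i)))
theorem gQ_rp {u : M} (hu : Tr u) {n : ℕ} (i j : Fin n) :
    Rp u ((gQ n i j).ev u) (fun w : Fin n → M => w i = w j) := by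
  refine (((gU_rp u n).dif (((gB_rp u i).dif (gB_rp u j)).ran)).dif
    (((gB_rp u j).dif (gB_rp u i)).ran)).congr fun w hw => ?_
  simp only [Fin.cons_succ]
  refine ⟨fun e => by grind, fun k => eqx fun z => ?_⟩
  have k1 := k.1.2; have k2 := k.2
  push Not at k1 k2
  exact ⟨fun hz => k1 z (hu _ (hw i) _ hz) hz, fun hz => k2 z (hu _ (hw j) _ hz) hz⟩
def Sg : {n : ℕ} → Fml n → GT
  | n, .mem i j => .r (.o 4 (gQ (n+1) 0 (i+1)) (gB n j))
  | n, .equ i j => gQ n i j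
  | _, .aux _ => .d .v .v
  | n, .impl f g => .d (gU n) (.d (Sg f) (Sg g))
  | n, .neg f => .d (gU n) (Sg f)
  | n, .all f => .d (gU n) (.r (.d (gU (n+1)) (Sg f)))
  | _, .ex f => .r (Sg f)
  | n, .allb i f => .d (gU n) (.r (.d (gB n i) (Sg f)))
theorem Sg_rp {u : M} (hu : Tr u) {n : ℕ} (f : Fml n) : Rp u ((Sg f).ev u) (Ev (fun z => z ε u) f) := by
  induction f with
  | @mem n i j =>
    refine (((gQ_rp hu 0 i.succ).int (gB_rp u j)).ran).congr fun w hw => ?_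
    simp only [Eval, Fin.cons_zero, Fin.cons_succ]
    grind
  | equ i j => exact gQ_rp hu i j
  | aux i => intro z; show z ε dif u u ↔ _
             simp [mem_dif, Eval, NoAux]
  | impl f g h1 h2 => exact ((gU_rp u _).dif (h1.dif h2)).congr fun w hw => by simp [Ev, Eval]
  | neg f h1 => exact ((gU_rp u _).dif h1).congr fun w hw => by simp [Ev, Eval]
  | all f h1 => exact ((gU_rp u _).dif (((gU_rp u _).dif h1).ran)).congr fun w hw => by simp [Ev, Eval]
  | ex f h1 => exact h1.ran.congr fun w hw => by simp [Ev, Eval]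
  | allb i f h1 =>
    refine ((gU_rp u _).dif (((gB_rp u i).dif h1).ran)).congr fun w hw => ?_
    simp only [Ev, Eval, Fin.cons_zero, Fin.cons_succ, true_and]
    grind
theorem tup_mem {c u : M} (hc : gcd c) (hu : u ε c) {n : ℕ} {w : Fin n → M} (hw : ∀ i, w i ε c) : tup emp w ε c := by
  induction n with
  | zero => have := hc 3 u u hu hu; change dif u u ε c at this; rwa [dif_self'] at this
  | succ n ih =>
    have k : ∀ x y, x ε c → y ε c → pr x y ε c := fun x y => hc 0 x y
    exact k _ _ (k _ _ (hw 0) (hw 0)) (k _ _ (hw 0) (ih fun i => hw i.succ))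
end
end
noncomputable section
section
variable [ZM M] {S : M → Prop} {n : ℕ}
def lo (Q : M → Prop) : M := the (fun b => On b ∧ Q b ∧ ∀ c, c ε b → ¬ Q c)
instance (priority := 200) DfF.lo {Q : (Fin n → M) → M → Prop}
    [h : Df S (fun w : Fin (n+1) → M => Q (fun i => w i.succ) (w 0))] : DfF S (fun v => lo (Q v)) := by
  have h1 := fun m r t (ht : DfF S t) => h.par (m := m) r (t := t) ht
  unfold ZFI0.lo
  have h2 := h1 (n+1) (fun i => i.succ) _ (DfF.var 0)
  have h3 := h1 (n+1+1) (fun i => i.succ.succ) _ (DfF.var 0)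
  infer_instance
theorem lo_spec (Q : M → Prop) [D1 Tp Q] (h : ∃ a, On a ∧ Q a) :
    On (lo Q) ∧ Q (lo Q) ∧ ∀ c, On c → Q c → le (lo Q) c := by
  obtain ⟨a, ha, hq⟩ := h
  obtain ⟨b, hb, hqb, hm, -⟩ := lst Q ha hq
  have e : lo Q = b := the_eq ⟨hb, hqb, hm⟩ fun z hz => by
    rcases hz.1.tri hb with h | h | h
    · grind
    · grind
    · grind
  rw [e]
  exact ⟨hb, hqb, fun c hc hq => (nlt hc hb).1 fun h => hm c h hq⟩
theorem obd (R : M → M → Prop) [D2 Tp R] (a : M) (h : ∀ t, t ε a → ∃ x, On x ∧ R t x) :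
    ∃ d, On d ∧ ∀ t, t ε a → ∃ x, x ε d ∧ R t x := by
  refine ⟨un (img a (fun t => sc (lo (fun x => R t x)))), on_un fun x hx => ?_, fun t ht => ?_⟩
  · obtain ⟨t, ht, rfl⟩ := mem_img.1 hx
    exact (lo_spec (fun x => R t x) (h t ht)).1.sc
  · have := lo_spec (fun x => R t x) (h t ht)
    exact ⟨_, mem_un.2 ⟨_, mem_img.2 ⟨t, ht, rfl⟩, by simp⟩, this.2.1⟩
variable {b a c x y z : M}
theorem Lf_le (ha : On a) (hc : On c) (h : le a c) : sub (Lf b a) (Lf b c) := hr_le ha hc h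
theorem Lf_s (ha : On a) (h : x ε Lf b a) : x ε Lf b (sc a) := Lf_le ha ha.sc (.inl (by simp)) _ h
theorem Lf_d (ha : On a) (h : sub x (Lf b a)) (h' : x ε gcl (sc (Lf b a))) : x ε Lf b (sc a) := by
  rw [Lf_sc ha, mem_dfs]; grind
theorem Lf_self (ha : On a) : Lf b a ε Lf b (sc a) := Lf_d ha (fun _ h => h) (sub_gcl _ _ (by simp))
theorem Lf_g (ha : On a) (i : Fin 10) (hx : x ε Lf b a) (hy : y ε Lf b a) (h : sub (gop i x y) (Lf b a)) :
    gop i x y ε Lf b (sc a) := Lf_d ha h (gcd_gcl _ i _ _ (sub_gcl _ _ (by simp_all)) (sub_gcl _ _ (by simp_all)))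
theorem Lf_pr (ha : On a) (hx : x ε Lf b a) (hy : y ε Lf b a) : pr x y ε Lf b (sc a) :=
  Lf_g ha 0 hx hy (by show sub (pr x y) _; intro z; simp; grind)
theorem Lf_kp (ha : On a) (hx : x ε Lf b a) (hy : y ε Lf b a) : kp x y ε Lf b (sc (sc a)) :=
  Lf_pr ha.sc (Lf_pr ha hx hx) (Lf_pr ha hx hy)
theorem kp_tr {c : M} (hc : Tr c) (h : kp x y ε c) : x ε c ∧ y ε c := by
  have : pr x y ε c := hc _ h _ (by simp [kp])
  exact ⟨hc _ this _ (by simp), hc _ this _ (by simp)⟩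
theorem Lf_gop (ha : On a) (i : Fin 10) (hx : x ε Lf b a) (hy : y ε Lf b a) :
    gop i x y ε Lf b (sc (sc (sc (sc (sc a))))) := by
  have t := tr_Lf (b := b) ha
  have s2 : ∀ {z}, z ε Lf b a → z ε Lf b (sc (sc a)) := fun h => Lf_s ha.sc (Lf_s ha h)
  have s4 : ∀ {z}, z ε Lf b (sc (sc a)) → z ε Lf b (sc (sc (sc (sc a)))) := fun h => Lf_s ha.sc.sc.sc (Lf_s ha.sc.sc h)
  refine Lf_g ha.sc.sc.sc.sc i (s4 (s2 hx)) (s4 (s2 hy)) ?_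
  have k3 : ∀ {u v w}, u ε Lf b a → v ε Lf b a → w ε Lf b a → kp u (kp v w) ε Lf b (sc (sc (sc (sc a)))) :=
    fun hu hv hw => Lf_kp ha.sc.sc (s2 hu) (Lf_kp ha hv hw)
  have kx : ∀ {u v}, kp u v ε x → u ε Lf b a ∧ v ε Lf b a := fun h => kp_tr t (t _ hx _ h)
  intro z hz
  match i with
  | 0 => change z ε pr x y at hz; simp at hz; grind
  | 1 => change z ε cp x y at hz; obtain ⟨u, v, hu, hv, rfl⟩ := mem_cp.1 hz
         exact s4 (Lf_kp ha (t _ hx _ hu) (t _ hy _ hv))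
  | 2 => change z ε mmr x y at hz; obtain ⟨u, v, hu, hv, -, rfl⟩ := mem_mmr.1 hz
         exact s4 (Lf_kp ha (t _ hx _ hu) (t _ hy _ hv))
  | 3 => change z ε dif x y at hz; exact s4 (s2 (t _ hx _ (mem_dif.1 hz).1))
  | 4 => change z ε int x y at hz; exact s4 (s2 (t _ hx _ (mem_int.1 hz).1))
  | 5 => change z ε un x at hz; obtain ⟨u, hu, hz⟩ := mem_un.1 hz; exact s4 (s2 (t _ (t _ hx _ hu) _ hz))
  | 6 => change z ε dmn x at hz; obtain ⟨u, hu⟩ := mem_dmn.1 hz; grind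
  | 7 => change z ε cnv x at hz; obtain ⟨u, v, hu, rfl⟩ := mem_cnv.1 hz; exact s4 (Lf_kp ha (kx hu).2 (kx hu).1)
  | 8 => change z ε pm1 x at hz; obtain ⟨u, v, w, hu, rfl⟩ := mem_pm1.1 hz
         have := kx hu; have h2 := kp_tr t this.2; exact k3 this.1 h2.2 h2.1
  | 9 => change z ε pm2 x at hz; obtain ⟨u, v, w, hu, rfl⟩ := mem_pm2.1 hz
         have := kx hu; have h2 := kp_tr t this.2; exact k3 h2.2 this.1 h2.1
theorem IL.tr (h : IL b x) (hy : y ε x) : IL b y := by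
  obtain ⟨a, ha, hx⟩ := h; exact ⟨a, ha, tr_Lf ha _ hx _ hy⟩
theorem IL.two (h : IL b x) (h' : IL b y) : ∃ a, On a ∧ x ε Lf b a ∧ y ε Lf b a := by
  obtain ⟨a, ha, hx⟩ := h; obtain ⟨c, hc, hy⟩ := h'
  exact ⟨_, on_max ha hc, Lf_le ha (on_max ha hc) (le_max ha hc).1 _ hx, Lf_le hc (on_max ha hc) (le_max ha hc).2 _ hy⟩
theorem IL.gop (i : Fin 10) (h : IL b x) (h' : IL b y) : IL b (gop i x y) := by
  obtain ⟨a, ha, hx, hy⟩ := h.two h'; exact ⟨_, ha.sc.sc.sc.sc.sc, Lf_gop ha i hx hy⟩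
theorem IL.fin {n : ℕ} {v : Fin n → M} (hv : ∀ i, IL b (v i)) (ha : On a) : ∃ c, On c ∧ le a c ∧ ∀ i, v i ε Lf b c := by
  induction n with
  | zero => exact ⟨a, ha, .inr rfl, fun i => i.elim0⟩
  | succ n ih =>
    obtain ⟨c, hc, hac, h⟩ := ih (fun i => hv _)
    obtain ⟨d, hd, h0⟩ := hv 0
    have hm := on_max hc hd
    have hl := le_max hc hd
    refine ⟨_, hm, ?_, fun i => Fin.cases (Lf_le hd hm hl.2 _ h0) (fun i => Lf_le hc hm hl.1 _ (h i)) i⟩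
    rw [le_iff ha hm]; rw [le_iff ha hc] at hac; rw [le_iff hc hm] at hl
    exact fun z hz => hl.1 z (hac z hz)
theorem IL.Lf (ha : On a) : IL b (Lf b a) := ⟨_, ha.sc, Lf_self ha⟩
theorem IL.bs : IL b b := ⟨emp, on_emp, by rw [ZFI0.Lf, hr_emp]; exact mem_L0 b⟩
theorem IL.gt (h : IL b x) (t : GT) : IL b (t.ev x) := by
  induction t with
  | v => exact h
  | o i a b h1 h2 => exact h1.gop i h2
def ec (f : Fml (n+1)) (b x t : M) : Prop := Ev (IL b) f (Fin.cons x (fun i : Fin n => prj i t))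
instance ec.df (f : Fml (n+1)) : D3 S (ec f : M → M → M → Prop) :=
  ⟨(Df.ev (C := IL) f (s := fun v : Fin 3 → M => v 0) (t := Fin.cons (fun v => v 1) (fun i v => prj i (v 2)))
    inferInstance (fun i => by
      refine Fin.cases ?_ (fun i => ?_) i
      · show DfF S (fun v : Fin 3 → M => v 1)
        infer_instance
      · show DfF S (fun v : Fin 3 → M => prj i (v 2))
        infer_instance)).congr fun v => by
    refine iff_of_eq (congrArg (Ev (IL (v 0)) f) ?_)
    funext i; refine Fin.cases ?_ (fun i => ?_) i <;> simp⟩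
theorem ec_tup (f : Fml (n+1)) (v : Fin n → M) : ec f b x (tup emp v) ↔ Ev (IL b) f (Fin.cons x v) := by
  unfold ec; simp only [prj_tup]
theorem IL.bnd (f : Fml (n+1)) (ha : On a) : ∃ c, On c ∧ le a c ∧ ∀ v, (∀ i, v i ε ZFI0.Lf b a) →
    (∃ x, IL b x ∧ Ev (IL b) f (Fin.cons x v)) → ∃ x, x ε ZFI0.Lf b c ∧ Ev (IL b) f (Fin.cons x v) := by
  obtain ⟨d, hd, h⟩ := obd (fun t c => ∀ x, IL b x → ec f b x t → ∃ x, x ε ZFI0.Lf b c ∧ ec f b x t)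
    ((gU n).ev (ZFI0.Lf b a)) (fun t ht => by
      by_cases hx : ∃ x, IL b x ∧ ec f b x t
      · obtain ⟨x, ⟨c, hc, hx⟩, h⟩ := hx; grind
      · grind)
  have hm := on_max ha hd
  have hl := le_max ha hd
  refine ⟨_, hm, hl.1, fun v hv ⟨x, hx, h'⟩ => ?_⟩
  obtain ⟨c, hc, h2⟩ := h (tup emp v) ((gU_rp _ n _).2 ⟨v, hv, rfl, trivial⟩)
  obtain ⟨y, hy, h3⟩ := h2 x hx ((ec_tup f v).2 h')
  exact ⟨y, Lf_le (hd.mem hc) hm (.inl (lt_of_lt_of_le' hm hc hl.2)) _ hy, (ec_tup f v).1 h3⟩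
theorem SF (f : Fml n) : ∀ a, On a → ∃ X, IL b X ∧ Rp (Lf b a) X (Ev (IL b) f) := by
  have kn : ∀ {n} {f : Fml n}, (∀ a, On a → ∃ X, IL b X ∧ Rp (Lf b a) X (Ev (IL b) f)) →
      (∀ a, On a → ∃ X, IL b X ∧ Rp (Lf b a) X (Ev (IL b) f.neg)) := fun h a ha => by
    obtain ⟨X, hX, h⟩ := h a ha
    exact ⟨_, ((IL.Lf ha).gt (gU _)).gop 3 hX, ((gU_rp _ _).dif h).congr fun w hw => by simp [Ev, Eval]⟩
  have ki : ∀ {n} {f g : Fml n}, (∀ a, On a → ∃ X, IL b X ∧ Rp (Lf b a) X (Ev (IL b) f)) →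
      (∀ a, On a → ∃ X, IL b X ∧ Rp (Lf b a) X (Ev (IL b) g)) →
      (∀ a, On a → ∃ X, IL b X ∧ Rp (Lf b a) X (Ev (IL b) (f.impl g))) := fun h h' a ha => by
    obtain ⟨X, hX, h⟩ := h a ha
    obtain ⟨Y, hY, h'⟩ := h' a ha
    exact ⟨_, ((IL.Lf ha).gt (gU _)).gop 3 (hX.gop 3 hY), ((gU_rp _ _).dif (h.dif h')).congr fun w hw => by simp [Ev, Eval]⟩
  have ke : ∀ {n} {f : Fml (n+1)}, (∀ a, On a → ∃ X, IL b X ∧ Rp (Lf b a) X (Ev (IL b) f)) →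
      (∀ a, On a → ∃ X, IL b X ∧ Rp (Lf b a) X (Ev (IL b) f.ex)) := fun {n f} h a ha => by
    obtain ⟨c, hc, hac, hb⟩ := IL.bnd f ha
    obtain ⟨X, hX, h⟩ := h c hc
    refine ⟨_, ((IL.Lf ha).gt (gU n)).gop 4 ((hX.gop 7 hX).gop 6 hX), fun z => ?_⟩
    change z ε int ((gU n).ev (Lf b a)) (dmn (cnv X)) ↔ _
    rw [mem_int, gU_rp, h.ran]
    constructor
    · rintro ⟨⟨w, hw, rfl, -⟩, w', hw', e, y, hy, h⟩
      rw [← tup_inj e] at h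
      exact ⟨w, hw, rfl, y, ⟨c, hc, hy⟩, h⟩
    · rintro ⟨w, hw, rfl, h⟩
      exact ⟨⟨w, hw, rfl, trivial⟩, w, fun i => Lf_le ha hc hac _ (hw i), rfl, hb w hw h⟩
  have km : ∀ {n} (i j : Fin n), ∀ a, On a → ∃ X, IL b X ∧ Rp (Lf b a) X (Ev (IL b) (.mem i j)) :=
    fun i j a ha => ⟨_, (IL.Lf ha).gt _, Sg_rp (tr_Lf ha) (.mem i j)⟩
  have kc : ∀ {n} {f g : Fml n}, (∀ v, Ev (IL b) f v ↔ Ev (IL b) g v) →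
      (∀ a, On a → ∃ X, IL b X ∧ Rp (Lf b a) X (Ev (IL b) g)) →
      (∀ a, On a → ∃ X, IL b X ∧ Rp (Lf b a) X (Ev (IL b) f)) := fun e h a ha => by
    obtain ⟨X, hX, h⟩ := h a ha
    exact ⟨X, hX, h.congr fun w _ => e w⟩
  induction f with
  | mem i j => exact km i j
  | equ i j => exact fun a ha => ⟨_, (IL.Lf ha).gt _, Sg_rp (tr_Lf ha) (.equ i j)⟩
  | aux i => exact fun a ha => ⟨_, (IL.Lf ha).gt _, Sg_rp (tr_Lf ha) (.aux i)⟩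
  | impl f g h1 h2 => exact ki h1 h2
  | neg f h1 => exact kn h1
  | all f h1 => exact kc (fun v => by simp [Ev, Eval]) (kn (ke (kn h1)))
  | ex f h1 => exact ke h1
  | allb i f h1 => exact kc (fun v => by simp [Ev, Eval]) (kn (ke (kn (ki (km 0 i.succ) h1))))
theorem IL.tup {v : Fin n → M} (hv : ∀ i, IL b (v i)) (hx : IL b x) : IL b (tup emp v) := by
  induction n with
  | zero => have := hx.gop 3 hx; change IL b (ZFI0.dif x x) at this; rwa [dif_self'] at this
  | succ n ih =>
    have k : ∀ x y, IL b x → IL b y → IL b (pr x y) := fun x y h h' => h.gop 0 h'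
    exact k _ _ (k _ _ (hv 0) (hv 0)) (k _ _ (hv 0) (ih fun i => hv i.succ))
theorem Lsep (f : Fml (n+1)) {v : Fin n → M} (hv : ∀ i, IL b (v i)) (hx : IL b x) :
    ∃ X, IL b X ∧ ∀ z, z ε X ↔ z ε x ∧ Ev (IL b) f (Fin.cons z v) := by
  obtain ⟨a, ha, hxa⟩ := id hx
  obtain ⟨c, hc, hac, hvc⟩ := IL.fin hv ha
  obtain ⟨S, hS, h⟩ := SF f c hc
  have ht := IL.tup hv hx
  refine ⟨_, ((hS.gop 4 (hx.gop 1 (ht.gop 0 ht))).gop 6 hx), fun z => ?_⟩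
  change z ε dmn (int S (cp x (sg (tup emp v)))) ↔ _
  have hz : z ε x → z ε Lf b c := fun h => Lf_le ha hc hac _ (tr_Lf ha _ hxa _ h)
  simp only [mem_dmn, mem_int, mem_cp, kp_eq, mem_sg]
  constructor
  · rintro ⟨y, h', a, b, ha, rfl, rfl, rfl⟩
    exact ⟨ha, (h.iff (cons_in (hz ha) hvc)).1 (by rwa [tup_cons])⟩
  · rintro ⟨hz', h'⟩
    refine ⟨_, ?_, _, _, hz', rfl, rfl, rfl⟩
    rw [← tup_cons, h.iff (cons_in (hz hz') hvc)]; grind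
theorem IL.on (ha : On a) : IL b a := by
  refine oind (fun a => IL b a) (fun a ha ih => ?_) ha
  obtain ⟨d, hd, h⟩ := obd (fun t c => t ε ZFI0.Lf b c) a (fun t ht => ih t ht)
  obtain ⟨X, hX, h1⟩ := Lsep (b := b) (.allb 0 (.allb 0 (.mem 0 2)) : Fml 1) (v := Fin.elim0) (fun i => i.elim0) (IL.Lf hd)
  obtain ⟨Y, hY, h2⟩ := Lsep (b := b) (.allb 0 (.allb 1 (.impl (.neg (.mem 1 0)) (.impl (.neg (.equ 1 0)) (.mem 0 1)))) : Fml 1) (v := Fin.elim0) (fun i => i.elim0) hX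
  have hon : ∀ z, z ε Y ↔ z ε ZFI0.Lf b d ∧ On z := fun z => by
    rw [h2, h1, and_assoc]
    refine and_congr_right fun hz => ?_
    have hi : IL b z := ⟨d, hd, hz⟩
    constructor
    · rintro ⟨hA, hB⟩
      refine ⟨fun y hy w hw => hA y (hi.tr hy) hy w ((hi.tr hy).tr hw) hw, fun y w hy hw => ?_⟩
      by_cases h1 : y ε w
      · exact .inl h1
      by_cases h2 : y = w
      · grind
      exact .inr (.inr (hB y (hi.tr hy) hy w (hi.tr hw) hw h1 h2))
    · intro ho
      refine ⟨fun y _ hy w _ hw => ho.1 y hy w hw, fun y _ hy w _ hw h1 h2 => ?_⟩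
      rcases ho.2 y w hy hw with h | h | h
      · exact (h1 h).elim
      · exact (h2 h).elim
      · exact h
  have hYo : On Y := on_of (fun y hy z hz => (hon z).2 ⟨tr_Lf hd _ ((hon y).1 hy).1 _ hz, ((hon y).1 hy).2.mem hz⟩)
    (fun y hy => ((hon y).1 hy).2)
  have : le a Y := (le_iff ha hYo).2 fun z hz => (hon z).2 ⟨by
    obtain ⟨x, hx, h⟩ := h z hz; exact Lf_le (hd.mem hx) hd (.inl hx) _ h, ha.mem hz⟩
  rcases this with h | rfl
  · exact hY.tr h
  · exact hY
theorem ev_sub {C : M → Prop} (f : Fml n) (v : Fin n → {x // C x}) :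
    Eval (fun a b : {x // C x} => a.1 ε b.1) NoAux AllSets f v ↔ Ev C f (fun i => (v i).1) := by
  have k : ∀ {n} x v, (fun i => ((Fin.cons x v : Fin (n+1) → {x // C x}) i).1) =
      (Fin.cons x.1 (fun i => (v i).1)) := fun x v => by
    funext i; refine Fin.cases ?_ (fun i => ?_) i <;> simp
  induction f with
  | mem i j => rfl
  | equ i j => exact Subtype.ext_iff
  | aux i => rfl
  | impl f g h1 h2 => exact imp_congr (h1 _) (h2 _)
  | neg f h1 => exact not_congr (h1 _)
  | all f h1 => exact ⟨fun h x hx => k ⟨x, hx⟩ v ▸ (h1 _).1 (h ⟨x, hx⟩ trivial), fun h x _ => (h1 _).2 ((k x v).symm ▸ h x.1 x.2)⟩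
  | ex f h1 => exact ⟨fun ⟨x, _, h⟩ => ⟨x.1, x.2, k x v ▸ (h1 _).1 h⟩, fun ⟨x, hx, h⟩ => ⟨⟨x, hx⟩, trivial, (h1 _).2 ((k ⟨x, hx⟩ v).symm ▸ h)⟩⟩
  | allb i f h1 => exact ⟨fun h x hx hi => k ⟨x, hx⟩ v ▸ (h1 _).1 (h ⟨x, hx⟩ trivial hi), fun h x _ hi => (h1 _).2 ((k x v).symm ▸ h x.1 x.2 hi)⟩
abbrev LL (b : M) : Type := {x : M // IL b x}
theorem LL_zf (b : M) : SatZF (M := LL b) (fun x y => x.1 ε y.1) NoAux where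
  ext x y h := Subtype.ext (eqx fun z => ⟨fun hz => (h ⟨z, x.2.tr hz⟩).1 hz, fun hz => (h ⟨z, y.2.tr hz⟩).2 hz⟩)
  found x h := by
    obtain ⟨y, hy⟩ := h
    obtain ⟨w, hw, h⟩ := fnd ⟨y.1, hy⟩
    exact ⟨⟨w, x.2.tr hw⟩, hw, fun z hz => h _ hz⟩
  pair x y := ⟨⟨_, x.2.gop 0 y.2⟩, fun z => by
    show z.1 ε pr x.1 y.1 ↔ _
    rw [mem_pr, Subtype.ext_iff, Subtype.ext_iff]⟩
  union x := ⟨⟨_, x.2.gop 5 x.2⟩, fun z => by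
    show z.1 ε un x.1 ↔ _
    rw [mem_un]; exact ⟨fun ⟨y, hy, h⟩ => ⟨⟨y, x.2.tr hy⟩, hy, h⟩, fun ⟨y, hy, h⟩ => ⟨_, hy, h⟩⟩⟩
  power x := by
    obtain ⟨d, hd, h⟩ := obd (fun t c => IL b t → t ε Lf b c) (pw x.1) (fun t ht => by
      by_cases h : IL b t
      · obtain ⟨c, hc, h⟩ := h; exact ⟨c, hc, fun _ => h⟩
      · exact ⟨emp, on_emp, fun h' => (h h').elim⟩)
    obtain ⟨X, hX, hs⟩ := Lsep (b := b) (.allb 0 (.mem 0 2) : Fml 2) (v := fun _ => x.1) (fun _ => x.2) (IL.Lf hd)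
    refine ⟨⟨X, hX⟩, fun z => (hs z.1).trans ?_⟩
    simp only [Ev, Eval]
    constructor
    · rintro ⟨_, h⟩ w hw; exact h w.1 w.2 hw
    · intro h1
      have h2 : ∀ w, w ε z.1 → w ε x.1 := fun w hw => h1 ⟨w, z.2.tr hw⟩ hw
      refine ⟨?_, fun w _ hw => h2 w hw⟩
      obtain ⟨c, hc, h3⟩ := h z.1 (mem_pw.2 h2)
      exact Lf_le (hd.mem hc) hd (.inl hc) _ (h3 z.2)
  infty := ⟨⟨om, IL.on omn⟩, ⟨⟨emp, IL.on on_emp⟩, emp_om, fun u h => by simp at h⟩, fun x hx =>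
    ⟨⟨sc x.1, IL.on (omn.mem hx).sc⟩, sc_om hx, fun z => by show z.1 ε sc x.1 ↔ _; rw [mem_sc, Subtype.ext_iff]⟩⟩
  sep f v a := by
    obtain ⟨X, hX, hs⟩ := Lsep f (fun i => (v i).2) a.2
    refine ⟨⟨X, hX⟩, fun z => (hs z.1).trans ?_⟩
    rw [ev_sub]
    refine and_congr_right fun _ => iff_of_eq (congrArg (Ev (IL b) f) ?_)
    funext i; refine Fin.cases ?_ (fun i => ?_) i <;> simp
  repl {n} f v a h := by
    have e : ∀ x y : LL b, Eval (M := LL b) (fun x y => x.1 ε y.1) NoAux AllSets f (Fin.cons x (Fin.cons y v)) ↔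
        Ev (IL b) f (Fin.cons x.1 (Fin.cons y.1 (fun i => (v i).1))) := fun x y => by
      rw [ev_sub]
      refine iff_of_eq (congrArg (Ev (IL b) f) ?_)
      funext i; refine Fin.cases ?_ (fun i => Fin.cases ?_ (fun i => ?_) i) i <;> simp
    simp only [e] at h ⊢
    have et : ∀ t y, ec f b t (kp y (tup emp (fun i => (v i).1))) ↔ Ev (IL b) f (Fin.cons t (Fin.cons y (fun i => (v i).1))) := fun t y => by
      rw [← tup_cons, ec_tup]
    obtain ⟨d, hd, hb⟩ := obd (fun t c : M => ∃ y, y ε Lf b c ∧ ec f b t (kp y (tup emp (fun i => (v i).1)))) a.1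
      (fun t ht => by
        obtain ⟨y, hy, -⟩ := h ⟨t, a.2.tr ht⟩ ht
        obtain ⟨c, hc, hy'⟩ := y.2
        exact ⟨c, hc, y.1, hy', (et _ _).2 hy⟩)
    obtain ⟨a0, ha0, haa⟩ := a.2
    obtain ⟨c, hc, hdc, hvc⟩ := IL.fin (fun i => (v i).2) (on_max hd ha0)
    have hl := le_max hd ha0
    obtain ⟨X, hX, hs⟩ := SF (b := b) f c hc
    have ht := IL.tup (fun i => (v i).2) a.2
    have hu := IL.Lf (b := b) hc
    have hR := hX.gop 4 (a.2.gop 1 (hu.gop 1 (ht.gop 0 ht)))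
    have hal : ∀ x, x ε a.1 → x ε Lf b c := fun x hx => Lf_le (on_max hd ha0) hc hdc _
      (Lf_le ha0 (on_max hd ha0) hl.2 _ (tr_Lf ha0 _ haa _ hx))
    refine ⟨⟨_, (((hR.gop 7 hR).gop 6 hR).gop 6 hR)⟩, fun y => ?_⟩
    show y.1 ε dmn (dmn (cnv (int X (cp a.1 (cp (Lf b c) (sg (tup emp (fun i => (v i).1)))))))) ↔ _
    simp only [mem_dmn, mem_cnv, mem_int, mem_cp, mem_sg, kp_eq]
    constructor
    · rintro ⟨_, _, _, _, ⟨hx, _, _, h1, ⟨_, _, h2, rfl, rfl⟩, rfl, h3⟩, rfl, rfl⟩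
      rw [kp_eq] at h3; obtain ⟨h3, rfl⟩ := h3
      refine ⟨⟨_, a.2.tr h1⟩, h1, ?_⟩
      rw [← tup_cons, ← tup_cons, hs.iff] at hx
      · exact hx
      · exact cons_in (hal _ h1) (cons_in (h3 ▸ h2) hvc)
    · rintro ⟨x, hx, h1⟩
      have hy : y.1 ε Lf b c := by
        obtain ⟨ξ, hξ, y', hy', h2⟩ := hb x.1 hx
        have := (h x hx).unique h1 (y₂ := ⟨y', _, hd.mem hξ, hy'⟩) ((et _ _).1 h2)
        rw [this]
        exact Lf_le (on_max hd ha0) hc hdc _ (Lf_le hd (on_max hd ha0) hl.1 _ (Lf_le (hd.mem hξ) hd (.inl hξ) _ hy'))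
      refine ⟨tup emp (fun i => (v i).1), x.1, _, _, ⟨?_, _, _, hx, ⟨_, _, hy, rfl, rfl⟩, rfl, rfl⟩, rfl, rfl⟩
      rw [← tup_cons, ← tup_cons, hs.iff]
      · exact h1
      · exact cons_in (hal _ hx) (cons_in hy hvc)
instance LL.zm (b : M) : ZM (LL b) := ⟨_, _, LL_zf b⟩
theorem LL_tri (b : M) : Tri (fun x : LL b => x.1) := ⟨fun _ _ => Iff.rfl, fun x y h => ⟨⟨y, x.2.tr h⟩, rfl⟩⟩
theorem LL_on {a : M} (b : M) (ha : On a) : ∃ a' : LL b, a = a'.1 := ⟨⟨a, IL.on ha⟩, rfl⟩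
theorem LL_V {b : M} (b' : LL b) (h : b'.1 = b) (x : LL b) : IL b' x :=
  ((LL_tri b).IL (fun a ha => LL_on b ha) b' x).1 (by grind)
end
end
class U {n : ℕ} (R : ∀ M : Type, (M → M → Prop) → (Fin n → M) → Prop) : Prop where
  h : ∃ f : Fml n, ∀ (M : Type) (E : M → M → Prop) (v : Fin n → M),
    R M E v ↔ Eval E NoAux AllSets f v
section
variable {n : ℕ} {A B : ∀ M : Type, (M → M → Prop) → (Fin n → M) → Prop}
instance U.imp [a : U A] [b : U B] : U (fun M E v => A M E v → B M E v) := by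
  obtain ⟨f, hf⟩ := a.h; obtain ⟨g, hg⟩ := b.h
  exact ⟨f.impl g, fun M E v => by simp only [Eval, hf, hg]⟩
instance U.not [a : U A] : U (fun M E v => ¬ A M E v) := by
  obtain ⟨f, hf⟩ := a.h
  exact ⟨f.neg, fun M E v => by simp only [Eval, hf]⟩
theorem U.congr (a : U A) (e : ∀ M E v, B M E v ↔ A M E v) : U B := by
  obtain ⟨f, hf⟩ := a.h
  exact ⟨f, fun M E v => (e M E v).trans (hf M E v)⟩
instance U.and [a : U A] [b : U B] : U (fun M E v => A M E v ∧ B M E v) :=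
  U.congr (U.not (A := fun M E v => A M E v → ¬ B M E v)) (fun _ _ v => by tauto)
instance U.or [a : U A] [b : U B] : U (fun M E v => A M E v ∨ B M E v) :=
  U.congr (U.imp (A := fun M E v => ¬ A M E v) (B := B)) (fun _ _ v => by tauto)
instance U.iff [a : U A] [b : U B] : U (fun M E v => A M E v ↔ B M E v) :=
  U.congr (U.and (A := fun M E v => A M E v → B M E v) (B := fun M E v => B M E v → A M E v))
    (fun _ _ v => by tauto)
instance U.all {R : ∀ M : Type, (M → M → Prop) → (Fin n → M) → M → Prop}
    [a : U (fun M E (w : Fin (n+1) → M) => R M E (fun i => w i.succ) (w 0))] :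
    U (fun M E v => ∀ x, R M E v x) := by
  obtain ⟨f, hf⟩ := a.h
  refine ⟨f.all, fun M E v => ?_⟩
  simp only [Eval, ← hf, Fin.cons_succ, Fin.cons_zero, AllSets, true_imp_iff]
instance U.ex {R : ∀ M : Type, (M → M → Prop) → (Fin n → M) → M → Prop}
    [a : U (fun M E (w : Fin (n+1) → M) => R M E (fun i => w i.succ) (w 0))] :
    U (fun M E v => ∃ x, R M E v x) := by
  obtain ⟨f, hf⟩ := a.h
  refine ⟨f.ex, fun M E v => ?_⟩
  simp only [Eval, ← hf, Fin.cons_succ, Fin.cons_zero, AllSets, true_and]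
instance U.mem (i j : Fin n) : U (fun M E v => E (v i) (v j)) := ⟨Fml.mem i j, fun _ _ _ => Iff.rfl⟩
instance U.eq (i j : Fin n) : U (fun M E v => v i = v j) := ⟨Fml.equ i j, fun _ _ _ => Iff.rfl⟩
theorem U.rn {m : ℕ} (a : U A) (r : Fin n → Fin m) :
    U (fun M E (v : Fin m → M) => A M E (fun i => v (r i))) := by
  obtain ⟨f, hf⟩ := a.h
  exact ⟨ren r f, fun M E v => by rw [Eval_ren, hf]⟩
class V1 (R : ∀ M : Type, (M → M → Prop) → M → Prop) : Prop where
  h : U (fun M E (v : Fin 1 → M) => R M E (v 0))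
class V2 (R : ∀ M : Type, (M → M → Prop) → M → M → Prop) : Prop where
  h : U (fun M E (v : Fin 2 → M) => R M E (v 0) (v 1))
class V3 (R : ∀ M : Type, (M → M → Prop) → M → M → M → Prop) : Prop where
  h : U (fun M E (v : Fin 3 → M) => R M E (v 0) (v 1) (v 2))
class V4 (R : ∀ M : Type, (M → M → Prop) → M → M → M → M → Prop) : Prop where
  h : U (fun M E (v : Fin 4 → M) => R M E (v 0) (v 1) (v 2) (v 3))
instance (priority := 50) {R : ∀ M : Type, (M → M → Prop) → M → Prop} [a : V1 R] (i : Fin n) :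
    U (fun M E (v : Fin n → M) => R M E (v i)) := a.h.rn ![i]
instance (priority := 50) {R : ∀ M : Type, (M → M → Prop) → M → M → Prop} [a : V2 R] (i j : Fin n) :
    U (fun M E (v : Fin n → M) => R M E (v i) (v j)) := a.h.rn ![i, j]
instance (priority := 50) {R : ∀ M : Type, (M → M → Prop) → M → M → M → Prop} [a : V3 R]
    (i j k : Fin n) : U (fun M E (v : Fin n → M) => R M E (v i) (v j) (v k)) := a.h.rn ![i, j, k]
instance (priority := 50) {R : ∀ M : Type, (M → M → Prop) → M → M → M → M → Prop} [a : V4 R]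
    (i j k l : Fin n) : U (fun M E (v : Fin n → M) => R M E (v i) (v j) (v k) (v l)) :=
  a.h.rn ![i, j, k, l]
end
instance : V2 @SubsetE := ⟨by unfold SubsetE; infer_instance⟩
instance : V1 @TransSet := ⟨by unfold TransSet; infer_instance⟩
instance : V1 @IsOrd := ⟨by unfold IsOrd; infer_instance⟩
instance : V1 @IsZero := ⟨by unfold IsZero; infer_instance⟩
instance : V2 @IsSuccOf := ⟨by unfold IsSuccOf; infer_instance⟩
instance : V1 @IsLimitOrd := ⟨by unfold IsLimitOrd; infer_instance⟩
instance : V3 @IsUPair := ⟨by unfold IsUPair; infer_instance⟩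
instance : V3 @IsKPair := ⟨by unfold IsKPair; infer_instance⟩
instance : V4 @IsKTriple := ⟨by unfold IsKTriple; infer_instance⟩
instance : V3 @PairIn := ⟨by unfold PairIn; infer_instance⟩
instance : V1 @IsFunc := ⟨by unfold IsFunc; infer_instance⟩
instance : V3 @IsGProd := ⟨by unfold IsGProd; infer_instance⟩
instance : V3 @IsGMemRel := ⟨by unfold IsGMemRel; infer_instance⟩
instance : V3 @IsGDiff := ⟨by unfold IsGDiff; infer_instance⟩
instance : V3 @IsGInter := ⟨by unfold IsGInter; infer_instance⟩
instance : V2 @IsGUnionSet := ⟨by unfold IsGUnionSet; infer_instance⟩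
instance : V2 @IsGDom := ⟨by unfold IsGDom; infer_instance⟩
instance : V2 @IsGConv := ⟨by unfold IsGConv; infer_instance⟩
instance : V2 @IsGPerm1 := ⟨by unfold IsGPerm1; infer_instance⟩
instance : V2 @IsGPerm2 := ⟨by unfold IsGPerm2; infer_instance⟩
instance : V1 @GClosed := ⟨by unfold GClosed; infer_instance⟩
instance : V2 @IsGClOf := ⟨by unfold IsGClOf; infer_instance⟩
instance : V2 @IsDefSetOf := ⟨by unfold IsDefSetOf; infer_instance⟩
instance : V2 @IsTransClOf := ⟨by unfold IsTransClOf; infer_instance⟩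
instance : V2 @IsLZero := ⟨by unfold IsLZero; infer_instance⟩
instance : V3 @IsLHier := ⟨by unfold IsLHier; infer_instance⟩
instance : V3 @IsLStage := ⟨by unfold IsLStage; infer_instance⟩
instance : V2 @InL := ⟨by unfold InL; infer_instance⟩
theorem U.ev {n : ℕ} (f : Fml n) : U (fun M E v => Eval E NoAux AllSets f v) :=
  ⟨f, fun _ _ _ => Iff.rfl⟩
section
variable {T L : Type} {E : T → T → Prop} {F : L → L → Prop} {j : T → L}
theorem U.tr (hj : ∀ {n : ℕ} (f : Fml n) v,
    Eval E NoAux AllSets f v ↔ Eval F NoAux AllSets f (fun i => j (v i))) {n : ℕ}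
    {R : ∀ M : Type, (M → M → Prop) → (Fin n → M) → Prop} (a : U R) (v : Fin n → T) :
    R T E v ↔ R L F (fun i => j (v i)) := by
  obtain ⟨f, hf⟩ := a.h
  grind
theorem ZF_tr (hj : ∀ {n : ℕ} (f : Fml n) v,
    Eval E NoAux AllSets f v ↔ Eval F NoAux AllSets f (fun i => j (v i)))
    (ax : SatZF F NoAux) : SatZF E NoAux where
  ext := fun x y => (U.tr hj (n := 2) (R := fun M E v => (∀ z, E z (v 0) ↔ E z (v 1)) → v 0 = v 1)
    inferInstance ![x, y]).2 (ax.ext _ _)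
  found := fun x => (U.tr hj (n := 1) (R := fun M E v => (∃ y, E y (v 0)) →
    ∃ y, E y (v 0) ∧ ∀ z, E z y → ¬ E z (v 0)) inferInstance ![x]).2 (ax.found _)
  pair := fun x y => (U.tr hj (n := 2) (R := fun M E v => ∃ p, ∀ z, E z p ↔ (z = v 0 ∨ z = v 1))
    inferInstance ![x, y]).2 (ax.pair _ _)
  union := fun x => (U.tr hj (n := 1) (R := fun M E v => ∃ u, ∀ z, E z u ↔ ∃ y, E y (v 0) ∧ E z y)
    inferInstance ![x]).2 (ax.union _)
  power := fun x => (U.tr hj (n := 1) (R := fun M E v => ∃ p, ∀ z, E z p ↔ SubsetE E z (v 0))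
    inferInstance ![x]).2 (ax.power _)
  infty := (U.tr hj (n := 0) (R := fun M E v => ∃ w : M, (∃ z, E z w ∧ ∀ u, ¬ E u z) ∧
    ∀ x, E x w → ∃ s, E s w ∧ ∀ z, E z s ↔ (E z x ∨ z = x)) inferInstance ![]).2 ax.infty
  sep := fun {n} f v a => by
    have i1 : ∀ {m : ℕ} (a : Fin m) (r : Fin n → Fin m), U (fun M E (w : Fin m → M) =>
      Eval E NoAux AllSets f (Fin.cons (w a) fun i => w (r i))) := fun a r => ((U.ev f).rn
      (Fin.cons a r)).congr fun M E w => iff_of_eq (congrArg _ (by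
        funext i; refine Fin.cases ?_ (fun i => ?_) i <;> simp))
    have := (U.tr hj (n := n+1) (R := fun M E v => ∃ b, ∀ z, E z b ↔
      (E z (v 0) ∧ Eval E NoAux AllSets f (Fin.cons z fun i => v i.succ))) inferInstance
      (Fin.cons a v)).2
    simp only [Fin.cons_zero, Fin.cons_succ] at this
    exact this (ax.sep f _ _)
  repl := fun {n} f v a => by
    have i1 : ∀ {m : ℕ} (a b : Fin m) (r : Fin n → Fin m), U (fun M E (w : Fin m → M) =>
      Eval E NoAux AllSets f (Fin.cons (w a) (Fin.cons (w b) fun i => w (r i)))) := fun a b r =>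
      ((U.ev f).rn (Fin.cons a (Fin.cons b r))).congr fun M E w => iff_of_eq (congrArg _ (by
        funext i; refine Fin.cases ?_ (fun i => Fin.cases ?_ (fun i => ?_) i) i <;> simp))
    have := (U.tr hj (n := n+1) (R := fun M E v => (∀ x, E x (v 0) → ∃ y,
      (Eval E NoAux AllSets f (Fin.cons x (Fin.cons y fun i => v i.succ))) ∧ ∀ z,
      Eval E NoAux AllSets f (Fin.cons x (Fin.cons z fun i => v i.succ)) → z = y) →
      ∃ b, ∀ y, E y b ↔ ∃ x, E x (v 0) ∧
        Eval E NoAux AllSets f (Fin.cons x (Fin.cons y fun i => v i.succ))) inferInstance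
      (Fin.cons a v)).2
    simp only [Fin.cons_zero, Fin.cons_succ] at this
    exact this (ax.repl f _ _)
end
noncomputable section
variable [ZM M] {S : M → Prop}
theorem up_iff {p x y : M} : IsUPair ZM.E p x y ↔ p = pr x y :=
  ⟨fun h => eqx fun z => by rw [h z, mem_pr], by rintro rfl z; simp_all⟩
theorem kp_iff {p x y : M} : IsKPair ZM.E p x y ↔ p = kp x y := by
  simp only [IsKPair, up_iff]
  exact ⟨by rintro ⟨_, _, rfl, rfl, rfl⟩; rfl, by rintro rfl; exact ⟨_, _, rfl, rfl, rfl⟩⟩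
theorem pin_iff {f x y : M} : PairIn ZM.E f x y ↔ kp x y ε f := by simp [PairIn, kp_iff]
theorem kt_iff {p x y z : M} : IsKTriple ZM.E p x y z ↔ p = kp x (kp y z) := by
  simp [IsKTriple, kp_iff]
theorem all_eq {Q : M → Prop} {y : M} (h : ∀ z, z ε y ↔ Q z) (x : M) :
    (∀ z, z ε x ↔ Q z) ↔ x = y :=
  ⟨fun h' => eqx fun z => (h' z).trans (h z).symm, by grind⟩
def GR : Fin 10 → ∀ M : Type, (M → M → Prop) → M → M → M → Prop :=
  ![@IsUPair, @IsGProd, @IsGMemRel, @IsGDiff, @IsGInter, fun M E z x _ => IsGUnionSet E z x, fun M E z x _ => IsGDom E z x,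
    fun M E z x _ => IsGConv E z x, fun M E z x _ => IsGPerm1 E z x, fun M E z x _ => IsGPerm2 E z x]
theorem GR.u (i : Fin 10) : V3 (GR i) := match i with
  | 0 | 1 | 2 | 3 | 4 | 5 | 6 | 7 | 8 | 9 => ⟨by simp only [GR, Matrix.cons_val]; infer_instance⟩
theorem gop_iff (i : Fin 10) (x y z : M) : GR i M ZM.E z x y ↔ z = gop i x y := match i with
  | 0 => up_iff
  | 1 => all_eq (y := cp x y) (by simp [kp_iff]) _
  | 2 => all_eq (y := mmr x y) (by simp [kp_iff, mem_mmr]) _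
  | 3 => all_eq (fun _ => mem_dif) _
  | 4 => all_eq (fun _ => mem_int) _
  | 5 => all_eq (y := un x) (fun _ => mem_un) _
  | 6 => all_eq (y := dmn x) (fun _ => by
    rw [mem_dmn]; simp only [kp_iff]; exact ⟨fun ⟨y, h⟩ => ⟨_, y, h, rfl⟩, by grind⟩) _
  | 7 => all_eq (y := cnv x) (fun _ => by rw [mem_cnv]; simp [kp_iff]) _
  | 8 => all_eq (y := pm1 x) (fun _ => by rw [mem_pm1]; simp [kt_iff]) _
  | 9 => all_eq (y := pm2 x) (fun _ => by rw [mem_pm2]; simp [kt_iff]) _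
theorem gcd_iff {c : M} : GClosed ZM.E c ↔ gcd c := by
  have e1 (x y z : M) : IsGProd ZM.E z x y ↔ z = cp x y := gop_iff 1 x y z
  have e2 (x y z : M) : IsGMemRel ZM.E z x y ↔ z = mmr x y := gop_iff 2 x y z
  have e3 (x y z : M) : IsGDiff ZM.E z x y ↔ z = dif x y := gop_iff 3 x y z
  have e4 (x y z : M) : IsGInter ZM.E z x y ↔ z = int x y := gop_iff 4 x y z
  have e5 (x z : M) : IsGUnionSet ZM.E z x ↔ z = un x := gop_iff 5 x x z
  have e6 (x z : M) : IsGDom ZM.E z x ↔ z = dmn x := gop_iff 6 x x z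
  have e7 (x z : M) : IsGConv ZM.E z x ↔ z = cnv x := gop_iff 7 x x z
  have e8 (x z : M) : IsGPerm1 ZM.E z x ↔ z = pm1 x := gop_iff 8 x x z
  have e9 (x z : M) : IsGPerm2 ZM.E z x ↔ z = pm2 x := gop_iff 9 x x z
  simp only [GClosed, up_iff, e1, e2, e3, e4, e5, e6, e7, e8, e9]
  constructor
  · rintro ⟨h, h'⟩ i x y hx hy
    fin_cases i <;> first | (refine h x y _ hx hy ?_; simp [gop]; done) | (refine h' x _ hx ?_; simp [gop])
  · intro h
    refine ⟨fun x y z hx hy e => ?_, fun x z hx e => ?_⟩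
    · rcases e with rfl | rfl | rfl | rfl | rfl
      exacts [h 0 x y hx hy, h 1 x y hx hy, h 2 x y hx hy, h 3 x y hx hy, h 4 x y hx hy]
    · rcases e with rfl | rfl | rfl | rfl | rfl
      exacts [h 5 x x hx hx, h 6 x x hx hx, h 7 x x hx hx, h 8 x x hx hx, h 9 x x hx hx]
theorem gcl_iff {b c : M} : IsGClOf ZM.E b c ↔ c = gcl b := by
  simp only [IsGClOf, gcd_iff]
  exact ⟨fun ⟨h, h1, h2⟩ => sub_ext (h2 _ (sub_gcl b) (gcd_gcl b)) (gcl_least h h1),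
    by rintro rfl; exact ⟨sub_gcl b, gcd_gcl b, fun c h h' => gcl_least h h'⟩⟩
theorem trc_iff {b c : M} : IsTransClOf ZM.E b c ↔ c = trc b :=
  ⟨fun ⟨h, h1, h2⟩ => sub_ext (h2 _ (sub_trc b) (tr_trc b)) (trc_least h h1),
    by rintro rfl; exact ⟨sub_trc b, tr_trc b, fun c h h' => trc_least h h'⟩⟩
theorem dfs_iff {b c : M} : IsDefSetOf ZM.E b c ↔ c = dfs b := by
  have e : ∀ lp, (∀ z, ZM.E z lp ↔ (ZM.E z b ∨ z = b)) ↔ lp = sc b := all_eq (fun z => mem_sc)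
  simp only [IsDefSetOf, gcl_iff, e]
  constructor
  · rintro ⟨_, _, rfl, rfl, h⟩; exact (all_eq (fun z => mem_dfs) _).1 h
  · rintro rfl; exact ⟨_, _, rfl, rfl, fun z => mem_dfs⟩
theorem L0_iff {b c : M} : IsLZero ZM.E b c ↔ c = L0 b := by
  simp only [IsLZero, trc_iff]
  constructor
  · rintro ⟨_, rfl, h⟩; exact (all_eq (fun z => by simp [L0]) _).1 h
  · rintro rfl; exact ⟨_, rfl, fun z => by simp [L0]⟩
theorem fn_gr {F : M → M} [F1 Tp F] (a : M) : IsFunc ZM.E (gr a F) ∧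
    ∀ c y : M, kp c y ε gr a F ↔ c ε a ∧ y = F c := by
  have h : ∀ c y : M, kp c y ε gr a F ↔ c ε a ∧ y = F c := fun c y => by
    rw [mem_gr]; simp only [kp_eq]
    grind
  refine ⟨⟨fun p hp => ?_, fun x y y' => ?_⟩, h⟩
  · obtain ⟨x, _, rfl⟩ := mem_gr.1 hp; exact ⟨_, _, kp_iff.2 rfl⟩
  · rw [pin_iff, pin_iff, h, h]; grind
theorem LS_iff {b a l : M} : IsLStage ZM.E b a l ↔ On a ∧ l = Lf b a := by
  simp only [IsLStage, IsLHier, pin_iff, L0_iff, dfs_iff, zero_iff, succ_iff, lim_iff, on_iff]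
  constructor
  · rintro ⟨H, ⟨ha, hf, hd, h0, hs, hl⟩, hm⟩
    refine ⟨ha, ?_⟩
    have : ∀ c, On c → c ε sc a → ∀ z, kp c z ε H → z = Lf b c := fun c hc => by
      refine oind (fun c => c ε sc a → ∀ z, kp c z ε H → z = Lf b c) (fun c hc ih hca z hz => ?_) hc
      have hi : ∀ d, d ε c → ∃ u, kp d u ε H ∧ u = Lf b d := fun d h => by
        have hd' : d ε sc a := ha.sc.1 _ hca _ h
        obtain ⟨u, hu⟩ := (hd d).2 (mem_sc.1 hd')
        grind
      rcases ocase hc with rfl | ⟨d, hd, hdo, rfl⟩ | hli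
      · rw [h0 _ z rfl hz, Lf, hr_emp]
      · obtain ⟨u, hu, e⟩ := hi d hd
        rw [hs d _ u z rfl hu hz, e, Lf_sc hdo]
      · refine eqx fun x => ?_
        rw [hl c z hli hz, Lf, hr_lim hli]
        constructor
        · rintro ⟨d, u, h, h1, h2⟩
          obtain ⟨u', h3, h4⟩ := hi d h
          rw [hf.2 d u u' (pin_iff.2 h1) (pin_iff.2 h3), h4] at h2
          exact ⟨d, h, h2⟩
        · rintro ⟨d, h, h2⟩
          obtain ⟨u', h3, h4⟩ := hi d h
          exact ⟨d, u', h, h3, h4 ▸ h2⟩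
    exact this a ha (by simp) l hm
  · rintro ⟨ha, rfl⟩
    obtain ⟨h1, h2⟩ := fn_gr (F := Lf b) (sc a)
    have ho : ∀ {c}, c ε sc a → On c := fun h => ha.sc.mem h
    refine ⟨_, ⟨ha, h1, ?_, ?_, ?_, ?_⟩, (h2 _ _).2 ⟨by simp, rfl⟩⟩ <;> simp only [h2]
    · intro c; rw [← mem_sc]; simp
    · rintro c z rfl ⟨_, rfl⟩; rw [Lf, hr_emp]
    · rintro c s z w rfl ⟨h, rfl⟩ ⟨_, rfl⟩; rw [Lf_sc (ho h)]
    · rintro c z hl ⟨h, rfl⟩ x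
      rw [Lf, hr_lim hl]
      constructor
      · rintro ⟨m, hm, h'⟩; exact ⟨m, _, hm, ⟨ha.sc.1 _ h _ hm, rfl⟩, h'⟩
      · rintro ⟨m, _, hm, ⟨_, rfl⟩, h'⟩; exact ⟨m, hm, h'⟩
theorem InL_iff {b x : M} : InL ZM.E b x ↔ IL b x := by
  simp only [InL, LS_iff, IL]
  grind
theorem mem_Vf {a x : M} (ha : On a) : x ε Vf a ↔ ∃ c, c ε a ∧ sub x (Vf c) := by
  rw [Vf, mem_hr ha]; simp [Vf]
theorem VS_iff {a l : M} : IsVStage ZM.E a l ↔ On a ∧ l = Vf a := by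
  simp only [IsVStage, IsVHier, pin_iff, on_iff]
  constructor
  · rintro ⟨H, ⟨ha, hf, hd, hs⟩, hm⟩
    refine ⟨ha, ?_⟩
    have : ∀ c, On c → c ε sc a → ∀ z, kp c z ε H → z = Vf c := fun c hc => by
      refine oind (fun c => c ε sc a → ∀ z, kp c z ε H → z = Vf c) (fun c hc ih hca z hz => ?_) hc
      refine eqx fun x => ?_
      rw [hs c z hz, mem_Vf hc]
      constructor
      · rintro ⟨d, u, h, h1, h2⟩
        exact ⟨d, h, ih d h (ha.sc.1 _ hca _ h) u h1 ▸ h2⟩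
      · rintro ⟨d, h, h2⟩
        have hd' : d ε sc a := ha.sc.1 _ hca _ h
        obtain ⟨u, hu⟩ := (hd d).2 (mem_sc.1 hd')
        exact ⟨d, u, h, hu, ih d h hd' u hu ▸ h2⟩
    exact this a ha (by simp) l hm
  · rintro ⟨ha, rfl⟩
    obtain ⟨h1, h2⟩ := fn_gr (F := Vf) (sc a)
    refine ⟨_, ⟨ha, h1, ?_, ?_⟩, (h2 _ _).2 ⟨by simp, rfl⟩⟩ <;> simp only [h2]
    · simp_all
    · rintro c z ⟨h, rfl⟩ x
      rw [mem_Vf (ha.sc.mem h)]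
      constructor
      · rintro ⟨m, hm, h'⟩; exact ⟨m, _, hm, ⟨ha.sc.1 _ h _ hm, rfl⟩, h'⟩
      · rintro ⟨m, _, hm, ⟨_, rfl⟩, h'⟩; exact ⟨m, hm, h'⟩
theorem Vf_le {a c : M} (ha : On a) (hc : On c) (h : le a c) : sub (Vf a) (Vf c) := hr_le ha hc h
theorem ex_rank {A a : M} (ha : On a) (h : sub A (Vf a)) : ∃ r, IsRankOf ZM.E A r ∧ On r ∧ le r a := by
  obtain ⟨r, hr, h1, h2, h3⟩ := lst (fun a => sub A (Vf a)) ha h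
  refine ⟨r, ⟨hr, ⟨_, VS_iff.2 ⟨hr, rfl⟩, h1⟩, fun r' v' ho hv hs => ?_⟩, hr, h3⟩
  obtain ⟨_, rfl⟩ := VS_iff.1 hv
  rcases hr.tri ho with h | h | h
  exacts [.inr h, .inl h, absurd hs (h2 _ h)]
def scn : ℕ → M → M
  | 0, x => x
  | n+1, x => scn n (sc x)
theorem it_iff (n : ℕ) (x y : M) : OrdIter ZM.E n x y ↔ y = scn n x := by
  induction n generalizing x with
  | zero => exact eq_comm
  | succ n ih => simp only [OrdIter, succ_iff, ih]; exact ⟨by rintro ⟨_, rfl, h⟩; exact h, fun h => ⟨_, rfl, h⟩⟩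
end
theorem U.fin {n m : ℕ} : ∀ {A : Fin m → ∀ M : Type, (M → M → Prop) → (Fin n → M) → Prop} (_ : ∀ i, U (A i)),
    U (fun M E v => ∀ i, A i M E v) := by
  induction m with
  | zero => intro A h; exact (U.all (R := fun M E v x => x = x)).congr (fun _ _ v => by simp)
  | succ m ih => intro A h; simp only [Fin.forall_fin_succ]
                 have := ih (fun i => h i.succ); infer_instance
theorem U.exs {m : ℕ} : ∀ {n : ℕ} {Q : ∀ M : Type, (M → M → Prop) → (Fin m → M) → (Fin n → M) → Prop}
    (_ : U (fun M E (w : Fin (n+m) → M) =>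
      Q M E (fun i => w (Fin.natAdd n i)) (fun i => w (Fin.castAdd m i)))),
    U (fun M E v => ∃ u, Q M E u v) := by
  induction m with
  | zero => intro n Q h; refine h.congr fun M E v => ?_
            constructor
            · rintro ⟨u, h⟩; convert h; rfl
            · exact fun h => ⟨_, h⟩
  | succ m ih =>
    intro n Q h
    have h1 := ih (n := n+1) (Q := fun M E u w => Q M E (Fin.cons (w 0) u) (fun i => w i.succ))
      ((h.rn (Fin.addCases (fun i => Fin.castAdd m i.succ)
        (Fin.cases (Fin.castAdd m 0) (fun i => Fin.natAdd (n+1) i)))).congr fun M E v => by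
        simp only [Fin.addCases_left, Fin.addCases_right]
        refine iff_of_eq (congrArg₂ _ ?_ rfl)
        funext i; refine Fin.cases ?_ (fun i => ?_) i <;> simp)
    refine (U.ex (R := fun M E v x => ∃ u : Fin m → M, Q M E (Fin.cons x u) v)).congr fun M E v => ?_
    constructor
    · rintro ⟨u, h⟩; exact ⟨u 0, fun i => u i.succ, by rwa [show (Fin.cons (u 0) (fun i => u i.succ) : Fin (m+1) → M) = u from Fin.cons_self_tail u]⟩
    · grind
def IsAp (M : Type) (E : M → M → Prop) (f x y : M) : Prop := ∀ z, E z y ↔ ∃ u, PairIn E f x u ∧ E z u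
instance : V3 @PairIn := ⟨by unfold PairIn; infer_instance⟩
instance : V3 IsAp := ⟨by unfold IsAp; infer_instance⟩
noncomputable section
def Elm {T L : Type} [ZM T] [ZM L] (j : T → L) : Prop := ∀ ⦃n : ℕ⦄ (f : Fml n) (v : Fin n → T),
  Eval ZM.E NoAux AllSets f v ↔ Eval ZM.E NoAux AllSets f (fun i => j (v i))
theorem Elm.tr {T L : Type} [ZM T] [ZM L] {j : T → L} (h : Elm j) {n : ℕ}
    {R : ∀ M : Type, (M → M → Prop) → (Fin n → M) → Prop} (a : U R) (v : Fin n → T) :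
    R T ZM.E v ↔ R L ZM.E (fun i => j (v i)) := U.tr (fun f v => h f v) a v
theorem Elm.inj {T L : Type} [ZM T] [ZM L] {j : T → L} (h : Elm j) {x y : T} : j x = j y ↔ x = y :=
  (h (.equ (0 : Fin 2) 1) ![x, y]).symm
theorem Elm.mem {T L : Type} [ZM T] [ZM L] {j : T → L} (h : Elm j) {x y : T} : j x ε j y ↔ x ε y :=
  (h (.mem (0 : Fin 2) 1) ![x, y]).symm
variable [ZM M] {S : M → Prop}
theorem ap_iff {f x y : M} : IsAp M ZM.E f x y ↔ y = ap f x := all_eq (fun z => by rw [mem_ap]; simp [pin_iff]) _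
theorem Df.un {n : ℕ} {R : ∀ M : Type, (M → M → Prop) → (Fin n → M) → Prop} (a : U R) : Df S (R M ZM.E) := by
  obtain ⟨f, hf⟩ := a.h
  have e : AllSets = fun x : M => x = x := by funext x; simp [AllSets]
  have := Df.ev (S := S) (C := fun _ x : M => x = x) f (s := fun _ : Fin n → M => emp)
    inferInstance (t := fun i v => v i) inferInstance
  exact this.congr fun v => by grind
structure Emb (b b1 : M) (j : M → M) : Prop where
  mp : ∀ x, IL b x → IL b1 (j x)
  el : Elm (fun x : LL b => (⟨j x.1, mp x.1 x.2⟩ : LL b1))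
section
variable {b b1 : M} {j : M → M}
def Emb.t (h : Emb b b1 j) (x : LL b) : LL b1 := ⟨j x.1, h.mp x.1 x.2⟩
theorem Emb.tr (h : Emb b b1 j) {n : ℕ} {R : ∀ M : Type, (M → M → Prop) → (Fin n → M) → Prop} (a : U R)
    (v : Fin n → LL b) : R (LL b) ZM.E v ↔ R (LL b1) ZM.E (fun i => h.t (v i)) := h.el.tr a v
theorem Emb.push (h : Emb b b1 j) (s : LL b) {n : ℕ}
    {R : ∀ M : Type, (M → M → Prop) → (Fin (n+2) → M) → Prop} (a : U R) (p : Fin n → LL b) :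
    ∃ F : LL b, ∀ x y : LL b1, x ε h.t s →
      (∀ z, R (LL b1) ZM.E (Fin.cons z (Fin.cons x fun i => h.t (p i))) ↔ z = y) →
      ap (h.t F) x = y := by
  have : D2 Tp (fun z x => R (LL b) ZM.E (Fin.cons z (Fin.cons x p))) := ⟨
    ((Df.un (S := Tp) a).sbs
    (fun i => by
      refine Fin.cases ?_ (fun i => Fin.cases ?_ (fun i => ?_) i) i
      · exact DfF.var 0
      · exact DfF.var 1
      · simp only [Fin.cons_succ]; exact inferInstance))⟩
  let Q z x := R (LL b) ZM.E (Fin.cons z (Fin.cons x p))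
  have : D2 Tp Q := this
  obtain ⟨h1, h2⟩ := fn_gr (F := fun x => the (fun z => ∀ z', Q z' x ↔ z' = z)) s
  let F := gr s (fun x => the (fun z => ∀ z', Q z' x ↔ z' = z))
  have i1 : ∀ {m : ℕ} (a c : Fin m) (r : Fin n → Fin m), U (fun M E (w : Fin m → M) =>
      R M E (Fin.cons (w a) (Fin.cons (w c) fun i => w (r i)))) := fun a' c r =>
      (a.rn (Fin.cons a' (Fin.cons c r))).congr fun M E w => iff_of_eq (congrArg _ (by
        funext i; refine Fin.cases ?_ (fun i => Fin.cases ?_ (fun i => ?_) i) i <;> simp))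
  have t1 := (h.tr (n := n+2) (R := fun M E v => ∀ x z, E x (v 1) →
    (∀ z', R M E (Fin.cons z' (Fin.cons x fun i => v i.succ.succ)) ↔ z' = z) → PairIn E (v 0) x z) inferInstance
    (Fin.cons F (Fin.cons s p))).1 (by
      intro x z hx hz
      simp only [Fin.cons_zero, Fin.cons_succ] at hz
      rw [pin_iff]
      refine (h2 _ _).2 ⟨hx, (the_eq (Q := fun z => ∀ z', Q z' x ↔ z' = z) hz fun z' hz' => ?_).symm⟩
      exact ((hz' z').1 |> fun _ => (hz z').1 ((hz' z').2 rfl)))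
  have t2 := (h.tr (n := 1) (R := fun M E v => ∀ x u u', PairIn E (v 0) x u → PairIn E (v 0) x u' → u = u')
    inferInstance ![F]).1 h1.2
  refine ⟨F, fun x y hx hy => ?_⟩
  simp only [Fin.cons_zero, Fin.cons_succ] at t1
  have := t1 x y hx hy
  exact ap_eq (pin_iff.1 this) fun z hz => t2 x z y (pin_iff.2 hz) this
def hul (b : M) (j : M → M) (D y : M) : Prop := ∃ f a, IL b f ∧ a ε D ∧ y = ap (j f) a
instance [F1 S j] : D3 S (fun b D y => hul b j D y) := by unfold hul; infer_instance
def Dcl (c : M) (H : M → Prop) : Prop := ∀ ⦃n : ℕ⦄ (f : Fml (n+1)) (v : Fin n → LL c) (y : LL c),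
  (∀ i, H (v i).1) → (∀ z : LL c, Eval ZM.E NoAux AllSets f (Fin.cons z v) ↔ z = y) → H y.1
theorem Emb.apt (h : Emb b b1 j) (f : LL b) (x : LL b1) : (ap (h.t f) x).1 = ap (j f.1) x.1 := (LL_tri b1).ap _ _
theorem Emb.cmp (h : Emb b b1 j) (s f g : LL b) : ∃ k : LL b, ∀ x : LL b1, x ε h.t s →
    ap (h.t k) x = ap (h.t f) (ap (h.t g) x) := by
  obtain ⟨F, hF⟩ := h.push s (R := fun M E v => ∃ u, IsAp M E (v 3) (v 1) u ∧ IsAp M E (v 2) u (v 0))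
    inferInstance ![f, g]
  refine ⟨F, fun x hx => hF x _ hx fun z => ?_⟩
  have : (∃ u, IsAp (LL b1) ZM.E (h.t g) x u ∧ IsAp (LL b1) ZM.E (h.t f) u z) ↔ z = ap (h.t f) (ap (h.t g) x) := by
    simp [ap_iff]
  exact this
def Seed (b : M) (j : M → M) (D : M) : Prop := (∃ a, a ε D) ∧ ∀ a a', a ε D → a' ε D →
  ∃ c g g', c ε D ∧ IL b g ∧ IL b g' ∧ a = ap (j g) c ∧ a' = ap (j g') c
theorem Emb.hul (h : Emb b b1 j) {s D : M} (hs : IL b s) (hD : sub D (j s)) (hS : Seed b j D) :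
    Dcl b1 (hul b j D) := by
  have hDL : ∀ {x}, x ε D → IL b1 x := fun hx => (h.mp _ hs).tr (hD _ hx)
  have cs : ∀ (n : ℕ) (v : Fin n → LL b1), (∀ i, ZFI0.hul b j D (v i).1) →
      ∃ (f : Fin n → LL b) (a : LL b1), a.1 ε D ∧ ∀ i, v i = ap (h.t (f i)) a := by
    intro n
    induction n with
    | zero => intro v _; obtain ⟨a, ha⟩ := hS.1; exact ⟨Fin.elim0, ⟨a, hDL ha⟩, ha, fun i => i.elim0⟩
    | succ n ih =>
      intro v hv
      obtain ⟨f, a, ha, hf⟩ := ih (fun i => v i.succ) (fun i => hv i.succ)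
      obtain ⟨f0, a0, hf0, ha0, e0⟩ := hv 0
      obtain ⟨c, g, g', hc, hg, hg', e1, e2⟩ := hS.2 _ _ ha0 ha
      have k := fun (f : LL b) (g : LL b) => h.cmp ⟨s, hs⟩ f g
      choose k hk using k
      have hc' : (⟨c, hDL hc⟩ : LL b1) ε h.t ⟨s, hs⟩ := hD _ hc
      refine ⟨Fin.cons (k ⟨f0, hf0⟩ ⟨g, hg⟩) (fun i => k (f i) ⟨g', hg'⟩), ⟨c, hDL hc⟩, hc, ?_⟩
      refine Fin.cases ?_ (fun i => ?_)
      · rw [Fin.cons_zero, hk _ _ _ hc']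
        apply Subtype.ext
        rw [h.apt, h.apt, ← e1]; exact e0
      · rw [Fin.cons_succ, hk _ _ _ hc']
        have : ap (h.t ⟨g', hg'⟩) ⟨c, hDL hc⟩ = a := Subtype.ext (by rw [h.apt, e2])
        rw [this]; exact hf i
  intro n f v y hv hy
  obtain ⟨g, a, ha, hg⟩ := cs n v hv
  have i1 : U (fun M E (w : Fin (n+2) → M) => ∃ u : Fin n → M, (∀ i, IsAp M E (w i.succ.succ) (w 1) (u i)) ∧
      Eval E NoAux AllSets f (Fin.cons (w 0) u)) := by
    refine U.exs (n := n+2) (m := n) (Q := fun M E u w => (∀ i, IsAp M E (w i.succ.succ) (w 1) (u i)) ∧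
      Eval E NoAux AllSets f (Fin.cons (w 0) u)) ?_
    have h1 := U.fin (m := n) (n := n+2+n) (A := fun i M E w => IsAp M E (w (Fin.castAdd n i.succ.succ))
      (w (Fin.castAdd n 1)) (w (Fin.natAdd (n+2) i))) fun i => inferInstance
    have h2 := (U.ev f).rn (m := n+2+n) (Fin.cons (Fin.castAdd n 0) (Fin.natAdd (n+2)))
    refine (@U.and _ _ _ h1 h2).congr fun M E w => and_congr Iff.rfl (iff_of_eq (congrArg _ (by
        funext i; refine Fin.cases ?_ (fun i => ?_) i <;> simp)))
  obtain ⟨F, hF⟩ := h.push ⟨s, hs⟩ i1 g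
  refine ⟨F, a, F.2, ha, ?_⟩
  rw [← h.apt, hF a y (hD _ ha) fun z => ?_]
  rw [← hy z]
  simp only [Fin.cons_zero, Fin.cons_succ, Fin.cons_one, ap_iff, ← hg]
  constructor
  · rintro ⟨u, hu, hh⟩
    rw [← funext hu]; exact hh
  · exact fun hh => ⟨v, fun i => rfl, hh⟩
end
end
noncomputable section
variable [ZM M] {S : M → Prop} {b c : M} {H : M → Prop}
theorem Dcl.tm (h : Dcl c H) {n : ℕ} (t : (Fin n → LL c) → LL c) [a : DfF Bt t] (v : Fin n → LL c)
    (hv : ∀ i, H (v i).1) : H (t v).1 := by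
  obtain ⟨k, f, p, hp, e⟩ := a.h.h
  cases k with
  | succ k => exact (hp 0).elim
  | zero =>
    refine h f v _ hv fun z => ?_
    have := e (Fin.cons z v)
    simp only [Fin.cons_zero, Fin.cons_succ] at this
    rw [this]
    refine iff_of_eq (congrArg _ ?_)
    funext i; exact (Fin.append_left (Fin.cons z v : Fin (n+1) → LL c) p i).symm
theorem Dcl.t1 (h : Dcl c H) (t : LL c → LL c) [a : F1 Bt t] (x : LL c) (hx : H x.1) : H (t x).1 :=
  h.tm (fun v : Fin 1 → LL c => t (v 0)) ![x] (by simp_all)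
theorem Dcl.t2 (h : Dcl c H) (t : LL c → LL c → LL c) [a : F2 Bt t] (x y : LL c) (hx : H x.1) (hy : H y.1) :
    H (t x y).1 :=
  h.tm (fun v : Fin 2 → LL c => t (v 0) (v 1)) ![x, y] (by simp_all)
theorem Dcl.t3 (h : Dcl c H) (t : LL c → LL c → LL c → LL c) [a : F3 Bt t] (x y z : LL c) (hx : H x.1) (hy : H y.1)
    (hz : H z.1) : H (t x y z).1 :=
  h.tm (fun v : Fin 3 → LL c => t (v 0) (v 1) (v 2)) ![x, y, z] (by simp [Fin.forall_fin_succ, hx, hy, hz])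
structure Hl (c : M) (H : M → Prop) : Prop where
  d : D1 Tp H
  l : ∀ x, H x → IL c x
  z : ∀ x, x ε L0 c → H x
  c : Dcl c H
theorem Hl.on (h : Hl c H) : ∀ {x}, x ε om → H x := by
  have := h.d
  refine fun {x} hx => nind H ?_ (fun x hx hh => ?_) hx
  · have := h.c.tm (fun _ : Fin 0 → LL c => emp) Fin.elim0 (fun i => i.elim0)
    rwa [show ((emp : LL c)).1 = emp from (LL_tri c).emp] at this
  · have := h.c.t1 sc ⟨x, h.l _ hh⟩ hh
    rwa [(LL_tri c).sc] at this
theorem Hl.meets (h : Hl c H) {X : M} (hX : H X) (hn : ∃ x, x ε X) : ∃ x, x ε X ∧ H x := by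
  have := h.d
  have hcH : H c := h.z _ (mem_L0 c)
  let c' : LL c := ⟨c, IL.bs⟩
  have ι := LL_tri c
  have key : ∀ {γ}, On γ → ∀ X, H X → (∃ x, x ε X ∧ x ε Lf c γ) → ∃ x, x ε X ∧ H x := by
    intro γ hγ
    refine oind (fun γ => ∀ X, H X → (∃ x, x ε X ∧ x ε Lf c γ) → ∃ x, x ε X ∧ H x) (fun γ hγ ih X hX hx => ?_) hγ
    obtain ⟨x, hxX, hx⟩ := hx
    rcases ocase hγ with rfl | ⟨a, ha, hoa, rfl⟩ | hl
    · rw [Lf, hr_emp] at hx; exact ⟨x, hxX, h.z _ hx⟩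
    · by_cases hm : ∃ x, x ε X ∧ x ε Lf c a
      · exact ih a ha X hX hm
      have oa' : On (⟨a, IL.on hoa⟩ : LL c) := ι.on.1 hoa
      have hag : ∃ g : LL c, g.1 = a ∧ H g.1 := by
        have e : ∀ g : LL c, On g → (Lf c' g).1 = Lf c g.1 := fun g hg => ι.Lf c' hg
        let t : LL c → LL c → LL c := fun X c => lo (fun g => ∃ x, x ε X ∧ x ε Lf c (sc g))
        have : F2 Bt t := by unfold t; infer_instance
        refine ⟨t ⟨X, h.l _ hX⟩ c', ?_, h.c.t2 t _ _ hX hcH⟩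
        have hs := lo_spec (fun g : LL c => ∃ x, x ε (⟨X, h.l _ hX⟩ : LL c) ∧ x ε Lf c' (sc g))
          ⟨_, oa', ⟨x, (h.l _ hX).tr hxX⟩, hxX, by
            refine (ι.e _ _).1 ?_
            simp only [e _ oa'.sc, ι.sc]; exact hx⟩
        have e1 : On (t ⟨X, h.l _ hX⟩ c').1 := ι.on.2 hs.1
        rcases e1.tri hoa with h1 | h1 | h1
        · obtain ⟨y, hy, hy'⟩ := hs.2.1
          have h3 := (ι.e _ _).2 hy'
          simp only [e _ hs.1.sc, ι.sc] at h3
          exact (hm ⟨y.1, hy, Lf_le e1.sc hoa ((sc_le e1 hoa).2 h1) _ h3⟩).elim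
        · exact h1
        · rcases hs.2.2 _ oa' ⟨⟨x, (h.l _ hX).tr hxX⟩, hxX, by
            refine (ι.e _ _).1 ?_
            simp only [e _ oa'.sc, ι.sc]; exact hx⟩ with h2 | h2
          · exact (nmem2 h1 ((ι.e _ _).2 h2)).elim
          · rw [show t ⟨X, h.l _ hX⟩ c' = _ from h2] at h1; exact (nmem_self h1).elim
      obtain ⟨g, rfl, hg⟩ := hag
      have hog : On g := ι.on.1 hoa
      let s : LL c → LL c := fun n => hr gst (sc (Lf c' g)) n
      have es : ∀ n : LL c, On n → (s n).1 = hr gst (sc (Lf c g.1)) n.1 := fun n hn => by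
        show (hr gst (sc (Lf c' g)) n).1 = _
        rw [ι.hr ι.gst hn, ι.sc, ι.Lf c' hog]
      have hs : ∀ n : LL c, n.1 ε om → On n ∧ H (s n).1 := fun n hn => by
        refine ⟨ι.on.1 (omn.mem hn), h.c.t3 (fun n c g => hr gst (sc (Lf c g)) n) n c' g (h.on hn) hcH hg⟩
      have hQ : ∀ {n}, n ε om → ∀ Y, H Y → (∃ x, x ε Y ∧ x ε hr gst (sc (Lf c g.1)) n) → ∃ x, x ε Y ∧ H x := by
        intro n hn
        refine nind (fun n => ∀ Y, H Y → (∃ x, x ε Y ∧ x ε hr gst (sc (Lf c g.1)) n) → ∃ x, x ε Y ∧ H x) ?_ ?_ hn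
        · rintro Y hY ⟨x, hx, hx'⟩
          rw [hr_emp, mem_sc] at hx'
          rcases hx' with hx' | rfl
          · exact ih g.1 ha Y hY ⟨x, hx, hx'⟩
          · refine ⟨_, hx, ?_⟩
            have := h.c.t2 Lf c' g hcH hg
            rwa [ι.Lf c' hog] at this
        · rintro n hn ih2 Y hY ⟨x, hx, hx'⟩
          rw [hr_sc (omn.mem hn), mem_bu, mem_gst] at hx'
          rcases hx' with hx' | ⟨u, w, hu, hw, i, rfl⟩
          · exact ih2 Y hY ⟨x, hx, hx'⟩
          let n' : LL c := ⟨n, IL.on (omn.mem hn)⟩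
          obtain ⟨h1, h2⟩ := hs n' hn
          have hsn := es n' h1
          have ms : ∀ {u}, u ε hr gst (sc (Lf c g.1)) n → IL c u := fun {u} hu => by
            rw [show hr gst (sc (Lf c g.1)) n = (s n').1 from hsn.symm] at hu; exact (s n').2.tr hu
          let Y' : LL c := ⟨Y, h.l _ hY⟩
          let t1 : LL c → LL c → LL c := fun s Y => sep s (fun u => ∃ w, w ε s ∧ gop i u w ε Y)
          have : F2 Bt t1 := by unfold t1; infer_instance
          obtain ⟨u0, hu0, hHu⟩ := ih2 _ (h.c.t2 t1 (s n') Y' h2 hY) ⟨u, by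
            have : (⟨u, ms hu⟩ : LL c) ε t1 (s n') Y' := mem_sep.2
              ⟨by rw [← ι.e, hsn]; exact hu, ⟨w, ms hw⟩, by rw [← ι.e, hsn]; exact hw, by rw [← ι.e, ι.gop]; exact hx⟩
            exact this, hu⟩
          have hLu := (t1 (s n') Y').2.tr hu0
          obtain ⟨h3, w1, hw1, hw1'⟩ := mem_sep.1 (show (⟨u0, hLu⟩ : LL c) ε t1 (s n') Y' from hu0)
          let t2 : LL c → LL c → LL c → LL c := fun s Y u => sep s (fun w => gop i u w ε Y)
          have : F3 Bt t2 := by unfold t2; infer_instance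
          obtain ⟨w0, hw0, hHw⟩ := ih2 _ (h.c.t3 t2 (s n') Y' ⟨u0, hLu⟩ h2 hY hHu) ⟨w1.1, by
            have : w1 ε t2 (s n') Y' ⟨u0, hLu⟩ := mem_sep.2 ⟨hw1, hw1'⟩
            exact this, by rw [show hr gst (sc (Lf c g.1)) n = (s n').1 from hsn.symm]; exact hw1⟩
          have hLw := (t2 (s n') Y' ⟨u0, hLu⟩).2.tr hw0
          obtain ⟨h5, h6⟩ := mem_sep.1 (show (⟨w0, hLw⟩ : LL c) ε t2 (s n') Y' ⟨u0, hLu⟩ from hw0)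
          exact ⟨_, h6, h.c.t2 (gop i) ⟨u0, hLu⟩ ⟨w0, hLw⟩ hHu hHw⟩
      rw [Lf_sc hoa, mem_dfs, gcl, hr_lim om_spec.1] at hx
      obtain ⟨-, n, hn, hx⟩ := hx
      exact hQ hn X hX ⟨x, hxX, hx⟩
    · obtain ⟨m, hm, hx⟩ := (hr_lim hl).1 hx
      exact ih m hm X hX ⟨x, hxX, hx⟩
  obtain ⟨x, hx⟩ := hn
  obtain ⟨γ, hγ, hx'⟩ := (h.l _ hX).tr hx
  exact key hγ X hX ⟨x, hx, hx'⟩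
theorem Hl.wit (h : Hl c H) {n : ℕ} (f : Fml (n+1)) (v : Fin n → LL c) (hv : ∀ i, H (v i).1)
    (hx : ∃ x, Eval ZM.E NoAux AllSets f (Fin.cons x v)) : ∃ x : LL c, H x.1 ∧ Eval ZM.E NoAux AllSets f (Fin.cons x v) := by
  let c' : LL c := ⟨c, IL.bs⟩
  have i1 : ∀ {m : ℕ} (a : Fin m) (r : Fin n → Fin m), Df Bt (fun (w : Fin m → LL c) =>
      Eval ZM.E NoAux AllSets f (Fin.cons (w a) fun i => w (r i))) := fun a r =>
    (Df.un ((U.ev f).rn (Fin.cons a r))).congr fun w => iff_of_eq (congrArg _ (by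
      funext i; refine Fin.cases ?_ (fun i => ?_) i <;> simp))
  let t : (Fin (n+1) → LL c) → LL c := fun w => sep (Lf (w 0) (lo (fun g => ∃ x, x ε Lf (w 0) g ∧
    Eval ZM.E NoAux AllSets f (Fin.cons x fun i => w i.succ)))) (fun x => Eval ZM.E NoAux AllSets f (Fin.cons x fun i => w i.succ))
  have : DfF Bt t := by unfold t; infer_instance
  have i2 : ∀ {m : ℕ} (a : Fin m), Df Tp (fun (w : Fin m → LL c) => Eval ZM.E NoAux AllSets f (Fin.cons (w a) v)) := fun a =>
    ((Df.un (S := Tp) (U.ev f)).sbs (t := fun i w => (Fin.cons (w a) v : Fin (n+1) → LL c) i) (fun i => by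
      refine Fin.cases ?_ (fun i => ?_) i
      · exact DfF.var a
      · simp only [Fin.cons_succ]; exact inferInstance))
  have e : t (Fin.cons c' v) = sep (Lf c' (lo (fun g => ∃ x, x ε Lf c' g ∧
    Eval ZM.E NoAux AllSets f (Fin.cons x v)))) (fun x => Eval ZM.E NoAux AllSets f (Fin.cons x v)) := rfl
  have : D1 Tp (fun x : LL c => Eval ZM.E NoAux AllSets f (Fin.cons x v)) := ⟨i2 0⟩
  have hH := h.c.tm t (Fin.cons c' v) (fun i => by
    refine Fin.cases ?_ (fun i => ?_) i
    · exact h.z _ (mem_L0 c)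
    · exact hv i)
  obtain ⟨x, hx⟩ := hx
  obtain ⟨a, ha, hxa⟩ := LL_V c' rfl x
  obtain ⟨h1, ⟨y, hy, hy'⟩, -⟩ := lo_spec (fun g => ∃ x, x ε Lf c' g ∧
    Eval ZM.E NoAux AllSets f (Fin.cons x v)) ⟨a, ha, x, hxa, hx⟩
  obtain ⟨z, hz, hz'⟩ := h.meets hH ⟨y.1, (by rw [e]; exact mem_sep.2 ⟨hy, hy'⟩ : y ε t (Fin.cons c' v))⟩
  refine ⟨⟨z, h.l _ hz'⟩, hz', ?_⟩
  have : (⟨z, h.l _ hz'⟩ : LL c) ε t (Fin.cons c' v) := hz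
  rw [e] at this
  exact (mem_sep.1 this).2
theorem Hl.elm (h : Hl c H) {n : ℕ} (f : Fml n) (v : Fin n → {x // H x}) :
    Eval (fun a b : {x // H x} => a.1 ε b.1) NoAux AllSets f v ↔
      Eval ZM.E NoAux AllSets f (fun i => (⟨(v i).1, h.l _ (v i).2⟩ : LL c)) := by
  have k : ∀ {n} (x : {x // H x}) (v : Fin n → {x // H x}), (fun i => (⟨((Fin.cons x v : Fin (n+1) → _) i).1, h.l _ ((Fin.cons x v : Fin (n+1) → _) i).2⟩ : LL c)) =
      (Fin.cons ⟨x.1, h.l _ x.2⟩ (fun i => ⟨(v i).1, h.l _ (v i).2⟩) : Fin (n+1) → LL c) := fun x v => by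
    funext i; refine Fin.cases ?_ (fun i => ?_) i <;> simp
  induction f with
  | mem i j => rfl
  | equ i j => exact Subtype.ext_iff.trans (Subtype.ext_iff (a1 := (⟨(v i).1, h.l _ (v i).2⟩ : LL c)) (a2 := ⟨(v j).1, h.l _ (v j).2⟩)).symm
  | aux i => rfl
  | impl f g h1 h2 => exact imp_congr (h1 _) (h2 _)
  | neg f h1 => exact not_congr (h1 _)
  | all f h1 =>
    refine ⟨fun hh x _ => ?_, fun hh x _ => (h1 _).2 ((k x v).symm ▸ hh ⟨x.1, h.l _ x.2⟩ trivial)⟩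
    by_contra hn
    obtain ⟨y, hy, hy'⟩ := h.wit f.neg _ (fun i => (v i).2) ⟨x, hn⟩
    exact hy' (k ⟨y.1, hy⟩ v ▸ (h1 _).1 (hh ⟨y.1, hy⟩ trivial))
  | ex f h1 =>
    refine ⟨fun ⟨x, _, hh⟩ => ⟨⟨x.1, h.l _ x.2⟩, trivial, k x v ▸ (h1 _).1 hh⟩, fun ⟨x, _, hh⟩ => ?_⟩
    obtain ⟨y, hy, hy'⟩ := h.wit f _ (fun i => (v i).2) ⟨x, hh⟩
    exact ⟨⟨y.1, hy⟩, trivial, (h1 _).2 ((k ⟨y.1, hy⟩ v).symm ▸ hy')⟩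
  | allb i f h1 =>
    refine ⟨fun hh x _ hi => ?_, fun hh x _ hi => (h1 _).2 ((k x v).symm ▸ hh ⟨x.1, h.l _ x.2⟩ trivial hi)⟩
    by_contra hn
    obtain ⟨y, hy, hy'⟩ := h.wit ((Fml.mem 0 i.succ).impl f).neg (fun i => (⟨(v i).1, h.l _ (v i).2⟩ : LL c))
      (fun i => (v i).2) ⟨x, by
        simp only [Eval, Fin.cons_zero, Fin.cons_succ]; exact fun h => hn (h hi)⟩
    refine hy' fun hi => k ⟨y.1, hy⟩ v ▸ (h1 _).1 (hh ⟨y.1, hy⟩ trivial ?_)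
    exact hi
theorem Eval_iso {T L : Type} {E : T → T → Prop} {F : L → L → Prop} {j : T → L} (he : ∀ x y, E x y ↔ F (j x) (j y))
    (hi : ∀ x y, j x = j y → x = y) (hs : ∀ y, ∃ x, y = j x) {n : ℕ} (f : Fml n) (v : Fin n → T) :
    Eval E NoAux AllSets f v ↔ Eval F NoAux AllSets f (fun i => j (v i)) := by
  have k : ∀ {n} (x : T) (v : Fin n → T), (fun i => j ((Fin.cons x v : Fin (n+1) → T) i)) =
      (Fin.cons (j x) (fun i => j (v i)) : Fin (n+1) → L) := fun x v => by
    funext i; refine Fin.cases ?_ (fun i => ?_) i <;> simp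
  induction f with
  | mem i j => exact he _ _
  | equ i j => exact ⟨fun h => congrArg _ h, hi _ _⟩
  | aux i => rfl
  | impl f g h1 h2 => exact imp_congr (h1 _) (h2 _)
  | neg f h1 => exact not_congr (h1 _)
  | all f h1 => exact ⟨fun h y _ => by obtain ⟨x, rfl⟩ := hs y; exact k x v ▸ (h1 _).1 (h x trivial),
      fun h x _ => (h1 _).2 ((k x v).symm ▸ h (j x) trivial)⟩
  | ex f h1 => exact ⟨fun ⟨x, _, h⟩ => ⟨j x, trivial, k x v ▸ (h1 _).1 h⟩,
      fun ⟨y, _, h⟩ => by obtain ⟨x, rfl⟩ := hs y; exact ⟨x, trivial, (h1 _).2 ((k x v).symm ▸ h)⟩⟩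
  | allb i f h1 => exact ⟨fun h y _ hy => by obtain ⟨x, rfl⟩ := hs y; exact k x v ▸ (h1 _).1 (h x trivial ((he _ _).2 hy)),
      fun h x _ hx => (h1 _).2 ((k x v).symm ▸ h (j x) trivial ((he _ _).1 hx))⟩
def col (H : M → Prop) (x : M) : M := wrec (fun _ x => sep x H) (fun _ x g => img (sep x H) (ap g)) emp x
def unc (H : M → Prop) (x : M) : M := the (fun y => H y ∧ x = col H y)
section
variable [D1 Tp H]
instance : F1 Tp (col H) := by unfold col; infer_instance
instance : F1 Tp (unc H) := by unfold unc; infer_instance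
theorem mem_col {x z : M} : z ε col H x ↔ ∃ y, y ε x ∧ H y ∧ z = col H y := by
  rw [col, erec_eq (fun x z hz => (mem_sep.1 hz).1), mem_img]
  constructor
  · rintro ⟨y, hy, rfl⟩
    refine ⟨y, (mem_sep.1 hy).1, (mem_sep.1 hy).2, ?_⟩
    exact ap_gr (F := col H) hy
  · rintro ⟨y, hy, hy', rfl⟩
    have : y ε sep x H := mem_sep.2 ⟨hy, hy'⟩
    exact ⟨y, this, (ap_gr (F := col H) this).symm⟩
end
theorem Hl.inj (h : Hl c H) {x y : M} (hx : H x) (hy : H y) (e : col H x = col H y) : x = y := by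
  have := h.d
  have q : ∀ x, H x → ∀ y, H y → col H x = col H y → x = y := by
    refine fun x => einduct (fun x => H x → ∀ y, H y → col H x = col H y → x = y) (fun x ih hx y hy e => ?_) x
    by_contra hn
    have k : ∀ u w, H u → H w → ¬ sub u w → ∃ z, z ε u ∧ H z ∧ ¬ z ε w := fun u w hu hw hn => by
      have h2 := h.c.t2 dif ⟨u, h.l _ hu⟩ ⟨w, h.l _ hw⟩ hu hw
      rw [(LL_tri c).dif] at h2
      unfold sub at hn; push Not at hn
      obtain ⟨z, hz, hz'⟩ := hn
      obtain ⟨z, hz, h'⟩ := h.meets h2 ⟨z, mem_dif.2 ⟨hz, hz'⟩⟩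
      exact ⟨z, (mem_dif.1 hz).1, h', (mem_dif.1 hz).2⟩
    by_cases h1 : sub x y
    · have h2 : ¬ sub y x := fun h2 => hn (sub_ext h1 h2)
      obtain ⟨z, hz, hz', hzn⟩ := k y x hy hx h2
      have : col H z ε col H x := by rw [e]; exact mem_col.2 ⟨z, hz, hz', rfl⟩
      obtain ⟨w, hw, hw', e'⟩ := mem_col.1 this
      exact hzn (ih w hw hw' z hz' e'.symm ▸ hw)
    · obtain ⟨z, hz, hz', hzn⟩ := k x y hx hy h1
      have : col H z ε col H y := by rw [← e]; exact mem_col.2 ⟨z, hz, hz', rfl⟩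
      obtain ⟨w, hw, hw', e'⟩ := mem_col.1 this
      exact hzn (ih z hz hz' w hw' e' ▸ hw)
  exact q x hx y hy e
theorem Hl.colm (h : Hl c H) {x y : M} (hx : H x) (hy : H y) : col H x ε col H y ↔ x ε y := by
  have := h.d
  rw [mem_col]
  exact ⟨fun ⟨z, hz, hz', e⟩ => h.inj hx hz' e ▸ hz, fun e => ⟨x, e, hx, rfl⟩⟩
theorem Hl.unc (h : Hl c H) {y : M} (hy : H y) : unc H (col H y) = y :=
  the_eq ⟨hy, rfl⟩ fun z hz => h.inj hz.1 hy hz.2.symm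
theorem Hl.fix (h : Hl c H) {u : M} (hu : Tr u) (hH : ∀ x, x ε u → H x) {x : M} (hx : x ε u) : col H x = x := by
  have := h.d
  refine einduct (fun x => x ε u → col H x = x) (fun x ih hx => eqx fun z => ?_) x hx
  rw [mem_col]
  constructor
  · rintro ⟨y, hy, -, rfl⟩; rw [ih y hy (hu _ hx _ hy)]; exact hy
  · exact fun hz => ⟨z, hz, hH _ (hu _ hx _ hz), (ih z hz (hu _ hx _ hz)).symm⟩
theorem Hl.elc (h : Hl c H) {C : M → Prop} (hC : ∀ x, C x ↔ ∃ y, H y ∧ x = col H y) {n : ℕ} (f : Fml n) (v : Fin n → {x // C x}) :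
    ∀ hm : (∀ x, C x → IL c (ZFI0.unc H x)), Eval (fun a b : {x // C x} => a.1 ε b.1) NoAux AllSets f v ↔
      Eval ZM.E NoAux AllSets f (fun i => (⟨ZFI0.unc H (v i).1, hm _ (v i).2⟩ : LL c)) := by
  intro hm
  have q : ∀ x, C x → H (ZFI0.unc H x) ∧ col H (ZFI0.unc H x) = x := fun x hx => by
    obtain ⟨y, hy, rfl⟩ := (hC _).1 hx; rw [h.unc hy]; exact ⟨hy, rfl⟩
  rw [Eval_iso (L := {x // H x}) (F := fun a b => a.1 ε b.1) (j := fun x => ⟨ZFI0.unc H x.1, (q _ x.2).1⟩), h.elm]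
  · intro x y
    show _ ↔ ZFI0.unc H x.1 ε ZFI0.unc H y.1
    rw [← h.colm (q _ x.2).1 (q _ y.2).1, (q _ x.2).2, (q _ y.2).2]
  · intro x y e
    apply Subtype.ext
    rw [← (q _ x.2).2, ← (q _ y.2).2, Subtype.mk.inj e]
  · intro y
    exact ⟨⟨col H y.1, (hC _).2 ⟨y.1, y.2, rfl⟩⟩, Subtype.ext (h.unc y.2).symm⟩
theorem Hl.col (h : Hl c H) (hu : ∀ a, On a → ∃ b, On b ∧ H b ∧ le a b) :
    (∀ x, IL c x ↔ ∃ y, H y ∧ x = col H y) ∧ Emb c c (ZFI0.unc H) := by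
  have := h.d
  have hD : D2 Tp fun t x => ∀ (b : M), On b → H b → t = ZFI0.col H b → x = b := inferInstance
  let C : M → Prop := fun x => ∃ y, H y ∧ x = ZFI0.col H y
  have hm : ∀ x, C x → IL c (ZFI0.unc H x) := by rintro _ ⟨y, hy, rfl⟩; rw [h.unc hy]; exact h.l _ hy
  have el := fun {n : ℕ} (f : Fml n) v => h.elc (C := C) (fun _ => Iff.rfl) f v hm
  letI : ZM {x // C x} := ⟨_, _, ZF_tr (L := LL c) (j := fun x => ⟨ZFI0.unc H x.1, hm _ x.2⟩) el (LL_zf c)⟩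
  have ι : Tri (fun x : {x // C x} => x.1) := ⟨fun _ _ => Iff.rfl, fun x y hy => by
    obtain ⟨w, hw, hw'⟩ := x.2
    simp only [hw'] at hy
    obtain ⟨z, -, hz, e⟩ := mem_col.1 hy
    exact ⟨⟨y, z, hz, e⟩, rfl⟩⟩
  have ho : ∀ a : M, On a → ∃ a' : {x // C x}, a = a'.1 := by
    intro α hα
    by_contra hn
    have k : ∀ b, On b → H b → ZFI0.col H b ε α := fun b hb hHb => by
      have h1 : On (ZFI0.col H b) := by
        have e : ZFI0.col H b = (⟨ZFI0.col H b, b, hHb, rfl⟩ : {x // C x}).1 := rfl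
        rw [e, ι.on]
        refine (U.tr (L := LL c) (j := fun x => ⟨ZFI0.unc H x.1, hm _ x.2⟩) el (n := 1) (R := fun M E v => IsOrd E (v 0)) inferInstance ![_]).2 ((LL_tri c).on.1 ?_)
        simp only [Matrix.cons_val_zero, h.unc hHb]; exact hb
      rcases h1.tri hα with h2 | h2 | h2
      · exact h2
      · exact (hn ⟨⟨_, b, hHb, rfl⟩, h2.symm⟩).elim
      · obtain ⟨z, e⟩ := ι.t (⟨_, b, hHb, rfl⟩ : {x // C x}) _ h2
        exact (hn ⟨z, e⟩).elim
    obtain ⟨d, hd, hd'⟩ := obd (fun t x => ∀ b, On b → H b → t = ZFI0.col H b → x = b) α (fun t ht => by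
      by_cases e : ∃ b, On b ∧ H b ∧ t = ZFI0.col H b
      · obtain ⟨b, hb, hHb, rfl⟩ := e; exact ⟨b, hb, fun b' _ h' e => h.inj hHb h' e⟩
      · exact ⟨emp, on_emp, fun b h1 h2 h3 => (e ⟨b, h1, h2, h3⟩).elim⟩)
    obtain ⟨b, hb, hHb, hle⟩ := hu d hd
    obtain ⟨x, hx, hx'⟩ := hd' _ (k b hb hHb)
    rw [hx' b hb hHb rfl] at hx
    rcases hle with h1 | rfl
    · exact nmem2 h1 hx
    · exact nmem_self hx
  have hc : H c := h.z _ (mem_L0 c)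
  have hcc : ZFI0.col H c = c := h.fix (tr_L0 c) h.z (mem_L0 c)
  let c1 : {x // C x} := ⟨c, c, hc, hcc.symm⟩
  have ec : ZFI0.unc H c = c := by rw [← hcc, h.unc hc, hcc]
  have hV : ∀ x, IL c1 x := fun x => by
    have := (U.tr (L := LL c) (j := fun x => ⟨ZFI0.unc H x.1, hm _ x.2⟩) el (n := 1) (R := fun M E v => ∀ x, InL E (v 0) x) inferInstance ![c1]).2
      (fun x => InL_iff.2 (LL_V _ ec x))
    exact InL_iff.1 (this x)
  have hC : ∀ x, IL c x ↔ ∃ y, H y ∧ x = ZFI0.col H y := fun x => by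
    constructor
    · intro hx
      obtain ⟨y, rfl, -⟩ := ι.ILr ho c1 x hx
      exact y.2
    · intro hx; exact (ι.IL ho c1 ⟨x, hx⟩).2 (hV _)
  have hm' : ∀ x, IL c x → IL c (ZFI0.unc H x) := fun x hx => hm x ((hC x).1 hx)
  exact ⟨hC, hm', fun n f v => h.elc hC f v hm'⟩
end
theorem U.rel {C : ∀ M : Type, (M → M → Prop) → M → M → Prop} [V2 C] {n : ℕ} (f : Fml n) :
    ∀ {m : ℕ} (p : Fin m) (r : Fin n → Fin m),
    U (fun M E v => Eval E NoAux (C M E (v p)) f (fun i => v (r i))) := by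
  have q : ∀ {n m : ℕ} {f : Fml (n+1)} {p : Fin m} {r : Fin n → Fin m},
      U (fun M E (v : Fin (m+1) → M) => Eval E NoAux (C M E (v p.succ)) f (fun i => v (upr r i))) →
      U (fun M E (v : Fin (m+1) → M) => Eval E NoAux (C M E (v p.succ)) f (Fin.cons (v 0) (fun i => v (r i).succ))) :=
    fun {n m f p r} h => h.congr fun M E v => by
      refine iff_of_eq (congrArg _ ?_)
      funext i; refine Fin.cases ?_ (fun i => ?_) i <;> simp [upr]
  induction f with
  | mem i j => intro m p r; simp only [Eval]; infer_instance
  | equ i j => intro m p r; simp only [Eval]; infer_instance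
  | aux i => intro m p r; exact (U.not (A := fun M E v => v p = v p)).congr fun M E v => by simp [Eval, NoAux]
  | impl f g h1 h2 => intro m p r; have := h1 p r; have := h2 p r; simp only [Eval] at *; infer_instance
  | neg f h1 => intro m p r; have := h1 p r; simp only [Eval] at *; infer_instance
  | all f h1 => intro m p r; have := q (h1 p.succ (upr r)); simp only [Eval] at *; infer_instance
  | ex f h1 => intro m p r; have := q (h1 p.succ (upr r)); simp only [Eval] at *; infer_instance
  | allb i f h1 => intro m p r; have := q (h1 p.succ (upr r)); simp only [Eval] at *; infer_instance
noncomputable section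
variable [ZM M] {S : M → Prop} {b b1 c c1 x y a f g : M} {j : M → M}
theorem Emb.mem (h : Emb b b1 j) (hx : IL b x) (hy : IL b y) : j x ε j y ↔ x ε y := h.el.mem (x := ⟨x, hx⟩) (y := ⟨y, hy⟩)
theorem Emb.inj (h : Emb b b1 j) (hx : IL b x) (hy : IL b y) : j x = j y ↔ x = y :=
  ⟨fun e => congrArg Subtype.val (h.el.inj.1 (Subtype.ext e) : (⟨x, hx⟩ : LL b) = ⟨y, hy⟩), fun e => e ▸ rfl⟩
theorem Emb.r3 (h : Emb b b1 j) {R : ∀ M : Type, (M → M → Prop) → M → M → M → Prop} (a : V3 R) (z x y : LL b) :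
    R (LL b) ZM.E z x y ↔ R (LL b1) ZM.E (h.t z) (h.t x) (h.t y) := h.tr a.h ![z, x, y]
theorem LL_IL {b' x : LL b} : IL b'.1 x.1 ↔ IL b' x := (LL_tri b).IL (fun a ha => LL_on b ha) b' x
theorem Emb.gop (h : Emb b b1 j) (i : Fin 10) (hx : IL b x) (hy : IL b y) : j (gop i x y) = gop i (j x) (j y) := by
  have := (h.r3 (GR.u i) (ZFI0.gop i ⟨x, hx⟩ ⟨y, hy⟩) ⟨x, hx⟩ ⟨y, hy⟩).1 ((gop_iff i _ _ _).2 rfl)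
  rw [gop_iff] at this
  have := congrArg Subtype.val this
  rw [(LL_tri b1).gop] at this
  rw [← (LL_tri b).gop i ⟨x, hx⟩ ⟨y, hy⟩]; exact this
theorem IL.kp (hx : IL b x) (hy : IL b y) : IL b (kp x y) := (hx.gop 0 hx).gop 0 (hx.gop 0 hy)
theorem Emb.kp (h : Emb b b1 j) (hx : IL b x) (hy : IL b y) : j (kp x y) = kp (j x) (j y) := by
  have := h.gop 0 (hx.gop 0 hx) (hx.gop 0 hy)
  rw [h.gop 0 hx hx, h.gop 0 hx hy] at this; exact this
theorem IL.ap (hx : IL b x) (hy : IL b y) : IL b (ap x y) := by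
  have := (LL_tri b).ap ⟨x, hx⟩ ⟨y, hy⟩; rw [← this]; exact (ZFI0.ap (⟨x, hx⟩ : LL b) ⟨y, hy⟩).2
theorem Emb.ap (h : Emb b b1 j) (hx : IL b x) (hy : IL b y) : j (ap x y) = ap (j x) (j y) := by
  have := (h.r3 (R := IsAp) inferInstance ⟨x, hx⟩ ⟨y, hy⟩ (ZFI0.ap ⟨x, hx⟩ ⟨y, hy⟩)).1 (ap_iff.2 rfl)
  rw [ap_iff] at this
  have := congrArg Subtype.val this
  rw [(LL_tri b1).ap] at this
  rw [← (LL_tri b).ap ⟨x, hx⟩ ⟨y, hy⟩]; exact this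
theorem Emb.on (h : Emb b b1 j) (ha : On a) : On (j a) := by
  have := h.tr (n := 1) (R := fun M E v => IsOrd E (v 0)) inferInstance ![⟨a, IL.on ha⟩]
  exact (LL_tri b1).on.2 (on_iff.1 (this.1 (on_iff.2 ((LL_tri b).on.1 ha))))
theorem Emb.il (h : Emb b b1 j) (hx : IL b x) (hy : IL b y) : IL (j x) (j y) ↔ IL x y := by
  have := h.tr (n := 2) (R := fun M E v => InL E (v 0) (v 1)) inferInstance ![⟨x, hx⟩, ⟨y, hy⟩]
  rw [InL_iff, InL_iff] at this
  exact (LL_IL (b' := h.t ⟨x, hx⟩) (x := h.t ⟨y, hy⟩)).trans (this.symm.trans (LL_IL (b' := ⟨x, hx⟩) (x := ⟨y, hy⟩)).symm)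
theorem Emb.lf (h : Emb b b1 j) (hx : ZFI0.IL b x) (ha : On a) : j (Lf x a) = Lf (j x) (j a) := by
  let a' : LL b := ⟨a, IL.on ha⟩
  have ha' : On a' := (LL_tri b).on.1 ha
  have := (h.r3 (R := @IsLStage) inferInstance ⟨x, hx⟩ a' (ZFI0.Lf ⟨x, hx⟩ a')).1 (LS_iff.2 ⟨ha', rfl⟩)
  rw [LS_iff] at this
  have := congrArg Subtype.val this.2
  rw [(LL_tri b1).Lf _ ((LL_tri b1).on.1 (h.on ha))] at this
  rw [← (LL_tri b).Lf ⟨x, hx⟩ ha']; exact this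
theorem IL.up (hb : IL c b) (hx : IL b x) : IL c x := by
  obtain ⟨a, ha, hx⟩ := hx
  have : IL c (ZFI0.Lf b a) := by
    have := (LL_tri c).Lf ⟨b, hb⟩ (a := ⟨a, IL.on ha⟩) ((LL_tri c).on.1 ha)
    rw [← this]; exact (ZFI0.Lf (⟨b, hb⟩ : LL c) _).2
  exact this.tr hx
theorem Emb.res (h : Emb c c1 j) (hb : IL c b) : Emb b (j b) j := by
  refine ⟨fun x hx => (h.il hb (hb.up hx)).2 hx, fun n f v => ?_⟩
  have k : ∀ {c b : M} (hb : IL c b) (v : Fin n → LL b), Eval ZM.E NoAux AllSets f v ↔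
      Eval ZM.E NoAux (InL ZM.E (⟨b, hb⟩ : LL c)) f (fun i => ⟨(v i).1, hb.up (v i).2⟩) := by
    intro c b hb v
    have e : InL ZM.E (⟨b, hb⟩ : LL c) = IL (⟨b, hb⟩ : LL c) := by funext x; exact propext InL_iff
    rw [e]
    have q : ∀ x : LL b, IL (⟨b, hb⟩ : LL c) ⟨x.1, hb.up x.2⟩ := fun x => (LL_IL (b' := ⟨b, hb⟩) (x := ⟨x.1, _⟩)).1 x.2
    have e2 := ev_sub f (C := IL (⟨b, hb⟩ : LL c)) fun i => ⟨⟨(v i).1, hb.up (v i).2⟩, q (v i)⟩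
    have e3 := Eval_iso (E := fun x y : LL b => x.1 ε y.1) (F := fun x y : {x : LL c // IL (⟨b, hb⟩ : LL c) x} => x.1 ε y.1) (j := fun x : LL b => (⟨⟨x.1, hb.up x.2⟩, q x⟩ : {x : LL c // IL (⟨b, hb⟩ : LL c) x}))
      (fun _ _ => Iff.rfl) (fun x y e => Subtype.ext (congrArg (fun z => z.1.1) e)) (fun y => ⟨⟨y.1.1, (LL_IL (b' := ⟨b, hb⟩) (x := y.1)).2 y.2⟩, rfl⟩) f v
    exact e3.trans e2
  have := h.tr (U.rel (C := @InL) f (m := n+1) 0 Fin.succ) (Fin.cons ⟨b, hb⟩ fun i => ⟨(v i).1, hb.up (v i).2⟩)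
  simp only [Fin.cons_zero, Fin.cons_succ] at this
  exact (k hb v).trans (this.trans (k (h.mp _ hb) fun i => ⟨j (v i).1, (h.il hb (hb.up (v i).2)).2 (v i).2⟩).symm)
theorem Emb.ge [F1 Tp j] (h : Emb b b1 j) (ha : On a) : le a (j a) := by
  refine oind (fun a => le a (j a)) (fun a ha ih => ?_) ha
  by_contra hn
  have h1 : j a ε a := by
    rcases (h.on ha).tri ha with q | q | q
    · exact q
    · exact (hn (.inr q.symm)).elim
    · exact (hn (.inl q)).elim
  have h2 := (h.mem (IL.on (ha.mem h1)) (IL.on ha)).2 h1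
  rcases ih _ h1 with q | q
  · exact nmem2 q h2
  · rw [← q] at h2; exact nmem_self h2
theorem Emb.cmpo {k : M → M} (h : Emb b b1 j) (h' : Emb b1 c k) : Emb b c (fun x => k (j x)) :=
  ⟨fun x hx => h'.mp _ (h.mp x hx), fun n f v => (h.el f v).trans (h'.el f _)⟩
theorem Emb.fac {i k : M → M} (h : Emb b b1 j) (h' : Emb c b1 k) (hi : ∀ x, IL b x → IL c (i x) ∧ k (i x) = j x) :
    Emb b c i :=
  ⟨fun x hx => (hi x hx).1, fun n f v => (h.el f v).trans (by
    refine Iff.trans (iff_of_eq (congrArg _ ?_)) (h'.el f _).symm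
    funext l; exact Subtype.ext (hi _ (v l).2).2.symm)⟩
theorem emb_cn (h : Emb b b1 j) {s D : M} (hs : IL b s) (hD : sub D (j s)) (ha : a ε D) (hx : IL b x) : hul b j D (j x) := by
  have hc : IL b (cp s (sg x)) := hs.gop 1 (hx.gop 0 hx)
  refine ⟨_, a, hc, ha, ?_⟩
  have e : j (cp s (sg x)) = cp (j s) (sg (j x)) := (h.gop 1 hs (hx.gop 0 hx)).trans (by rw [h.gop 0 hx hx]; rfl)
  rw [e]
  exact (ap_eq (mem_cp.2 ⟨_, _, hD _ ha, mem_sg.2 rfl, rfl⟩) fun z hz => by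
    obtain ⟨_, _, _, h2, e⟩ := mem_cp.1 hz
    rw [kp_eq] at e; rw [e.2]; exact mem_sg.1 h2).symm
instance hul.d [F1 Tp j] {D : M} : D1 Tp (hul b j D) := by
  unfold hul; infer_instance
theorem emb_fact [F1 Tp j] (h : Emb b b1 j) {s D : M} (hs : IL b s) (hD : sub D (j s)) (hS : Seed b j D)
    (hz : ∀ x, x ε L0 b1 → hul b j D x) : Hl b1 (hul b j D) ∧ Emb b1 b1 (unc (hul b j D)) ∧
      Emb b b1 (fun x => col (hul b j D) (j x)) ∧ (∀ x, IL b1 x ↔ ∃ y, hul b j D y ∧ x = col (hul b j D) y) ∧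
      ∀ x, IL b x → unc (hul b j D) (col (hul b j D) (j x)) = j x := by
  have d : D1 Tp (hul b j D) := inferInstance
  have hH : Hl b1 (hul b j D) := ⟨d, by
    rintro _ ⟨f, a, hf, ha, rfl⟩; exact (h.mp _ hf).ap ((h.mp _ hs).tr (hD _ ha)), hz, h.hul hs hD hS⟩
  obtain ⟨w, hw⟩ := hS.1
  have hc : ∀ x, IL b x → hul b j D (j x) := fun x hx => emb_cn h hs hD hw hx
  obtain ⟨h1, h2⟩ := hH.col fun a ha => ⟨j a, h.on ha, hc _ (IL.on ha), h.ge ha⟩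
  have h3 : ∀ x, IL b x → unc (hul b j D) (col (hul b j D) (j x)) = j x := fun x hx => hH.unc (hc x hx)
  exact ⟨hH, h2, h.fac h2 fun x hx => ⟨(h1 _).2 ⟨_, hc x hx, rfl⟩, h3 x hx⟩, h1, h3⟩
end
noncomputable section
section
variable {T : Type} [ZM T] {F : T → T} {b : T}
structure Nice (F : T → T) : Prop where
  e : ∀ x y, F x ε F y ↔ x ε y
  g : ∀ i x y, F (gop i x y) = gop i (F x) (F y)
  c : ∀ y, ∃ x, y ε F x
theorem Nice.mp (h : Nice F) : F emp = emp := by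
  have := h.g 3 emp emp
  change F (dif emp emp) = dif (F emp) (F emp) at this
  rwa [dif_self', dif_self'] at this
theorem Nice.sb (h : Nice F) {x y : T} (hs : sub x y) : sub (F x) (F y) := by
  have e : dif x y = emp := eqx fun z => by rw [mem_dif]; simpa using hs z
  have := h.g 3 x y
  change F (dif x y) = dif (F x) (F y) at this
  rw [e, h.mp] at this
  intro z hz; by_contra hn
  exact mem_emp.1 (this ▸ mem_dif.2 ⟨hz, hn⟩)
theorem Nice.tr (h : Nice F) {x : T} (hx : Tr x) : Tr (F x) := by
  have := h.sb (x := un x) (y := x) (fun z hz => by obtain ⟨y, hy, hz⟩ := mem_un.1 hz; first | exact hx _ hy _ hz | exact hx _ hz _ hy)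
  rw [show F (un x) = un (F x) from h.g 5 x x] at this
  intro y hy z hz; exact this _ (mem_un.2 (by first | exact ⟨y, hy, hz⟩ | exact ⟨y, hz, hy⟩))
theorem Nice.tp (h : Nice F) {n : ℕ} (v : Fin n → T) : F (tup emp v) = tup emp (fun i => F (v i)) := by
  induction n with
  | zero => exact h.mp
  | succ n ih =>
    have k : ∀ x y, F (kp x y) = kp (F x) (F y) := fun x y => by
      have := h.g 0 (gop 0 x x) (gop 0 x y); rw [h.g 0 x x, h.g 0 x y] at this; exact this
    simp only [tup, k, ih]
theorem Nice.elm (h : Nice F) (hV : ∀ x : T, IL b x) : Elm F := by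
  have hC : IL b = AllSets := by funext x; simp [AllSets, hV]
  let P {n : ℕ} (f : Fml n) := ∀ a, On a → ∀ X, Rp (Lf b a) X (Ev (IL b) f) → Rp (F (Lf b a)) (F X) (Ev (IL b) f)
  have hrp : ∀ {n : ℕ} {u X Y : T} {Q : (Fin n → T) → Prop}, Rp u X Q → Rp u Y Q → X = Y :=
    fun h h' => eqx fun z => (h z).trans (h' z).symm
  have hU : ∀ n u, F ((gU n).ev u) = (gU n).ev (F u) := fun n u => GT.hom h.g (gU n) u
  have km : ∀ {n} (i j : Fin n), P (.mem i j) := fun i j a ha X hX => by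
    rw [hrp hX (Sg_rp (tr_Lf ha) (.mem i j)), GT.hom h.g]; exact Sg_rp (h.tr (tr_Lf ha)) (.mem i j)
  have kn : ∀ {n} {f : Fml n}, P f → P f.neg := fun {n f} hf a ha X hX => by
    obtain ⟨Y, -, hY⟩ := SF (b := b) f a ha
    have e := hrp hX (((gU_rp _ n).dif hY).congr fun w hw => by simp [Ev, Eval])
    rw [e, show F (dif _ _) = dif _ _ from h.g 3 _ _, hU]
    exact ((gU_rp _ _).dif (hf a ha Y hY)).congr fun w hw => by simp [Ev, Eval]
  have ki : ∀ {n} {f g : Fml n}, P f → P g → P (f.impl g) := fun {n f g} hf hg a ha X hX => by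
    obtain ⟨Y, -, hY⟩ := SF (b := b) f a ha
    obtain ⟨Z, -, hZ⟩ := SF (b := b) g a ha
    have e := hrp hX (((gU_rp _ n).dif (hY.dif hZ)).congr fun w hw => by simp [Ev, Eval])
    rw [e, show F (dif _ _) = dif _ _ from h.g 3 _ _, show F (dif _ _) = dif _ _ from h.g 3 _ _, hU]
    exact ((gU_rp _ _).dif ((hf a ha Y hY).dif (hg a ha Z hZ))).congr fun w hw => by simp [Ev, Eval]
  have ke : ∀ {n} {f : Fml (n+1)}, P f → P f.ex := fun {n f} hf a ha X hX => by
    obtain ⟨c, hc, hac, hb⟩ := IL.bnd (b := b) f ha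
    have k : ∀ d, On d → le c d → ∀ w : Fin n → T, (∀ i, w i ε F (Lf b a)) →
        (tup emp w ε F X ↔ ∃ y, y ε F (Lf b d) ∧ Ev (IL b) f (Fin.cons y w)) := fun d hd hcd w hw => by
      obtain ⟨Y, -, hY⟩ := SF (b := b) f d hd
      have hs := Lf_le (b := b) hc hd hcd
      have hs' := Lf_le (b := b) ha hc hac
      have e : X = gop 4 ((gU n).ev (Lf b a)) (gop 6 (gop 7 Y Y) Y) := by
        change _ = int _ (dmn (cnv Y))
        refine hrp hX fun z => ?_
        rw [mem_int, gU_rp, hY.ran]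
        constructor
        · rintro ⟨⟨w, hw, rfl, -⟩, w', hw', e, y, hy, h⟩
          rw [← tup_inj e] at h
          exact ⟨w, hw, rfl, y, hV _, h⟩
        · rintro ⟨w, hw, rfl, h⟩
          obtain ⟨y, hy, h⟩ := hb w hw h
          exact ⟨⟨w, hw, rfl, trivial⟩, w, fun i => hs _ (hs' _ (hw i)), rfl, y, hs _ hy, h⟩
      rw [e, h.g, h.g, h.g, hU]
      change _ ε int _ (dmn (cnv (F Y))) ↔ _
      rw [mem_int, (gU_rp _ _).iff hw, (hf d hd Y hY).ran.iff (fun i => h.sb hs _ (h.sb hs' _ (hw i)))]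
      simp
    intro z
    constructor
    · intro hz
      have : sub X ((gU n).ev (Lf b a)) := fun z hz => by
        obtain ⟨w, hw, rfl, -⟩ := (hX z).1 hz; exact (gU_rp _ _ _).2 ⟨w, hw, rfl, trivial⟩
      have := h.sb this z hz
      rw [hU] at this
      obtain ⟨w, hw, rfl, -⟩ := (gU_rp _ _ _).1 this
      obtain ⟨y, hy, hh⟩ := (k c hc (.inr rfl) w hw).1 hz
      exact ⟨w, hw, rfl, y, hV y, hh⟩
    · rintro ⟨w, hw, rfl, y, -, hy⟩
      obtain ⟨x, hx⟩ := h.c y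
      obtain ⟨d, hd, hxd⟩ := hV x
      have hm := on_max hc hd
      refine (k _ hm (le_max hc hd).1 w hw).2 ⟨y, h.sb (Lf_le hd hm (le_max hc hd).2) _ ?_, hy⟩
      exact h.tr (tr_Lf hd) _ ((h.e _ _).2 hxd) _ hx
  have kc : ∀ {n} {f g : Fml n}, (∀ v, Ev (IL b) f v ↔ Ev (IL b) g v) → P g → P f := fun e hg a ha X hX => by
    exact (hg a ha X (hX.congr fun w hw => (e w).symm)).congr fun w hw => e w
  have ka : ∀ {n} {f : Fml (n+1)}, P f → P f.all := fun hf => kc (g := .neg (.ex (.neg _))) (fun v => by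
    simp [Ev, Eval]) (kn (ke (kn hf)))
  have al : ∀ {n} (f : Fml n), P f := by
    intro n f
    induction f with
    | mem i j => exact km i j
    | @equ n i j => intro a ha X hX
                    rw [hrp hX (Sg_rp (tr_Lf ha) (.equ i j)), GT.hom h.g]; exact Sg_rp (h.tr (tr_Lf ha)) (.equ i j)
    | @aux n i => exact kc (g := .neg (.impl (.mem i i) (.mem i i))) (fun v => by simp [Ev, Eval, NoAux]) (kn (ki (km _ _) (km _ _)))
    | impl f g h1 h2 => exact ki h1 h2
    | neg f h1 => exact kn h1
    | all f h1 => exact ka h1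
    | ex f h1 => exact ke h1
    | allb i f h1 => exact kc (g := .all (.impl (.mem 0 i.succ) f)) (fun v => by simp [Ev, Eval]) (ka (ki (km _ _) h1))
  intro n f v
  rw [← hC]
  obtain ⟨a, ha, -, hv⟩ := IL.fin (b := b) (fun i => hV (v i)) on_emp
  obtain ⟨X, -, hX⟩ := SF (b := b) f a ha
  exact (hX.iff hv).symm.trans (((h.e _ _).symm.trans (by rw [h.tp])).trans ((al f a ha X hX).iff (fun i => (h.e _ _).2 (hv i))))
def NR (G : T → T → Prop) : Prop := ((∀ x, ∃ y, G x y) ∧ (∀ x y y', G x y → G x y' → y = y') ∧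
  (∀ x y x' y', G x x' → G y y' → (x' ε y' ↔ x ε y)) ∧ ∀ y, ∃ x x', G x x' ∧ y ε x') ∧
  ∀ i, ∀ x y x' y', G x x' → G y y' → G (gop i x y) (gop i x' y')
end
variable [ZM M] {c : M}
theorem suz {R : LL c → LL c → Prop} (hR : D2 Tp R) {F : LL c → LL c} (hF : ∀ x y, R x y ↔ y = F x) (hN : Nice F)
    {a : LL c} (ha : On a) : F a = a := by
  obtain ⟨k, f, p, -, hp⟩ := hR.h.h
  let G (t x y : LL c) : Prop := Eval ZM.E NoAux AllSets f (Fin.append ![x, y] fun i : Fin k => prj i t)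
  have dG : D3 Bt G := ⟨((Df.un (U.ev f)).sbs (t := fun i (w : Fin 3 → LL c) => Fin.append ![w 1, w 2] (fun i : Fin k => prj i (w 0)) i)
    (fun i => by
      refine Fin.addCases (fun i => ?_) (fun i => ?_) i
      · simp only [Fin.append_left]
        refine Fin.cases ?_ (fun i => ?_) i
        · exact DfF.var 1
        · refine Fin.cases ?_ (fun i => i.elim0) i; exact DfF.var 2
      · simp only [Fin.append_right]; infer_instance))⟩
  let N1 (t : LL c) := NR (G t)
  have d1 : D1 Bt N1 := by
    have : Df Bt (fun v : Fin 1 → LL c => ∀ i, ∀ x y x' y', G (v 0) x x' → G (v 0) y y' → G (v 0) (gop i x y) (gop i x' y')) :=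
      Df.fin fun i => inferInstance
    refine ⟨?_⟩
    unfold N1 NR; infer_instance
  have key : ∀ (t : LL c), NR (G t) → (∃ F : LL c → LL c, (∀ x y, G t x y ↔ y = F x) ∧ Elm F) := fun t ht => by
    obtain ⟨⟨h1, h2, h3, h4⟩, h5⟩ := ht
    choose F hF using h1
    have e : ∀ x y, G t x y ↔ y = F x := fun x y => ⟨fun h => h2 _ _ _ h (hF x), fun h => h ▸ hF x⟩
    have : Nice F := ⟨fun x y => h3 _ _ _ _ (hF x) (hF y), fun i x y => ((e _ _).1 (h5 i _ _ _ _ (hF x) (hF y))).symm,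
      fun y => by obtain ⟨x, x', h, h'⟩ := h4 y; exact ⟨x, (e _ _).1 h ▸ h'⟩⟩
    exact ⟨F, e, this.elm (b := ⟨c, IL.bs⟩) (LL_V _ rfl)⟩
  by_contra hn
  let Q (a : LL c) := ∃ t, N1 t ∧ ∃ y, G t a y ∧ ¬ y = a
  have dQ : D1 Bt Q := by unfold Q; infer_instance
  have : D1 Tp Q := ⟨dQ.h.mono (fun _ h => h.elim)⟩
  have hG : ∀ x y, G (tup emp p) x y ↔ y = F x := fun x y => by
    rw [← hF]; refine Iff.trans ?_ (hp ![x, y]).symm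
    simp only [G, prj_tup]; rfl
  obtain ⟨h1, ⟨t, ht, y, hy, hya⟩, h3⟩ := lo_spec Q ⟨a, ha, tup emp p, by
    refine ⟨⟨fun x => ⟨_, (hG _ _).2 rfl⟩, fun x y y' h h' => ?_, fun x y x' y' h h' => ?_, fun y => ?_⟩, fun i x y x' y' h h' => ?_⟩
    · rw [hG] at h h'; rw [h, h']
    · rw [hG] at h h'; rw [h, h', hN.e]
    · obtain ⟨x, hx⟩ := hN.c y; exact ⟨x, _, (hG _ _).2 rfl, hx⟩
    · rw [hG] at *; rw [h, h', hN.g], F a, (hG _ _).2 rfl, hn⟩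
  obtain ⟨F', e, hE⟩ := key t ht
  have dl : DfF Bt (fun v : Fin 0 → LL c => lo Q) := inferInstance
  obtain ⟨k', f', p', hp', e'⟩ := (dl.gph (0 : Fin 1) Fin.elim0).h
  cases k' with
  | succ k' => exact hp' 0
  | zero =>
    have q : ∀ z, Eval ZM.E NoAux AllSets f' (Fin.append ![z] p') ↔ z = lo Q := fun z => by
      refine Iff.trans (e' ![z]).symm ?_; simp
    have := (hE f' (Fin.append ![lo Q] p')).1 ((q _).2 rfl)
    have h6 : (fun i => F' ((Fin.append ![lo Q] p' : Fin (1+0) → LL c) i)) = Fin.append ![F' (lo Q)] p' := by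
      funext i; refine Fin.addCases (fun i => ?_) (fun i => i.elim0) i
      rw [Fin.append_left, Fin.append_left]; refine Fin.cases rfl (fun i => i.elim0) i
    erw [h6, q] at this
    exact hya (((e _ _).1 hy).trans this)
end
noncomputable section
section
variable [ZM M] {S : M → Prop}
def pnt (p q q' : M) : Prop := ∀ i, ¬ p = kp (gop i (fst q) (fst q')) (gop i (snd q) (snd q'))
instance : D3 S pnt := ⟨Df.fin fun i => inferInstance⟩
def SN (r p : M) : Prop := ∃ q q', q ε r ∧ q' ε r ∧ (∃ x y, q = kp x y) ∧ (∃ x y, q' = kp x y) ∧ ¬ pnt p q q'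
instance : D2 S SN := by unfold SN; infer_instance
def stp (r : M) : M := sep (cp (gcl (un (un r))) (gcl (un (un r)))) (fun p => SN r p)
instance : F1 S stp := by unfold stp; infer_instance
theorem mem_stp {r p : M} : p ε stp r ↔ ∃ x y x' y', kp x y ε r ∧ kp x' y' ε r ∧ ∃ i, p = kp (gop i x x') (gop i y y') := by
  rw [stp, mem_sep]
  constructor
  · rintro ⟨-, _, _, h, h', ⟨x, y, rfl⟩, ⟨x', y', rfl⟩, hp⟩
    simp only [pnt, fst_kp, snd_kp] at hp; push Not at hp
    exact ⟨x, y, x', y', h, h', hp⟩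
  · rintro ⟨x, y, x', y', h, h', i, rfl⟩
    have k : ∀ {x y}, kp x y ε r → x ε gcl (un (un r)) ∧ y ε gcl (un (un r)) := fun {x y} h => by
      have : pr x y ε un r := mem_un.2 ⟨_, h, by simp [kp]⟩
      exact ⟨sub_gcl _ _ (mem_un.2 ⟨_, this, by simp⟩), sub_gcl _ _ (mem_un.2 ⟨_, this, by simp⟩)⟩
    refine ⟨mem_cp.2 ⟨_, _, gcd_gcl _ i _ _ (k h).1 (k h').1, gcd_gcl _ i _ _ (k h).2 (k h').2, rfl⟩,
      _, _, h, h', ⟨_, _, rfl⟩, ⟨_, _, rfl⟩, ?_⟩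
    simp only [pnt, fst_kp, snd_kp]; push Not; exact ⟨i, rfl⟩
theorem LL_stp (c : M) (r : LL c) : (stp r).1 = stp r.1 := by
  have h := LL_tri c
  have k : ∀ {x y : M}, kp x y ε r.1 → ∃ x' y' : LL c, x = x'.1 ∧ y = y'.1 ∧ kp x' y' ε r := fun {x y} hx => by
    have := r.2.tr hx
    have h1 : IL c (pr x y) := this.tr (by simp [kp])
    refine ⟨⟨x, h1.tr (by simp)⟩, ⟨y, h1.tr (by simp)⟩, rfl, rfl, (h.e _ _).1 ?_⟩
    simp only [h.kp]; exact hx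
  refine h.eq (fun z => ?_) (fun w hw => ?_)
  · rw [mem_stp, mem_stp]
    constructor
    · rintro ⟨_, _, _, _, h1, h2, i, e⟩
      obtain ⟨x, y, rfl, rfl, h3⟩ := k h1
      obtain ⟨x', y', rfl, rfl, h4⟩ := k h2
      refine ⟨x, y, x', y', h3, h4, i, Subtype.ext ?_⟩
      rw [e, h.kp, h.gop, h.gop]
    · rintro ⟨x, y, x', y', h1, h2, i, rfl⟩
      have h1 := (h.e _ _).2 h1; have h2 := (h.e _ _).2 h2
      simp only [h.kp, h.gop] at *
      exact ⟨_, _, _, _, h1, h2, i, rfl⟩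
  · obtain ⟨_, _, _, _, h1, h2, i, rfl⟩ := mem_stp.1 hw
    obtain ⟨x, y, rfl, rfl, h1⟩ := k h1
    obtain ⟨x', y', rfl, rfl, h2⟩ := k h2
    exact ⟨kp (gop i x x') (gop i y y'), by simp only [h.kp, h.gop]⟩
end
variable [ZM M] {c : M} {j : M → M}
theorem sz9 [F1 Tp j] (h : Emb c c j) (hc : IL (j c) c) {A B : LL c → LL c} [F1 Tp A] [F1 Tp B]
    (hA : ∀ x : LL c, x.1 ε L0 c → (A x).1 = j x.1) (hB : ∀ x : LL c, On x → (B x).1 = j x.1) {a : M} (ha : On a) :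
    j a = a := by
  have T := LL_tri c
  let c' : LL c := ⟨c, IL.bs⟩
  let d' : LL c := ⟨j c, h.mp _ IL.bs⟩
  let bs (g : LL c) : LL c := bu (gr (L0 c') A) (img g (fun a => kp (Lf c' a) (Lf d' (B a))))
  let R (x y : LL c) : Prop := ∃ g, On g ∧ kp x y ε hr stp (bs g) om
  have hbs : F1 Tp bs := by unfold bs; infer_instance
  have dR : D2 Tp R := by unfold R; infer_instance
  have hr1 : ∀ g : LL c, (hr stp (bs g) om).1 = hr stp (bs g).1 om := fun g => by
    have := T.hr (F := stp) (F' := stp) (LL_stp c) (x := bs g) (a := om) omn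
    rw [this, T.om]
  have e1 : ∀ x : LL c, x.1 ε L0 c ↔ x ε L0 c' := fun x => by
    rw [← T.e, T.L0]
  have hmb : ∀ g : LL c, On g → ∀ z, z ε bs g ↔ (∃ x : LL c, x ε L0 c' ∧ z = kp x (h.t x)) ∨
      ∃ a : LL c, a ε g ∧ z = kp (Lf c' a) (h.t (Lf c' a)) := fun g hg z => by
    unfold bs
    rw [mem_bu, mem_gr, mem_img]
    refine or_congr (exists_congr fun x => and_congr_right fun hx => ?_) (exists_congr fun a => and_congr_right fun ha => ?_)
    · rw [show A x = h.t x from Subtype.ext (hA x ((e1 x).2 hx))]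
    · have ha := hg.mem ha
      have : Lf d' (B a) = h.t (Lf c' a) := Subtype.ext (by
        have e := hB a ha
        have : On (B a) := T.on.1 (by show On (B a).1; rw [e]; exact h.on (T.on.2 ha))
        rw [T.Lf _ this, e]
        show _ = j _
        rw [T.Lf _ ha, h.lf IL.bs (T.on.2 ha)])
      rw [this]
  have snd : ∀ x y, R x y → y = h.t x := by
    rintro x y ⟨g, hg, hq⟩
    have : ∀ p, p ε hr stp (bs g).1 om → (∃ x, IL c x ∧ p = kp x (j x)) := by
      refine hr_cl (fun p => ∃ x, IL c x ∧ p = kp x (j x)) (fun p hp => ?_) (fun m hm ih z hz => ?_) omn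
      · obtain ⟨p, rfl⟩ := T.t _ _ hp
        rcases (hmb g hg p).1 hp with ⟨x, hx, rfl⟩ | ⟨x, hx, rfl⟩ <;> exact ⟨_, Subtype.property _, T.kp _ _⟩
      · obtain ⟨x, y, x', y', h1, h2, i, rfl⟩ := mem_stp.1 hz
        obtain ⟨u, hu, e⟩ := ih _ h1; rw [kp_eq] at e; obtain ⟨rfl, rfl⟩ := e
        obtain ⟨u, hu', e⟩ := ih _ h2; rw [kp_eq] at e; obtain ⟨rfl, rfl⟩ := e
        exact ⟨_, hu.gop i hu', by rw [h.gop i hu hu']⟩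
    obtain ⟨u, hu, e⟩ := this (kp x y).1 (by rw [← hr1]; exact hq)
    rw [T.kp, kp_eq] at e
    exact Subtype.ext (by rw [e.2, ← e.1]; rfl)
  have tot : ∀ x, ∃ y, R x y := fun x => by
    obtain ⟨g, hg, hx⟩ := LL_V c' rfl x
    have dD : D1 Tp (fun x => ∃ y, kp x y ε hr stp (bs g) om) := inferInstance
    have cl : ∀ i x y x' y', kp x y ε hr stp (bs g) om → kp x' y' ε hr stp (bs g) om →
        kp (gop i x x') (gop i y y') ε hr stp (bs g) om := fun i x y x' y' h1 h2 => by
      obtain ⟨m, hm, h1, h2⟩ := hr_lim2 om_spec.1 h1 h2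
      refine (hr_lim om_spec.1).2 ⟨sc m, sc_om hm, ?_⟩
      rw [hr_sc (omn.mem hm), mem_bu]; exact .inr (mem_stp.2 ⟨x, y, x', y', h1, h2, i, rfl⟩)
    have bse : ∀ z, z ε bs g → z ε hr stp (bs g) om := hr_base omn
    have : ∀ m, On m → (le m g) → ∀ x, x ε Lf c' m → ∃ y, kp x y ε hr stp (bs g) om := by
      intro m hm
      refine oind (fun m => le m g → ∀ x, x ε Lf c' m → ∃ y, kp x y ε hr stp (bs g) om) (fun m hm ih hle x hx => ?_) hm
      rcases (mem_hr hm).1 hx with hx | ⟨k, hk, hx⟩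
      · exact ⟨_, bse _ ((hmb g hg _).2 (.inl ⟨x, hx, rfl⟩))⟩
      · have hkg := lt_of_lt_of_le' hg hk hle
        have i1 := ih k hk (.inl hkg)
        have := (mem_dfs.1 hx).2
        obtain ⟨Z, hZ⟩ : ∃ Z : LL c, ∀ z, z ε Z ↔ z ε gcl (sc (Lf c' k)) ∧ ∃ y, kp z y ε hr stp (bs g) om := sepx _ _
        refine ((hZ _).1 (gcl_least (c := Z) ?_ ?_ _ this)).2
        · intro z hz
          refine (hZ z).2 ⟨sub_gcl _ _ hz, ?_⟩
          rcases mem_sc.1 hz with hz | rfl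
          · exact i1 z hz
          · exact ⟨_, bse _ ((hmb g hg _).2 (.inr ⟨k, hkg, rfl⟩))⟩
        · intro i u v hu hv
          obtain ⟨h1, y, h2⟩ := (hZ _).1 hu
          obtain ⟨h3, y', h4⟩ := (hZ _).1 hv
          exact (hZ _).2 ⟨gcd_gcl _ i _ _ h1 h3, _, cl i _ _ _ _ h2 h4⟩
    obtain ⟨y, hy⟩ := this g hg (.inr rfl) x hx
    exact ⟨y, g, hg, hy⟩
  have hN : Nice h.t := ⟨fun x y => h.el.mem, fun i x y => Subtype.ext (by
      show j _ = _; rw [T.gop, T.gop]; exact h.gop i x.2 y.2), fun y => by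
    obtain ⟨g, hg, hy⟩ := hc.up y.2
    refine ⟨⟨Lf c g, IL.Lf hg⟩, ?_⟩
    show y.1 ε j (Lf c g)
    rw [h.lf IL.bs hg]; exact Lf_le hg (h.on hg) (h.ge hg) _ hy⟩
  exact congrArg Subtype.val (suz dR (fun x y => ⟨snd x y, fun e => by
    obtain ⟨y', hy⟩ := tot x; rw [e, ← snd _ _ hy]; exact hy⟩) hN (a := ⟨a, IL.on ha⟩) (T.on.1 ha))
end
noncomputable section
section
variable [ZM M] {S : M → Prop} {F : M → M} {n : ℕ}
theorem Elm.df (h : Elm F) (hP : (ZM.P : M → Prop) = NoAux) {R : (Fin n → M) → Prop} (d : Df Bt R) (v : Fin n → M) :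
    R v ↔ R (fun i => F (v i)) := by
  obtain ⟨k, f, p, hp, e⟩ := d.h
  rw [e, e, hP, h]
  refine iff_of_eq (congrArg _ (funext fun i => ?_))
  refine Fin.addCases (fun i => ?_) (fun i => (hp i).elim) i
  simp
theorem Elm.ff (h : Elm F) (hP : (ZM.P : M → Prop) = NoAux) {t : (Fin n → M) → M} (d : DfF Bt t) (v : Fin n → M) :
    F (t v) = t (fun i => F (v i)) := by
  simpa using h.df hP d.h (Fin.cons (t v) v)
theorem Elm.f1 (h : Elm F) (hP : (ZM.P : M → Prop) = NoAux) (t : M → M) [d : F1 Bt t] (x : M) : F (t x) = t (F x) :=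
  h.ff hP d.h ![x]
theorem Elm.f2 (h : Elm F) (hP : (ZM.P : M → Prop) = NoAux) (t : M → M → M) [d : F2 Bt t] (x y : M) : F (t x y) = t (F x) (F y) :=
  h.ff hP d.h ![x, y]
theorem Elm.f3 (h : Elm F) (hP : (ZM.P : M → Prop) = NoAux) (t : M → M → M → M) [d : F3 Bt t] (x y z : M) :
    F (t x y z) = t (F x) (F y) (F z) := h.ff hP d.h ![x, y, z]
def W : ℕ → M → M
  | 0 => fun w => w
  | m+1 => fun w => pw (W m w)
def pm : ℕ → M → M → M
  | 0 => kp
  | m+1 => fun x y => bu (img x (pm m emp)) (img y (pm m (sg emp)))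
instance W.f (m : ℕ) : F1 S (W m : M → M) := by
  induction m with
  | zero => unfold W; infer_instance
  | succ m ih => unfold W; infer_instance
instance pm.f (m : ℕ) : F2 S (pm m : M → M → M) := by
  induction m with
  | zero => unfold pm; infer_instance
  | succ m ih => unfold pm; infer_instance
theorem mem_pm {m : ℕ} {x y z : M} : z ε pm (m+1) x y ↔ (∃ u, u ε x ∧ z = pm m emp u) ∨ ∃ u, u ε y ∧ z = pm m (sg emp) u := by
  rw [pm, mem_bu, mem_img, mem_img]
theorem e01 : (emp : M) ≠ sg emp := fun h => by
  have : (emp : M) ε sg emp := mem_sg.2 rfl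
  rw [← h] at this; exact mem_emp.1 this
theorem pm_eq {m : ℕ} {x y x' y' : M} : pm m x y = pm m x' y' ↔ x = x' ∧ y = y' := by
  induction m generalizing x y x' y' with
  | zero => exact kp_eq
  | succ m ih =>
    refine ⟨fun h => ?_, by rintro ⟨rfl, rfl⟩; rfl⟩
    have a : ∀ {x y u : M}, pm m emp u ε pm (m+1) x y ↔ u ε x := by simp [mem_pm, ih, e01]
    have b : ∀ {x y u : M}, pm m (sg emp) u ε pm (m+1) x y ↔ u ε y := by simp [mem_pm, ih, e01.symm]
    exact ⟨eqx fun z => by rw [← a, h, a], eqx fun z => by rw [← b, h, b]⟩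
structure Gd (w : M) : Prop where
  t : Tr w
  k : ∀ x y, x ε w → y ε w → kp x y ε w
  s : ∀ x y, x ε w → sub y x → y ε w
  e : sg emp ε w
variable {w : M}
theorem Gd.tr (h : Gd w) (m : ℕ) : Tr (W m w) := by
  induction m with
  | zero => exact h.t
  | succ m ih => exact fun x hx y hy => mem_pw.2 fun z hz => ih _ (mem_pw.1 hx y hy) z hz
theorem Gd.up (h : Gd w) {m : ℕ} : sub (W m w) (W (m+1) w) := fun x hx => mem_pw.2 fun z hz => h.tr m _ hx z hz
theorem Gd.sb (h : Gd w) {m : ℕ} {x y : M} (hx : x ε W m w) (hy : sub y x) : y ε W m w := by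
  cases m with
  | zero => exact h.s _ _ hx hy
  | succ m => exact mem_pw.2 fun z hz => mem_pw.1 hx z (hy z hz)
theorem Gd.e1 (h : Gd w) (m : ℕ) : sg emp ε W m w := by
  induction m with
  | zero => exact h.e
  | succ m ih => exact h.up _ ih
theorem Gd.pm (h : Gd w) {m : ℕ} : ∀ {x y : M}, x ε W m w → y ε W m w → pm m x y ε W m w := by
  induction m with
  | zero => exact h.k _ _
  | succ m ih =>
    intro x y hx hy
    have e0 : emp ε W m w := h.sb (h.e1 m) fun z hz => (mem_emp.1 hz).elim
    refine mem_pw.2 fun z hz => ?_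
    rcases mem_pm.1 hz with ⟨u, hu, rfl⟩ | ⟨u, hu, rfl⟩
    · exact ih e0 (mem_pw.1 hx u hu)
    · exact ih (h.e1 m) (mem_pw.1 hy u hu)
def pap (m : ℕ) (k x : M) : M := the (fun y => pm m x y ε k)
instance (m : ℕ) : F2 S (pap m : M → M → M) := by unfold pap; infer_instance
def rs (m : ℕ) (w k : M) : M := sep (W m w) (fun e => ∃ x y, x ε W m w ∧ e = pm m x y ∧ pm (m+2) x y ε k)
instance (m : ℕ) : F2 S (rs m : M → M → M) := by unfold rs; infer_instance
def Kf : ℕ → M → M → M → M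
  | 0 => fun w k X => un (img w (fun u => pap 0 k (int X u)))
  | m+1 => fun w k X => sep (W (2*m+2) w) (fun a => rs (2*m) w k ε pap (2*m+2) k (sep (W (2*m+1) w)
      (fun k' => sep (W (2*m+1) w) (fun z => Kf m w k' z ε a) ε X)))
instance Kf.f (m : ℕ) : F3 S (Kf m : M → M → M → M) := by
  induction m with
  | zero => unfold Kf; infer_instance
  | succ m ih => unfold Kf; infer_instance
def Kg (m : ℕ) (w a X : M) : M := sep (W (2*m+1) w) (fun k' => sep (W (2*m+1) w) (fun z => Kf m w k' z ε a) ε X)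
instance (m : ℕ) : F3 S (Kg m : M → M → M → M) := by unfold Kg; infer_instance
theorem even (h : Elm F) (hP : (ZM.P : M → Prop) = NoAux) (hw : Gd w) (hF : F w = w)
    (hc : ∀ y, y ε w → ∃ u, u ε w ∧ y ε F u) : ∀ (m : ℕ) (c : M),
    (∀ e, e ε c ↔ ∃ x, x ε W (2*m) w ∧ e = pm (2*m) x (F x)) → ∀ X, X ε W (2*m+1) w → Kf m w c X = F X := by
  have hW : ∀ m, F (W m w) = W m w := fun m => by rw [h.f1 hP (W m), hF]
  have hp : ∀ m (c : M), (∀ e, e ε c ↔ ∃ x, x ε W m w ∧ e = pm m x (F x)) → ∀ x, x ε W m w → pap m c x = F x :=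
    fun m c hc x hx => the_eq ((hc _).2 ⟨x, hx, rfl⟩) fun y hy => by
      obtain ⟨x', -, e⟩ := (hc _).1 hy
      rw [pm_eq] at e; rw [e.2, e.1]
  intro m
  induction m with
  | zero =>
    intro c h0 X hX
    have e : ∀ u, u ε w → pap 0 c (int X u) = int (F X) (F u) := fun u hu => by
      rw [hp 0 c h0 _ (hw.s u _ hu fun z hz => (mem_int.1 hz).2), h.f2 hP int]
    refine eqx fun y => ?_
    rw [Kf, mem_un]
    constructor
    · rintro ⟨_, h1, h2⟩
      obtain ⟨u, hu, rfl⟩ := mem_img.1 h1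
      rw [e u hu] at h2; exact (mem_int.1 h2).1
    · intro hy
      have : y ε w := by
        have : F X ε W 1 w := by rw [← hW 1]; exact h.mem.2 hX
        exact mem_pw.1 this y hy
      obtain ⟨u, hu, h3⟩ := hc y this
      exact ⟨_, mem_img.2 ⟨u, hu, rfl⟩, by rw [e u hu]; exact mem_int.2 ⟨hy, h3⟩⟩
  | succ m ih =>
    intro c h0 X hX
    have hr : ∀ e, e ε rs (2*m) w c ↔ ∃ x, x ε W (2*m) w ∧ e = pm (2*m) x (F x) := fun e => by
      rw [rs, mem_sep]
      constructor
      · rintro ⟨-, x, y, hx, rfl, h2⟩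
        obtain ⟨x', -, e⟩ := (h0 _).1 h2
        rw [show 2*(m+1) = 2*m+2 from rfl, pm_eq] at e
        exact ⟨x, hx, by rw [e.2, e.1]⟩
      · rintro ⟨x, hx, rfl⟩
        exact ⟨hw.pm hx (by rw [← hW]; exact h.mem.2 hx), x, _, hx, rfl, (h0 _).2 ⟨x, hw.up _ (hw.up _ hx), rfl⟩⟩
    have i1 := ih _ hr
    have hk : rs (2*m) w c ε W (2*m+1) w := mem_pw.2 fun z hz => (mem_sep.1 hz).1
    refine eqx fun a => ?_
    rw [show Kf (m+1) w c X = sep (W (2*m+2) w) (fun a => rs (2*m) w c ε pap (2*m+2) c (Kg m w a X)) from rfl, mem_sep]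
    have hFX : F X ε W (2*m+3) w := by rw [← hW]; exact h.mem.2 hX
    have : a ε W (2*m+2) w → (rs (2*m) w c ε pap (2*m+2) c (Kg m w a X) ↔ a ε F X) := fun ha => by
      rw [hp (2*m+2) c h0 (Kg m w a X) (mem_pw.2 fun z hz => (mem_sep.1 hz).1), h.f3 hP (Kg m), hF, Kg, mem_sep, and_iff_right hk]
      have : sep (W (2*m+1) w) (fun z => Kf m w (rs (2*m) w c) z ε F a) = a := eqx fun z => by
        rw [mem_sep]
        constructor
        · rintro ⟨h1, h2⟩; rw [i1 z h1] at h2; exact h.mem.1 h2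
        · intro hz
          have h1 := mem_pw.1 ha z hz
          exact ⟨h1, by rw [i1 z h1]; exact h.mem.2 hz⟩
      rw [this]
    exact ⟨fun h => (this h.1).1 h.2, fun h => have h1 := mem_pw.1 hFX a h; ⟨h1, (this h1).2 h⟩⟩
end
end
noncomputable section
section
variable [ZM M] {S : M → Prop}
theorem vind (v : M → M) [F1 Tp v] (Q : M → Prop) [D1 Tp Q] (d : M)
    (h : ∀ x, x ε d → (∀ y, y ε d → v y ε v x → Q y) → Q x) : ∀ x, x ε d → Q x := by
  by_contra! hn
  obtain ⟨x, hx, hq⟩ := hn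
  obtain ⟨e, he⟩ := sepx (fun x => ¬ Q x) d
  obtain ⟨y, hy, hm⟩ := fnd (a := img e v) ⟨_, mem_img.2 ⟨x, (he x).2 ⟨hx, hq⟩, rfl⟩⟩
  obtain ⟨z, hz, rfl⟩ := mem_img.1 hy
  obtain ⟨hz, hq⟩ := (he z).1 hz
  exact hq (h z hz fun y hy hv => by_contra fun hq => hm _ hv (mem_img.2 ⟨y, (he y).2 ⟨hy, hq⟩, rfl⟩))
def gg (s e g : M) : M := sep (cp s e) (fun z => snd z = ap g (fst z))
instance : F3 S gg := by unfold gg; infer_instance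
theorem mem_gg {s e g z : M} : z ε gg s e g ↔ ∃ x, x ε s ∧ ap g x ε e ∧ z = kp x (ap g x) := by
  rw [gg, mem_sep, mem_cp]
  constructor
  · rintro ⟨⟨x, y, h1, h2, rfl⟩, e⟩
    simp only [fst_kp, snd_kp] at e; subst e; exact ⟨x, h1, h2, rfl⟩
  · rintro ⟨x, h1, h2, rfl⟩; exact ⟨⟨_, _, h1, h2, rfl⟩, by simp⟩
theorem ap_gg {s e g x : M} (hx : x ε s) (h : ap g x ε e) : ap (gg s e g) x = ap g x :=
  ap_eq (mem_gg.2 ⟨x, hx, h, rfl⟩) fun z hz => by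
    obtain ⟨x', -, -, e⟩ := mem_gg.1 hz; rw [kp_eq] at e; rw [e.2, e.1]
def xx (s g f : M) : M := sep (cp s s) (fun z => ap g (fst z) ε ap f (snd z))
instance : F3 S xx := by unfold xx; infer_instance
theorem mem_xx {s g f a a' : M} : kp a' a ε xx s g f ↔ a' ε s ∧ a ε s ∧ ap g a' ε ap f a := by
  rw [xx, mem_sep, mem_cp]; simp [and_assoc]
theorem LL_gg {b : M} (s e g : LL b) : (gg s e g).1 = gg s.1 e.1 g.1 := by
  have T := LL_tri b
  refine T.eq (fun z => ?_) (fun w hw => ?_)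
  · rw [mem_gg, mem_gg]
    constructor
    · rintro ⟨x, h1, h2, e⟩
      obtain ⟨x, rfl⟩ := T.t _ _ h1
      rw [← T.ap] at h2 e
      exact ⟨x, h1, h2, Subtype.ext (by rw [e, T.kp])⟩
    · rintro ⟨x, h1, h2, rfl⟩
      exact ⟨x.1, h1, by rw [← T.ap]; exact h2, by rw [T.kp, T.ap]⟩
  · obtain ⟨x, h1, h2, rfl⟩ := mem_gg.1 hw
    obtain ⟨x, rfl⟩ := T.t _ _ h1
    exact ⟨kp x (ap g x), by rw [T.kp, T.ap]⟩
end
variable [ZM M] {c : M} {j : M → M}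
theorem emb_elm (h : Emb c c j) : Elm h.t := h.el
theorem st7 [F1 Tp j] (h : Emb c c j) {b s D a0 : LL c} (hs : IL b.1 s.1) (hD : ∀ a, a ε D → a ε h.t s) (h0 : a0 ε D)
    {q : LL c → LL c → LL c → Prop} [D3 Tp q]
    (hq : ∀ X a a', sub X (cp s s) → a ε D → a' ε D → (q X a' a ↔ kp a' a ε h.t X)) :
    ∃ B : LL c → LL c, F1 Tp B ∧ ∀ x, On x → (B x).1 = col (hul b.1 j D.1) (j x.1) := by
  have T := LL_tri c
  let H := hul b.1 j D.1
  have dH : D1 Tp H := hul.d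
  let fs (p : LL c) : LL c := sep (pw (cp s (sc p))) (fun g => IL b g)
  have dfs : F1 Tp fs := by unfold fs; infer_instance
  let pd (p x : LL c) : LL c := sep (cp (fs p) D) (fun z => q (xx s (fst z) (fst x)) (snd z) (snd x))
  have dpd : F2 Tp pd := by unfold pd; infer_instance
  let G (p x r : LL c) : LL c := img r snd
  have dG : F3 Tp G := by unfold G; infer_instance
  have mfs : ∀ p g, g ε fs p ↔ sub g (cp s (sc p)) ∧ IL b.1 g.1 := fun p g =>
    (mem_sep (a := pw (cp s (sc p))) (Q := fun g => IL b g)).trans (and_congr mem_pw LL_IL.symm)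
  have dB : F1 Tp (fun x => wrec pd G x (kp (cp s (sg x)) a0)) := inferInstance
  refine ⟨_, dB, fun p hp => ?_⟩
  let v (x : M) : M := ap (j (fst x)) (snd x)
  have dv : F1 Tp v := by unfold v; infer_instance
  have vk : ∀ f a : LL c, v (kp f a).1 = (ap (h.t f) a).1 := fun f a => by
    show ap _ _ = _
    rw [T.kp, fst_kp, snd_kp, T.ap]; rfl
  let d := cp (fs p) D
  have md : ∀ {z}, z ε d ↔ ∃ f a, f ε fs p ∧ a ε D ∧ z = kp f a := mem_cp
  have mp : ∀ f a, f ε fs p → a ε D → ∀ z, z ε pd p (kp f a) ↔ z ε d ∧ v z.1 ε v (kp f a).1 := fun f a hf ha z => by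
    have := mem_sep (a := d) (z := z) (Q := fun z => q (xx s (fst z) (fst (kp f a))) (snd z) (snd (kp f a)))
    refine this.trans (and_congr_right fun hz => ?_)
    obtain ⟨g, a', hg, ha', rfl⟩ := md.1 hz
    simp only [fst_kp, snd_kp]
    rw [hq (xx s g f) a a' (fun z hz => (mem_sep.1 hz).1) ha ha', (emb_elm h).f3 rfl xx, mem_xx, vk, vk]
    exact ⟨fun k => k.2.2, fun k => ⟨hD _ ha', hD _ ha, k⟩⟩
  have E : ∀ x, x ε d → wrec pd G p x = G p x (gr (pd p x) (wrec pd G p)) := fun x hx => by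
    refine wrec_eq (Q := fun x => x ε d) (fun x hx => ⟨d, hx, fun y hy => ⟨hy, fun z hz => (mem_sep.1 hz).1⟩⟩) ?_ hx
    rintro e ⟨x, hx⟩ he
    by_contra! hn
    have := vind v (fun x => ¬ x ε e.1) e.1 (fun x hx ih he' => by
      obtain ⟨x, rfl⟩ := T.t _ _ hx
      obtain ⟨y, hy, hy'⟩ := hn x hx
      obtain ⟨f, a, hf, ha, rfl⟩ := md.1 (he x hx)
      exact ih y.1 hy' ((mp f a hf ha y).1 hy).2 hy') x.1 hx
    exact this hx
  obtain ⟨Φ, hΦ⟩ : ∃ Φ, Φ = wrec pd G p := ⟨_, rfl⟩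
  have dΦ : F1 Tp Φ := by rw [hΦ]; infer_instance
  replace E : ∀ f a, f ε fs p → a ε D → ∀ w, w ε Φ (kp f a) ↔ ∃ z, z ε d ∧ v z.1 ε v (kp f a).1 ∧ w = Φ z := fun f a hf ha w => by
    rw [hΦ, E _ (md.2 ⟨f, a, hf, ha, rfl⟩), ← hΦ]
    refine (mem_img (F := snd)).trans ⟨fun ⟨r, hr, e⟩ => ?_, fun ⟨z, h1, h2, e⟩ => ?_⟩
    · obtain ⟨z, hz, rfl⟩ := mem_gr.1 hr
      rw [mp f a hf ha] at hz
      exact ⟨z, hz.1, hz.2, by rw [e, snd_kp]⟩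
    · exact ⟨_, mem_gr.2 ⟨z, (mp f a hf ha z).2 ⟨h1, h2⟩, rfl⟩, by rw [snd_kp, e]⟩
  show (wrec pd G p _).1 = _
  rw [← hΦ]
  clear hΦ mp dB dG dpd
  clear_value G pd fs d v
  clear pd G
  have key : ∀ x, x ε d.1 → ap (gr d Φ).1 x = col H (v x) := by
    refine vind v (fun x => ap (gr d Φ).1 x = col H (v x)) d.1 (fun x hx ih => ?_)
    obtain ⟨x, rfl⟩ := T.t _ _ hx
    have hx : x ε d := hx
    have ap1 : ∀ x, x ε d → ap (gr d Φ).1 x.1 = (Φ x).1 := fun x hx => by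
      rw [← T.ap, ap_gr hx]
    rw [ap1 x hx]
    obtain ⟨f, a, hf, ha, rfl⟩ := md.1 hx
    have m2 : ∀ w, w ε (Φ (kp f a)).1 ↔ ∃ z : LL c, z ε d ∧ v z.1 ε v (kp f a).1 ∧ w = (Φ z).1 := fun w => by
      constructor
      · intro hw
        obtain ⟨w, rfl⟩ := T.t _ _ hw
        obtain ⟨z, h1, h2, rfl⟩ := (E f a hf ha w).1 hw
        exact ⟨z, h1, h2, rfl⟩
      · rintro ⟨z, h1, h2, rfl⟩
        exact (E f a hf ha _).2 ⟨z, h1, h2, rfl⟩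
    refine eqx fun w => ?_
    rw [m2, mem_col]
    constructor
    · rintro ⟨z, hz, hv, rfl⟩
      obtain ⟨g, a', hg, ha', rfl⟩ := md.1 hz
      refine ⟨_, hv, ⟨g.1, a'.1, ?_, ha', ?_⟩, ?_⟩
      · exact ((mfs p g).1 hg).2
      · rw [vk, T.ap]; rfl
      · rw [← ap1 _ hz]; exact ih _ hz hv
    · rintro ⟨y, hy, ⟨g, a', hg, ha', rfl⟩, rfl⟩
      let g1 : LL c := ⟨g, b.2.up hg⟩
      obtain ⟨a', rfl⟩ := T.t _ _ ha'
      have e1 : ap (j g) a'.1 = (ap (h.t g1) a').1 := by rw [T.ap]; rfl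
      rw [e1, vk] at hy
      have hy : ap (h.t g1) a' ε ap (h.t f) a := hy
      have h2 : ap (h.t g1) a' ε sc (h.t p) := by
        obtain ⟨u, hu, hy⟩ := mem_ap.1 hy
        have hf := mem_pw.2 ((mfs p f).1 hf).1
        rw [← (emb_elm h).mem, (emb_elm h).f1 rfl pw, (emb_elm h).f2 rfl cp, (emb_elm h).f1 rfl sc] at hf
        obtain ⟨x, u', hx, hu', e⟩ := mem_cp.1 (mem_pw.1 hf _ hu)
        rw [kp_eq] at e; obtain ⟨rfl, rfl⟩ := e
        have hp : On (h.t p) := T.on.1 (h.on (T.on.2 hp))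
        exact hp.sc.1 _ hu' _ hy
      let g2 := gg s (sc p) g1
      have e3 : ap (h.t g2) a' = ap (h.t g1) a' := by
        rw [(emb_elm h).f3 rfl gg, (emb_elm h).f1 rfl sc, ap_gg (hD _ ha') h2]
      have hg2 : g2 ε fs p := (mfs p g2).2 ⟨fun z hz => (mem_sep.1 hz).1, (by
        have := (gg (⟨s.1, hs⟩ : LL b.1) ⟨(sc p).1, IL.on (T.on.2 hp.sc)⟩ ⟨g, hg⟩).2
        rw [LL_gg] at this; exact (LL_gg s (sc p) g1).symm ▸ this)⟩
      have hd : kp g2 a' ε d := md.2 ⟨_, _, hg2, ha', rfl⟩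
      have hv : v (kp g2 a').1 ε v (kp f a).1 := by rw [vk, vk, e3]; exact hy
      refine ⟨kp g2 a', hd, hv, ?_⟩
      rw [← ap1 _ hd, ih _ hd hv, vk, e3, e1]
  have hk : cp s (sg p) ε fs p := (mfs p _).2 ⟨fun z hz => by
    obtain ⟨x, y, hx, hy, rfl⟩ := mem_cp.1 hz
    exact mem_cp.2 ⟨x, y, hx, mem_sc.2 (.inr (mem_sg.1 hy)), rfl⟩, (by
      have := (cp (⟨s.1, hs⟩ : LL b.1) (sg ⟨p.1, IL.on (T.on.2 hp)⟩)).2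
      rw [(LL_tri b.1).cp, (LL_tri b.1).sg] at this
      rw [T.cp, T.sg]; exact this)⟩
  have hd : kp (cp s (sg p)) a0 ε d := md.2 ⟨_, _, hk, h0, rfl⟩
  have := key _ hd
  rw [← T.ap, ap_gr hd, vk, (emb_elm h).f2 rfl cp, (emb_elm h).f1 rfl sg] at this
  rw [this, ap_eq (y := h.t p) (mem_cp.2 ⟨_, _, hD _ h0, by simp, rfl⟩) fun z hz => by
    obtain ⟨x, y, hx, hy, e⟩ := mem_cp.1 hz
    rw [kp_eq] at e; rw [e.2, mem_sg.1 hy]]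
  rfl
end
noncomputable section
section
variable [ZM M] {S : M → Prop} {F : M → M}
theorem Elm.d3 (h : Elm F) (hP : (ZM.P : M → Prop) = NoAux) (R : M → M → M → Prop) [d : D3 Bt R] (x y z : M) :
    R x y z ↔ R (F x) (F y) (F z) := h.df hP d.h ![x, y, z]
theorem Elm.d2 (h : Elm F) (hP : (ZM.P : M → Prop) = NoAux) (R : M → M → Prop) [d : D2 Bt R] (x y : M) :
    R x y ↔ R (F x) (F y) := h.df hP d.h ![x, y]
theorem Elm.d1 (h : Elm F) (hP : (ZM.P : M → Prop) = NoAux) (R : M → Prop) [d : D1 Bt R] (x : M) :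
    R x ↔ R (F x) := h.df hP d.h ![x]
theorem Elm.d4 (h : Elm F) (hP : (ZM.P : M → Prop) = NoAux) (R : M → M → M → M → Prop) [d : D4 Bt R] (x y z w : M) :
    R x y z w ↔ R (F x) (F y) (F z) (F w) := h.df hP d.h ![x, y, z, w]
def Cfr (d n r : M) : Prop := (∀ z, z ε d → ∃ x, x ε n ∧ kp z x ε r) ∧ (∀ x, x ε n → ∃ z, z ε d ∧ ¬ kp z x ε r) ∧
  ∀ z z' x x', z ε d → x' ε n → kp z x ε r → le z' z → le x x' → kp z' x' ε r
instance : D3 S Cfr := by unfold Cfr; infer_instance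
def Cof (d n : M) : Prop := ∃ r, Cfr d n r
instance : D2 S Cof := by unfold Cof; infer_instance
theorem le_trans' {a b c : M} (hc : On c) (h : le a b) (h' : le b c) : le a c := by
  rcases h' with h' | rfl
  · exact .inl (lt_of_le_of_lt' hc h h')
  · exact h
theorem Cof.int {d n : M} (hd : On d) (hn : On n) (h : Cof d n) : ∃ r, sub r (cp d n) ∧ Cfr d n r := by
  obtain ⟨r, h1, h2, h3⟩ := h
  refine ⟨sep (cp d n) (fun z => z ε r), fun z hz => (mem_sep.1 hz).1, fun z hz => ?_, fun x hx => ?_, ?_⟩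
  · obtain ⟨x, hx, h⟩ := h1 z hz
    exact ⟨x, hx, mem_sep.2 ⟨mem_cp.2 ⟨_, _, hz, hx, rfl⟩, h⟩⟩
  · obtain ⟨z, hz, h⟩ := h2 x hx
    exact ⟨z, hz, fun q => h (mem_sep.1 q).2⟩
  · intro z z' x x' hz hx h hl hl'
    exact mem_sep.2 ⟨mem_cp.2 ⟨_, _, lt_of_le_of_lt' hd hl hz, hx, rfl⟩, h3 z z' x x' hz hx (mem_sep.1 h).2 hl hl'⟩
theorem Cof.tr {d m n : M} (hd : On d) (hm : On m) (hn : On n) (h : Cof d m) (h' : Cof d n) : Cof m n := by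
  obtain ⟨r, h1, h2, h3⟩ := h
  obtain ⟨r', g1, g2, g3⟩ := h'
  obtain ⟨g, key⟩ : ∃ g, ∀ i x, kp i x ε g ↔ i ε m ∧ x ε n ∧ ∀ z, z ε d → kp z i ε r → kp z x ε r' :=
    ⟨sep (cp m n) (fun w => ∀ z, z ε d → kp z (fst w) ε r → kp z (snd w) ε r'), fun i x => by
      rw [mem_sep, mem_cp]; simp [and_assoc]⟩
  refine ⟨g, fun i hi => ?_, fun x hx => ?_, fun i i' x x' hi hx' q hl hl' => ?_⟩
  · obtain ⟨z0, hz0, hz⟩ := h2 i hi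
    obtain ⟨x, hx, hh⟩ := g1 z0 hz0
    refine ⟨x, hx, (key _ _).2 ⟨hi, hx, fun z hz' hr => g3 z0 z x x hz0 hx hh ?_ (.inr rfl)⟩⟩
    rw [← nlt (hd.mem hz0) (hd.mem hz')]
    exact fun hl => hz (h3 z z0 i i hz' hi hr (.inl hl) (.inr rfl))
  · obtain ⟨z, hz, hh⟩ := g2 x hx
    obtain ⟨i, hi, hi'⟩ := h1 z hz
    exact ⟨i, hi, fun q => hh (((key _ _).1 q).2.2 z hz hi')⟩
  · rw [key] at q ⊢
    exact ⟨lt_of_le_of_lt' hm hl hi, hx', fun z hz hr => g3 z z x x' hz hx' (q.2.2 z hz (h3 z z i' i hz hi hr (.inr rfl) hl)) (.inr rfl) hl'⟩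
structure Rch (n a : M) (t : M → M) : Prop where
  o : ∀ x, x ε n → On (t x)
  m : ∀ x y, x ε n → y ε n → le x y → le (t x) (t y)
  u : ∀ z, z ε a ↔ ∃ x, x ε n ∧ z ε t x
theorem Rch.on {n a : M} {t : M → M} (h : Rch n a t) : On a :=
  on_of (fun z hz w hw => by
    obtain ⟨x, hx, hz⟩ := (h.u _).1 hz; exact (h.u _).2 ⟨x, hx, (h.o x hx).1 _ hz _ hw⟩)
    (fun z hz => by obtain ⟨x, hx, hz⟩ := (h.u _).1 hz; exact (h.o x hx).mem hz)
def P1 (f a h s n : M) : Prop := ∀ x, x ε s → ap f x ε a → ∃ y, y ε n ∧ kp x y ε h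
instance : Df S (fun v : Fin 5 → M => P1 (v 0) (v 1) (v 2) (v 3) (v 4)) := by unfold P1; infer_instance
def P2 (f h y t : M) : Prop := ∀ x, kp x y ε h → ap f x ε t
instance : D4 S P2 := by unfold P2; infer_instance
def P3 (f a z : M) : Prop := ∀ x, x ε a → ∃ e, le e z ∧ ap f e ε a ∧ ¬ ap f e ε x
instance : D3 S P3 := by unfold P3; infer_instance
def P4 (f a d t : M) : Prop := ∀ x, x ε d → ap f x ε a → ap f x ε t
instance : D4 S P4 := by unfold P4; infer_instance
end
section
variable [ZM M] {c b : M} {k : M → M}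
theorem kpl {x y : M} (h : IL b (kp x y)) : IL b x ∧ IL b y :=
  ⟨(h.tr (y := sg x) (by simp [kp])).tr (by simp), (h.tr (y := pr x y) (by simp [kp])).tr (by simp)⟩
theorem P1b (f a h s n : LL b) : P1 f a h s n ↔ P1 f.1 a.1 h.1 s.1 n.1 := by
  have T := LL_tri b
  unfold P1
  constructor
  · intro q x hx hf
    obtain ⟨x, rfl⟩ := T.t _ _ hx
    rw [← T.ap] at hf
    obtain ⟨y, hy, hh⟩ := q x hx hf
    exact ⟨y.1, hy, by rw [← T.kp]; exact hh⟩
  · intro q x hx hf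
    obtain ⟨y, hy, hh⟩ := q x.1 hx (by rw [← T.ap]; exact hf)
    obtain ⟨y, rfl⟩ := T.t _ _ hy
    exact ⟨y, hy, by rw [← T.kp] at hh; exact hh⟩
theorem P2b (f h y t : LL b) : P2 f h y t ↔ P2 f.1 h.1 y.1 t.1 := by
  have T := LL_tri b
  unfold P2
  constructor
  · intro q x hx
    have hi : IL b x := (kpl (h.2.tr hx)).1
    have := q ⟨x, hi⟩ (by rw [← T.kp ⟨x, hi⟩ y] at hx; exact hx)
    rw [← T.ap f ⟨x, hi⟩]; exact this
  · intro q x hx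
    have := q x.1 (by rw [← T.kp]; exact hx)
    rw [← T.ap] at this; exact this
theorem P3b (f a z : LL b) : P3 f a z ↔ P3 f.1 a.1 z.1 := by
  have T := LL_tri b
  unfold P3
  constructor
  · intro q x hx
    obtain ⟨x, rfl⟩ := T.t _ _ hx
    obtain ⟨e, h1, h2, h3⟩ := q x hx
    refine ⟨e.1, ?_, by rw [← T.ap]; exact h2, by rw [← T.ap]; exact h3⟩
    rcases h1 with h1 | rfl
    · exact .inl h1
    · exact .inr rfl
  · intro q x hx
    obtain ⟨e, h1, h2, h3⟩ := q x.1 hx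
    have hi : IL b e := by
      rcases h1 with h1 | rfl
      · exact z.2.tr h1
      · exact z.2
    rw [← T.ap f ⟨e, hi⟩] at h2 h3
    refine ⟨⟨e, hi⟩, ?_, h2, h3⟩
    rcases h1 with h1 | h1
    · exact .inl h1
    · exact .inr (Subtype.ext h1)
theorem P4b (f a d t : LL b) : P4 f a d t ↔ P4 f.1 a.1 d.1 t.1 := by
  have T := LL_tri b
  unfold P4
  constructor
  · intro q x hx
    obtain ⟨x, rfl⟩ := T.t _ _ hx
    rw [← T.ap]; exact q x hx
  · intro q x hx hf
    have := q x.1 hx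
    rw [← T.ap] at this
    exact this hf
theorem iefix [F1 Tp k] (h : Emb c c k) {s n a f x : M} {t : M → M} [F1 Tp t] (R : Rch n a t) (hs : IL c s) (hn : On n) (kn : k n = n)
    (kf : ∀ x, x ε n → k x = x) (hr : ∀ r, sub r (cp s n) → IL c r) (hf : IL c f) (hx : x ε k s) (hz : ap (k f) x ε k a) :
    ∃ y, y ε n ∧ ap (k f) x ε k (t y) := by
  obtain ⟨g, hg⟩ : ∃ g, ∀ z, z ε g ↔ z ε cp s n ∧ ap f (fst z) ε t (snd z) := ⟨_, fun z => mem_sep⟩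
  have key : ∀ x y, kp x y ε g ↔ x ε s ∧ y ε n ∧ ap f x ε t y := fun x y => by
    rw [hg, mem_cp]; simp [and_assoc]
  have gl : IL c g := hr g fun z hz => ((hg z).1 hz).1
  let f' : LL c := ⟨f, hf⟩
  let a' : LL c := ⟨a, IL.on R.on⟩
  let g' : LL c := ⟨g, gl⟩
  let s' : LL c := ⟨s, hs⟩
  let n' : LL c := ⟨n, IL.on hn⟩
  have h1 : P1 f' a' g' s' n' := (P1b ..).2 fun x hx hf => by
    obtain ⟨y, hy, hh⟩ := (R.u _).1 hf
    exact ⟨y, hy, (key ..).2 ⟨hx, hy, hh⟩⟩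
  have h2 : P1 (h.t f') (h.t a') (h.t g') (h.t s') (h.t n') :=
    ((emb_elm h).df rfl (R := fun v : Fin 5 → LL c => P1 (v 0) (v 1) (v 2) (v 3) (v 4)) inferInstance ![f', a', g', s', n']).1 h1
  obtain ⟨y, hy, hh⟩ := (P1b ..).1 h2 x hx hz
  have hy : y ε n := by rw [← kn]; exact hy
  refine ⟨y, hy, ?_⟩
  let y' : LL c := ⟨y, IL.on (hn.mem hy)⟩
  let t' : LL c := ⟨t y, IL.on (R.o y hy)⟩
  have h3 : P2 f' g' y' t' := (P2b ..).2 fun x hx => ((key ..).1 hx).2.2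
  have h4 := (P2b ..).1 (((emb_elm h).d4 rfl P2 _ _ _ _).1 h3) x
  exact h4 (by show kp x (k y) ε k g; rw [kf y hy]; exact hh)
theorem kfix [F1 Tp k] (h : Emb c c k) {n a f d : M} {t : M → M} [F1 Tp t] (R : Rch n a t) (hn : On n) (hd : On d) (hdk : d ε k d)
    (kf : ∀ x, x ε d → k x = x) (hc : ¬ Cof d n) (hf : IL c f) (hz : ap (k f) d ε k a) :
    ∃ y, y ε n ∧ ap (k f) d ε k (t y) := by
  by_contra! hno
  apply hc
  obtain ⟨g, key⟩ : ∃ g, ∀ z x, kp z x ε g ↔ z ε d ∧ x ε n ∧ ∀ e, le e z → ap f e ε a → ap f e ε t x :=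
    ⟨sep (cp d n) (fun w => ∀ e, le e (fst w) → ap f e ε a → ap f e ε t (snd w)), fun z x => by
      rw [mem_sep, mem_cp]; simp [and_assoc]⟩
  let f' : LL c := ⟨f, hf⟩
  let a' : LL c := ⟨a, IL.on R.on⟩
  refine ⟨g, fun z hzd => ?_, fun x hx => ?_, fun z z' x x' hz hx' q hl hl' => ?_⟩
  · by_contra! hcn
    let z' : LL c := ⟨z, IL.on (hd.mem hzd)⟩
    have h1 : P3 f' a' z' := (P3b ..).2 fun x hx => by
      obtain ⟨y, hy, hxy⟩ := (R.u _).1 hx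
      have := hcn y hy
      rw [key] at this
      push Not at this
      obtain ⟨e, h1, h2, h3⟩ := this hzd hy
      exact ⟨e, h1, h2, fun h4 => h3 ((R.o y hy).1 _ hxy _ h4)⟩
    have h2 := (P3b ..).1 (((emb_elm h).d3 rfl P3 _ _ _).1 h1)
    obtain ⟨e, h3, h4, h5⟩ := h2 (ap (k f) d) hz
    have h3 : le e z := by rw [← kf z hzd]; exact h3
    have he : e ε d := lt_of_le_of_lt' hd h3 hzd
    have ee : ap (k f) e = k (ap f e) := by rw [h.ap hf (IL.on (hd.mem he)), kf e he]
    change ap (k f) e ε k a at h4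
    change ¬ ap (k f) e ε _ at h5
    rw [ee] at h4 h5
    rw [h.mem (hf.ap (IL.on (hd.mem he))) (IL.on R.on)] at h4
    obtain ⟨y, hy, hh⟩ := (R.u _).1 h4
    have hto := R.o y hy
    rw [← h.mem (hf.ap (IL.on (hd.mem he))) (IL.on hto)] at hh
    have := hno y hy
    rw [nlt ((h.on R.on).mem hz) (h.on hto)] at this
    exact h5 (lt_of_lt_of_le' ((h.on R.on).mem hz) hh this)
  · by_contra! hcn
    let d' : LL c := ⟨d, IL.on hd⟩
    let t' : LL c := ⟨t x, IL.on (R.o x hx)⟩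
    have h1 : P4 f' a' d' t' := (P4b ..).2 fun z hzd hfz => ((key z x).1 (hcn z hzd)).2.2 z (.inr rfl) hfz
    exact hno x hx ((P4b ..).1 (((emb_elm h).d4 rfl P4 _ _ _ _).1 h1) d hdk hz)
  · rw [key] at q ⊢
    exact ⟨lt_of_le_of_lt' hd hl hz, hx', fun e he hfe =>
      lt_of_lt_of_le' (R.o x' hx') (q.2.2 e (le_trans' (hd.mem hz) he hl) hfe) (R.m x x' q.2.1 hx' hl')⟩
end
end
noncomputable section
variable [ZM M] {c b b1 v : M} {J k e : M → M}
theorem IL.l0 {x : M} (h : x ε L0 b) : IL b x := ⟨emp, on_emp, by rw [ZFI0.Lf, hr_emp]; exact h⟩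
def fF (p q : M → M) (C : M) : M := sc (bu (p C) (q C))
instance {p q : M → M} [F1 Tp p] [F1 Tp q] : F1 Tp (fF p q) := by unfold fF; infer_instance
theorem unb (p q : M → M) [F1 Tp p] [F1 Tp q] (hp : ∀ x, On x → On (p x)) (hq : ∀ x, On x → On (q x)) {a0 n : M}
    (h0 : On a0) (hn : Lim n) : ∃ a t, F1 Tp t ∧ Rch n a t ∧ le a0 a ∧ ∀ x, x ε n → p (t x) ε a ∧ q (t x) ε a := by
  have ho : ∀ a, On a → On (hr (fF p q) a0 a) := fun a ha => by
    refine oind (fun a => On (hr (fF p q) a0 a)) (fun a ha ih => ?_) ha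
    have hF : ∀ m, m ε a → On (fF p q (hr (fF p q) a0 m)) := fun m hm => (on_max (hp _ (ih m hm)) (hq _ (ih m hm))).sc
    refine on_of (fun y hy z hz => ?_) (fun y hy => ?_)
    · rw [mem_hr ha] at hy ⊢
      rcases hy with hy | ⟨m, hm, hy⟩
      · exact .inl (h0.1 _ hy _ hz)
      · exact .inr ⟨m, hm, (hF m hm).1 _ hy _ hz⟩
    · rw [mem_hr ha] at hy
      rcases hy with hy | ⟨m, hm, hy⟩
      · exact h0.mem hy
      · exact (hF m hm).mem hy
  refine ⟨hr (fF p q) a0 n, hr (fF p q) a0, inferInstance, ⟨fun x hx => ho x (hn.1.mem hx), fun x y hx hy hl => ?_, fun z => hr_lim hn⟩, ?_, fun x hx => ?_⟩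
  · exact (le_iff (ho _ (hn.1.mem hx)) (ho _ (hn.1.mem hy))).2 (hr_le (hn.1.mem hx) (hn.1.mem hy) hl)
  · exact (le_iff h0 (ho _ hn.1)).2 (hr_base hn.1)
  · have hx' := ho x (hn.1.mem hx)
    have hm := le_max (hp _ hx') (hq _ hx')
    exact ⟨(mem_hr hn.1).2 (.inr ⟨x, hx, mem_sc_le.2 hm.1⟩), (mem_hr hn.1).2 (.inr ⟨x, hx, mem_sc_le.2 hm.2⟩)⟩
theorem fxo {H : M → Prop} [D1 Tp H] {n a : M} {t : M → M} (R : Rch n a t) (hh : ∀ z, z ε k a → H z → ∃ y, y ε n ∧ z ε k (t y))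
    (ht : ∀ y, y ε n → col H (k (t y)) ε a) (ho : On (col H (k a))) (hle : le a (col H (k a))) : col H (k a) = a := by
  refine eqx fun w => ⟨fun hw => ?_, (le_iff R.on ho).1 hle w⟩
  obtain ⟨z, hz, hH, rfl⟩ := mem_col.1 hw
  obtain ⟨y, hy, hzy⟩ := hh z hz hH
  exact R.on.1 _ (ht y hy) _ (mem_col.2 ⟨z, hzy, hH, rfl⟩)
theorem emb_id [F1 Tp e] (h : Emb b b e) (h0 : ∀ x, x ε L0 b → e x = x) (ho : ∀ a, On a → e a = a) {x : M} (hx : IL b x) :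
    e x = x := by
  obtain ⟨a, ha, hx⟩ := hx
  refine oind (fun a => ∀ x, x ε Lf b a → e x = x) (fun a ha ih x hx => ?_) ha x hx
  have hx1 : IL b x := ⟨a, ha, hx⟩
  rcases (mem_hr ha).1 hx with hx | ⟨m, hm, hx⟩
  · exact h0 x hx
  · have hmo := ha.mem hm
    change x ε dfs (Lf b m) at hx
    have hs := (mem_dfs.1 hx).1
    rw [← Lf_sc hmo, ← h.mem hx1 (IL.Lf hmo.sc), h.lf IL.bs hmo.sc, h0 b (mem_L0 b), ho _ hmo.sc, Lf_sc hmo] at hx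
    have hs' := (mem_dfs.1 hx).1
    refine eqx fun z => ⟨fun hz => ?_, fun hz => ?_⟩
    · have hz' := hs' z hz
      rw [← ih m hm z hz', h.mem ⟨m, hmo, hz'⟩ hx1] at hz
      exact hz
    · have hz' := hs z hz
      rw [← h.mem ⟨m, hmo, hz'⟩ hx1, ih m hm z hz'] at hz
      exact hz
theorem eq_dcl {e1 e2 : M → M} (h1 : Emb b b1 e1) (h2 : Emb b b1 e2) : Dcl b (fun x => IL b x ∧ e1 x = e2 x) := by
  intro n f v y hv hf
  refine ⟨y.2, ?_⟩
  let r : Fin (n+1) → Fin (n+2) := Fin.cons 0 (fun i => i.succ.succ)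
  have hr : ∀ {T : Type} (z y : T) (w : Fin n → T),
      (fun i => (Fin.cons z (Fin.cons y w : Fin (n+1) → T) : Fin (n+2) → T) (r i)) = Fin.cons z w := fun z y w => by
    funext i; refine Fin.cases ?_ (fun i => ?_) i <;> simp [r]
  have key := (h1.el (.all (.impl (ren r f) (.equ 0 1))) (Fin.cons y v)).1 (fun z _ hz => by
    rw [Eval_ren, hr, hf] at hz; exact hz)
  have hc : ∀ {e : M → M} (h : Emb b b1 e) (x : LL b), (fun i => (⟨e ((Fin.cons x v : Fin (n+1) → LL b) i).1, h.mp _ ((Fin.cons x v : Fin (n+1) → LL b) i).2⟩ : LL b1)) =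
      Fin.cons (h.t x) (fun i => h.t (v i)) := fun h x => by
    funext i; refine Fin.cases ?_ (fun i => ?_) i <;> rfl
  have k2 := (h2.el f (Fin.cons y v)).1 ((hf y).2 rfl)
  rw [hc] at key k2
  have hvv : (fun i => h2.t (v i)) = fun i => h1.t (v i) := funext fun i => Subtype.ext (hv i).2.symm
  rw [hvv] at k2
  have := key (h2.t y) trivial (by rw [Eval_ren, hr]; exact k2)
  exact congrArg Subtype.val (this.symm : h1.t y = h2.t y)
theorem L0_j (h : Emb v v J) (hb : IL v b) : J (L0 b) = L0 (J b) := by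
  have := congrArg Subtype.val ((emb_elm h).f1 rfl L0 ⟨b, hb⟩)
  rw [(LL_tri v).L0] at this
  refine Eq.trans ?_ this
  show J _ = J _
  rw [(LL_tri v).L0]
theorem IL.l0' : IL b (L0 b) := by
  have := ((L0 (⟨b, IL.bs⟩ : LL b))).2
  rwa [(LL_tri b).L0] at this
theorem gr_id (h : Emb b b k) {d : M} (hd : IL b d) : ∃ g, IL b g ∧ ∀ x, x ε k d → ap (k g) x = x := by
  let d' : LL b := ⟨d, hd⟩
  refine ⟨(gr d' (fun x => x)).1, (gr d' (fun x => x)).2, fun x hx => ?_⟩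
  have e1 := (emb_elm h).f1 rfl (fun d => gr d (fun x => x)) d'
  have hx' : IL b x := (h.mp d hd).tr hx
  have e2 : ap (h.t (gr d' (fun x => x))) ⟨x, hx'⟩ = ⟨x, hx'⟩ := by
    rw [e1]; exact ap_gr (F := fun x => x) (show (⟨x, hx'⟩ : LL b) ε h.t d' from hx)
  exact (h.apt _ ⟨x, hx'⟩).symm.trans (congrArg Subtype.val e2)
theorem mainA [F1 Tp J] (h : Emb v v J) {s D a0 : M} (hb : IL v b) (hs : IL b s) (hD : sub D (J s)) (hS : Seed b J D)
    (hz : ∀ x, x ε L0 (J b) → hul b J D x) (hD0 : sub D (L0 (J b)))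
    (hn : ∀ d, On d → ∃ n, Lim n ∧ ¬ Cof d n ∧ J n = n ∧ (∀ x, x ε n → J x = x) ∧ ∀ r, sub r (cp s n) → IL v r)
    (h0 : On a0) (hm : unc (hul b J D) a0 ≠ a0) :
    ∃ e, F1 Tp e ∧ Emb b b e ∧ (∀ x, x ε L0 b → e x = x) ∧ ∃ a, On a ∧ e a ≠ a := by
  obtain ⟨b1, hb1⟩ : ∃ b1, b1 = J b := ⟨_, rfl⟩
  have hJ : Emb b b1 J := hb1 ▸ h.res hb
  rw [← hb1] at hz hD0
  obtain ⟨H, hH⟩ : ∃ H, H = hul b J D := ⟨_, rfl⟩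
  have dH : D1 Tp H := by rw [hH]; infer_instance
  obtain ⟨f1, f2, f3, f4, f5⟩ := emb_fact hJ hs hD hS hz
  rw [← hH] at f1 f2 f3 f4 f5 hm hz
  obtain ⟨k, hk⟩ : ∃ k, k = unc H := ⟨_, rfl⟩
  have dk : F1 Tp k := by rw [hk]; infer_instance
  obtain ⟨ie, hie⟩ : ∃ ie, ie = fun x => col H (J x) := ⟨_, rfl⟩
  have die : F1 Tp ie := by rw [hie]; infer_instance
  have iex : ∀ x, ie x = col H (J x) := fun x => by rw [hie]
  rw [← hie] at f3
  rw [← hk] at f2 f5 hm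
  simp only [← iex] at f5
  have k0 : ∀ x, x ε L0 b1 → k x = x := fun x hx => by
    have := f1.unc (hz x hx)
    rwa [f1.fix (tr_L0 b1) hz hx, ← hk] at this
  obtain ⟨d, hd, hkd, hdm, -⟩ := lst (fun a => k a ≠ a) h0 hm
  have kf : ∀ x, x ε d → k x = x := fun x hx => by simpa using hdm x hx
  have hdk : d ε k d := (f2.ge hd).resolve_right fun e => hkd e.symm
  obtain ⟨g, hg, hgi⟩ := gr_id f2 (IL.on hd (b := b1))
  have hsd : sub (sg d) (k d) := fun z hz => by rw [mem_sg] at hz; rw [hz]; exact hdk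
  have hS' : Seed b1 k (sg d) := ⟨⟨d, by simp⟩, fun a a' ha ha' => by
    rw [mem_sg] at ha ha'; subst ha ha'
    exact ⟨a', g, g, by simp, hg, hg, (hgi _ hdk).symm, (hgi _ hdk).symm⟩⟩
  obtain ⟨H', hH'⟩ : ∃ H', H' = hul b1 k (sg d) := ⟨_, rfl⟩
  have dH' : D1 Tp H' := by rw [hH']; infer_instance
  have hfx : ∀ x, IL b1 x → k x = x → H' x := fun x hx e => by
    rw [← e, hH']; exact emb_cn f2 (IL.on hd) hsd (a := d) (by simp) hx
  have hz' : ∀ x, x ε L0 b1 → hul b1 k (sg d) x := fun x hx => by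
    rw [← hH']; exact hfx x (IL.l0 hx) (k0 x hx)
  obtain ⟨g1, g2, g3, g4, g5⟩ := emb_fact f2 (IL.on hd) hsd hS' hz'
  rw [← hH'] at g1 g2 g3 g4 g5 hz'
  obtain ⟨ku, hku⟩ : ∃ ku, ku = fun x => col H' (k x) := ⟨_, rfl⟩
  have dku : F1 Tp ku := by rw [hku]; infer_instance
  have kux : ∀ x, ku x = col H' (k x) := fun x => by rw [hku]
  rw [← hku] at g3
  have ku0 : ∀ x, x ε L0 b1 → ku x = x := fun x hx => by
    rw [kux, k0 x hx]; exact g1.fix (tr_L0 b1) hz' hx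
  have kud : ku d ≠ d := fun e => by
    have h1 : ∀ x, x ε sc d → H' x := fun x hx => by
      rcases mem_sc.1 hx with hx | rfl
      · exact hfx x (IL.on (hd.mem hx)) (kf x hx)
      · rw [hH']; exact ⟨g, x, hg, by simp, (hgi _ hdk).symm⟩
    have h2 := g1.fix hd.sc.1 h1 (x := d) (by simp)
    have h3 := g5 d (IL.on hd)
    rw [← kux, e, ← h2, g1.unc (h1 d (by simp))] at h3
    rw [h2] at h3
    exact hkd h3.symm
  have h02 := f3.cmpo g3
  let Q (x : M) : Prop := IL b x ∧ ie x = ku (ie x)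
  have dQ : D1 Tp Q := by unfold Q; infer_instance
  have hl : Hl b Q := ⟨dQ, fun x hx => hx.1, fun x hx => ⟨IL.l0 hx, by
    have : J x ε L0 b1 := by
      rw [hb1, ← L0_j h hb, h.mem (hb.up (IL.l0 hx)) (hb.up IL.l0')]; exact hx
    rw [iex, f1.fix (tr_L0 b1) hz this, ku0 _ this]⟩, eq_dcl f3 h02⟩
  have hub : ∀ a, On a → ∃ b, On b ∧ Q b ∧ le a b := fun a ha => by
    obtain ⟨n, n1, n2, n3, n4, n5⟩ := hn d hd
    obtain ⟨a1, t, dt, R, hl, hr⟩ := unb ie ku (fun x hx => f3.on hx) (fun x hx => g3.on hx) ha n1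
    have e1 : ie a1 = a1 := by
      rw [iex]
      refine fxo R (fun z hz hHz => ?_) (fun y hy => by rw [← iex]; exact (hr y hy).1) (by rw [← iex]; exact f3.on R.on) (by rw [← iex]; exact f3.ge R.on)
      rw [hH] at hHz
      obtain ⟨f, x, hf, hx, rfl⟩ := hHz
      exact iefix h R (hb.up hs) n1.1 n3 n4 n5 (hb.up hf) (hD _ hx) hz
    have e2 : ku a1 = a1 := by
      rw [kux]
      refine fxo R (fun z hz hHz => ?_) (fun y hy => by rw [← kux]; exact (hr y hy).2) (by rw [← kux]; exact g3.on R.on) (by rw [← kux]; exact g3.ge R.on)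
      rw [hH'] at hHz
      obtain ⟨f, x, hf, hx, rfl⟩ := hHz
      rw [mem_sg] at hx; subst hx
      exact kfix f2 R n1.1 hd hdk kf n2 hf hz
    exact ⟨a1, R.on, ⟨IL.on R.on, by rw [e1, e2]⟩, hl⟩
  obtain ⟨q1, q2⟩ := hl.col hub
  have e0 : ∀ x, x ε L0 b → unc Q x = x := fun x hx => by
    have := hl.unc (hl.z x hx)
    rwa [hl.fix (tr_L0 b) hl.z hx] at this
  refine ⟨unc Q, inferInstance, q2, e0, ?_⟩
  by_contra! hno
  have hQ : ∀ x, IL b x → ie x = ku (ie x) := fun x hx => by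
    obtain ⟨y, hy, e⟩ := (q1 x).1 hx
    have h1 := emb_id q2 e0 hno hx
    have h2 := hl.unc hy
    rw [← e, h1] at h2
    rw [h2]; exact hy.2
  obtain ⟨y, hy, e⟩ := (f4 d).1 (IL.on hd)
  have e3 : k d = y := by rw [e, hk, f1.unc hy]
  rw [hH] at hy
  obtain ⟨f, a, hf, ha, rfl⟩ := hy
  have hda := hD0 a ha
  have hfl := f3.mp f hf
  rw [← f5 f hf, ← k0 a hda, ← f2.ap hfl (IL.l0 hda), f2.inj (IL.on hd) (hfl.ap (IL.l0 hda))] at e3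
  apply kud
  rw [e3, g3.ap hfl (IL.l0 hda), ← hQ f hf, ku0 a hda]
end
noncomputable section
variable [ZM M] {v w : M}
theorem un_pw (x : M) : un (pw x) = x := eqx fun z => by
  rw [mem_un]; constructor
  · rintro ⟨y, hy, hz⟩; exact mem_pw.1 hy z hz
  · intro hz; exact ⟨x, mem_pw.2 fun _ h => h, hz⟩
theorem scn_s : ∀ (m : ℕ) (x : M), scn (m+1) x = sc (scn m x)
  | 0, x => rfl
  | m+1, x => scn_s m (sc x)
theorem scn_on {x : M} (h : On x) : ∀ m : ℕ, On (scn m x)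
  | 0 => h
  | m+1 => by rw [scn_s]; exact (scn_on h m).sc
theorem Vf_scn {x : M} (h : On x) : ∀ m : ℕ, Vf (scn m x) = W m (Vf x)
  | 0 => rfl
  | m+1 => by rw [scn_s, Vf_sc (scn_on h m), Vf_scn h m]; rfl
theorem Vf_pr {a x y : M} (ha : On a) (hx : sub x (Vf a)) (hy : sub y (Vf a)) : sub (pr x y) (Vf (sc a)) := fun z hz => by
  rw [Vf_sc ha, mem_pw]; rcases mem_pr.1 hz with rfl | rfl <;> assumption
theorem Vf_kp {a x y : M} (ha : On a) (hx : sub x (Vf a)) (hy : sub y (Vf a)) : sub (kp x y) (Vf (sc (sc a))) := by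
  unfold kp sg
  exact Vf_pr ha.sc (Vf_pr ha hx hx) (Vf_pr ha hx hy)
theorem Vf_two {a x y : M} (ha : Lim a) (hx : x ε Vf a) (hy : y ε Vf a) : ∃ c, c ε a ∧ sub x (Vf c) ∧ sub y (Vf c) := by
  rw [mem_Vf ha.1] at hx hy
  obtain ⟨c, hc, hx⟩ := hx
  obtain ⟨d, hd, hy⟩ := hy
  have oc := ha.1.mem hc
  have od := ha.1.mem hd
  have h := le_max oc od
  refine ⟨bu c d, ?_, fun z hz => Vf_le oc (on_max oc od) h.1 _ (hx z hz), fun z hz => Vf_le od (on_max oc od) h.2 _ (hy z hz)⟩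
  rcases oc.tri od with h1 | h1 | h1
  · rwa [show bu c d = d from eqx fun z => by rw [mem_bu]; exact ⟨fun h => h.elim (fun h => od.1 _ h1 _ h) id, .inr⟩]
  · subst h1; rwa [show bu c c = c from eqx fun z => by rw [mem_bu]; exact ⟨fun h => h.elim id id, .inr⟩]
  · rwa [show bu c d = c from eqx fun z => by rw [mem_bu]; exact ⟨fun h => h.elim id (fun h => oc.1 _ h1 _ h), .inl⟩]
theorem Vf_cp {a x y : M} (ha : Lim a) (hx : x ε Vf a) (hy : y ε Vf a) : cp x y ε Vf a := by
  obtain ⟨c, hc, hx, hy⟩ := Vf_two ha hx hy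
  have oc := ha.1.mem hc
  refine (mem_Vf ha.1).2 ⟨sc (sc (sc c)), ha.2.2 _ (ha.2.2 _ (ha.2.2 _ hc)), fun z hz => ?_⟩
  obtain ⟨p, q, hp, hq, rfl⟩ := mem_cp.1 hz
  rw [Vf_sc oc.sc.sc, mem_pw]
  exact Vf_kp oc (tr_Vf oc _ (hx p hp)) (tr_Vf oc _ (hy q hq))
theorem gd_Vf {a : M} (ha : Lim a) : Gd (Vf a) where
  t := tr_Vf ha.1
  k x y hx hy := by
    obtain ⟨c, hc, hx, hy⟩ := Vf_two ha hx hy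
    exact (mem_Vf ha.1).2 ⟨sc (sc c), ha.2.2 _ (ha.2.2 _ hc), Vf_kp (ha.1.mem hc) hx hy⟩
  s x y hx hy := by
    obtain ⟨c, hc, hx⟩ := (mem_Vf ha.1).1 hx
    exact (mem_Vf ha.1).2 ⟨c, hc, fun z hz => hx z (hy z hz)⟩
  e := by
    have h0 : (emp : M) ε a := emp_lim ha
    refine (mem_Vf ha.1).2 ⟨sc emp, ha.2.2 _ h0, fun z hz => ?_⟩
    rw [mem_sg] at hz; subst hz
    rw [Vf_sc on_emp, mem_pw]; exact fun z hz => (mem_emp.1 hz).elim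
theorem Vf_on {a : M} (ha : On a) : sub a (Vf a) := by
  refine oind (fun a => sub a (Vf a)) (fun a ha ih z hz => ?_) ha
  exact (mem_Vf ha).2 ⟨z, hz, ih z hz⟩
theorem on_Vf {a x : M} (ha : On a) : On x → x ε Vf a → x ε a := by
  refine oind (fun a => ∀ x, On x → x ε Vf a → x ε a) (fun a ha ih x hx h => ?_) ha x
  obtain ⟨c, hc, h⟩ := (mem_Vf ha).1 h
  by_contra hn
  have := (nlt hx ha).1 hn
  have hcx : c ε x := lt_of_lt_of_le' hx hc this
  exact nmem_self (ih c hc c (ha.mem hc) (h c hcx))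
theorem LL_pw (x : LL v) (h : ∀ z, sub z x.1 → IL v z) : (pw x).1 = pw x.1 :=
  (LL_tri v).eq (fun z => by rw [mem_pw, mem_pw]; exact (LL_tri v).sub) (fun z hz => ⟨⟨z, h z (mem_pw.1 hz)⟩, rfl⟩)
theorem LL_W {m : ℕ} (x : LL v) (h : ∀ z, z ε W m x.1 → IL v z) (hx : Gd x.1) : (W m x).1 = W m x.1 := by
  induction m with
  | zero => rfl
  | succ m ih =>
    have ih := ih fun z hz => h z (hx.up z hz)
    show (pw (W m x)).1 = pw (W m x.1)
    rw [LL_pw _ (fun z hz => h z (by rw [ih] at hz; exact mem_pw.2 hz)), ih]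
theorem LL_img (x : LL v) {F : LL v → LL v} {F' : M → M} [F1 Tp F] [F1 Tp F'] (h : ∀ x, (F x).1 = F' x.1) : (img x F).1 = img x.1 F' := by
  have T := LL_tri v
  refine T.eq (fun z => ?_) (fun z hz => ?_)
  · rw [mem_img, mem_img]; constructor
    · rintro ⟨y, hy, e⟩; exact ⟨⟨y, x.2.tr hy⟩, hy, Subtype.ext (by rw [h]; exact e)⟩
    · rintro ⟨y, hy, rfl⟩; exact ⟨y.1, hy, h y⟩
  · obtain ⟨y, hy, rfl⟩ := mem_img.1 hz
    exact ⟨F ⟨y, x.2.tr hy⟩, by rw [h]⟩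
theorem LL_pm {m : ℕ} (x y : LL v) : (pm m x y).1 = pm m x.1 y.1 := by
  have T := LL_tri v
  induction m generalizing x y with
  | zero => exact T.kp x y
  | succ m ih =>
    unfold pm
    rw [T.bu, LL_img x (F' := pm m emp) (fun z => by rw [ih, T.emp]), LL_img y (F' := pm m (sg emp)) (fun z => by rw [ih, T.sg, T.emp])]
theorem LL_Vf (a : LL v) (ha : On a) (h : ∀ z, z ε Vf a.1 → IL v z) : (Vf a).1 = Vf a.1 := by
  have T := LL_tri v
  have ha' : On a.1 := T.on.2 ha
  let g := (gr (sc a) Vf).1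
  have hg : ∀ m : LL v, m ε sc a → ap g m.1 = (Vf m).1 := fun m hm => by
    rw [← T.ap, ap_gr hm]
  clear_value g
  have key : ∀ m, On m → m ε (sc a).1 → ap g m = Vf m := fun m hm => by
    refine oind (fun m => m ε (sc a).1 → ap g m = Vf m) (fun m hm ih hma => ?_) hm
    have oa : On (sc a).1 := T.on.2 ha.sc
    let m' : LL v := ⟨m, (sc a).2.tr hma⟩
    have om' : On m' := T.on.1 hm
    rw [show m = m'.1 from rfl, hg m' hma]
    have hle : le m a.1 := by rw [T.sc] at hma; exact mem_sc_le.1 hma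
    refine T.eq (fun z => ?_) (fun z hz => ⟨⟨z, h z (Vf_le hm ha' hle z hz)⟩, rfl⟩)
    rw [mem_Vf om', mem_Vf hm]
    constructor
    · rintro ⟨c, hc, hs⟩
      have hc' := oa.1 _ hma _ hc
      refine ⟨⟨c, m'.2.tr hc⟩, hc, T.sub.1 ?_⟩
      rw [← ih c hc hc', ← show ap g c = _ from hg ⟨c, m'.2.tr hc⟩ hc'] at *
      exact hs
    · rintro ⟨c, hc, hs⟩
      have hc' : c.1 ε (sc a).1 := oa.1 _ hma _ hc
      refine ⟨c.1, hc, ?_⟩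
      rw [← ih c.1 hc hc', hg c hc']
      exact T.sub.2 hs
  rw [← hg a (by simp), key a.1 ha' (show a ε sc a by simp)]
theorem LL_gd (x : LL v) (h : Gd x.1) : Gd x := by
  have T := LL_tri v
  exact ⟨T.tr.1 h.t, fun p q hp hq => (T.e _ _).1 (by rw [T.kp]; exact h.k _ _ hp hq), fun p q hp hs => h.s _ _ hp (T.sub.2 hs),
    (T.e _ _).1 (by rw [T.sg, T.emp]; exact h.e)⟩
theorem rel_in {m : ℕ} (hw : Gd w) {r : M} (hr : sub r (cp (W m w) (W m w))) : IL (W (m+1) w) r := by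
  have T := LL_tri (W (m+1) w)
  have hI : ∀ z, z ε W (m+1) w → IL (W (m+1) w) z := fun z hz => IL.bs.tr hz
  let w' : LL (W (m+1) w) := ⟨w, by
    have h0 : ∀ k : ℕ, w ε W (k+1) w := fun k => by
      induction k with
      | zero => exact mem_pw.2 fun _ h => h
      | succ k ih => exact hw.up _ ih
    exact hI _ (h0 m)⟩
  obtain ⟨c, hc⟩ : ∃ c, ∀ z, z ε c ↔ z ε W m w ∧ ∃ x y, z = pm m x y ∧ kp x y ε r := sepx (fun z => ∃ x y, z = pm m x y ∧ kp x y ε r) (W m w)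
  have hcI := hI c (mem_pw.2 fun z hz => ((hc z).1 hz).1)
  let c' : LL (W (m+1) w) := ⟨c, hcI⟩
  have hu : (W m w').1 = W m w := LL_W w' (fun z hz => hI z (hw.up z hz)) hw
  obtain ⟨g', key'⟩ : ∃ g' : LL (W (m+1) w), ∀ z, z ε g' ↔ ∃ x y, x ε W m w' ∧ y ε W m w' ∧ z = kp x y ∧ pm m x y ε c' :=
    ⟨sep (cp (W m w') (W m w')) (fun z => pm m (fst z) (snd z) ε c'), fun z => by
      rw [mem_sep, mem_cp]; constructor
      · rintro ⟨⟨x, y, hx, hy, rfl⟩, h⟩; exact ⟨x, y, hx, hy, rfl, by simpa using h⟩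
      · rintro ⟨x, y, hx, hy, rfl, h⟩; exact ⟨⟨x, y, hx, hy, rfl⟩, by simpa using h⟩⟩
  have : r = g'.1 := by
    symm
    refine T.eq (fun z => ?_) (fun z hz => ?_)
    · rw [key']; constructor
      · intro hz
        obtain ⟨x, y, hx, hy, e⟩ := mem_cp.1 (hr _ hz)
        have hx' := hI _ (hw.up _ hx)
        have hy' := hI _ (hw.up _ hy)
        refine ⟨⟨x, hx'⟩, ⟨y, hy'⟩, (T.e _ _).1 (by rw [hu]; exact hx), (T.e _ _).1 (by rw [hu]; exact hy), Subtype.ext (by rw [T.kp]; exact e), (T.e _ _).1 ?_⟩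
        rw [LL_pm]; exact (hc _).2 ⟨hw.pm hx hy, x, y, rfl, e ▸ hz⟩
      · rintro ⟨x, y, hx, hy, rfl, h⟩
        have h1 := (T.e _ _).2 h
        rw [LL_pm] at h1
        obtain ⟨-, x1, y1, e, h2⟩ := (hc _).1 h1
        rw [pm_eq] at e
        rw [← e.1, ← e.2] at h2
        rw [T.kp]; exact h2
    · obtain ⟨x, y, hx, hy, rfl⟩ := mem_cp.1 (hr _ hz)
      exact ⟨kp ⟨x, hI _ (hw.up _ hx)⟩ ⟨y, hI _ (hw.up _ hy)⟩, by rw [T.kp]⟩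
  rw [this]; exact g'.2
end
noncomputable section
variable [ZM M] {v w : M} {j : M → M} {n : ℕ} {a k : M}
theorem emb_ff (h : Emb v v j) {m : ℕ} {t : (Fin m → LL v) → LL v} (d : DfF Bt t) (x : Fin m → LL v) :
    j (t x).1 = (t (fun i => h.t (x i))).1 := congrArg Subtype.val ((emb_elm h).ff rfl d x)
theorem j_emp (h : Emb v v j) : j emp = emp := by
  have := emb_ff h (t := fun _ : Fin 0 → LL v => emp) inferInstance ![]
  rwa [(LL_tri v).emp] at this
theorem j_om (h : Emb v v j) : j om = om := by
  have := emb_ff h (t := fun _ : Fin 0 → LL v => om) inferInstance ![]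
  rwa [(LL_tri v).om] at this
theorem j_sc (h : Emb v v j) {x : M} (hx : IL v x) : j (sc x) = sc (j x) := by
  have := congrArg Subtype.val ((emb_elm h).f1 rfl sc ⟨x, hx⟩)
  rw [(LL_tri v).sc, show (h.t (sc ⟨x, hx⟩)).1 = j (sc (⟨x, hx⟩ : LL v)).1 from rfl, (LL_tri v).sc] at this
  exact this
theorem j_un (h : Emb v v j) {x : M} (hx : IL v x) : j (un x) = un (j x) := h.gop 5 hx hx
theorem j_scn (h : Emb v v j) {x : M} (hx : On x) : ∀ m : ℕ, j (scn m x) = scn m (j x)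
  | 0 => rfl
  | m+1 => by rw [scn_s, scn_s, j_sc h (IL.on (scn_on hx m)), j_scn h hx m]
theorem lim_scn (hk : Lim k) : ∀ m : ℕ, k ε scn m a → k ε a ∨ (k = a ∧ 0 < m)
  | 0, h => .inl h
  | m+1, h => by
    rw [scn_s, mem_sc] at h
    rcases h with h | h
    · exact (lim_scn hk m h).imp id fun h => ⟨h.1, by omega⟩
    · cases m with
      | zero => exact .inr ⟨h, by omega⟩
      | succ m =>
        rw [scn_s] at h
        have h1 : scn m a ε k := by rw [h]; simp
        have := hk.2.2 _ h1
        rw [← h] at this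
        exact (nmem_self this).elim
structure Cx (j : M → M) (n : ℕ) (a k v : M) : Prop where
  d : F1 Tp j
  ha : a = emp ∨ Lim a
  hv : v = Vf (scn (2*n+1) a)
  h : Emb v v j
  ko : On k
  kl : k ε scn (2*n) a
  km : j k ≠ k
  kf : ∀ x, x ε k → j x = x
namespace Cx
theorem kL (X : Cx j n a k v) : Lim k := by
  rcases ocase X.ko with e | ⟨b, hb, ob, e⟩ | h
  · exact (X.km (by rw [e]; exact j_emp X.h)).elim
  · exact (X.km (by rw [e, j_sc X.h (IL.on ob), X.kf b hb])).elim
  · exact h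
theorem omk (X : Cx j n a k v) : om ε k := by
  have h := om_spec (M := M)
  rcases h.1.1.tri X.ko with h1 | h1 | h1
  · exact h1
  · exact (X.km (by rw [← h1]; exact j_om X.h)).elim
  · exact (h.2 _ h1 X.kL).elim
theorem ka (X : Cx j n a k v) : k ε a ∨ (k = a ∧ 0 < n) := (lim_scn X.kL _ X.kl).imp id fun h => ⟨h.1, by omega⟩
theorem aL (X : Cx j n a k v) : Lim a := by
  rcases X.ha with e | h
  · rcases X.ka with h1 | h1
    · rw [e] at h1; exact (mem_emp.1 h1).elim
    · rw [← h1.1]; exact X.kL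
  · exact h
theorem gd (X : Cx j n a k v) : Gd (Vf a) := gd_Vf X.aL
theorem vW (X : Cx j n a k v) : v = W (2*n+1) (Vf a) := by rw [X.hv, Vf_scn X.aL.1]
theorem kj (X : Cx j n a k v) : k ε j k := by
  have := X.d
  rcases X.h.ge X.ko with h | h
  · exact h
  · exact (X.km h.symm).elim
theorem il (X : Cx j n a k v) {z : M} (h : z ε W (2*n+1) (Vf a)) : IL v z := by rw [← X.vW] at h; exact IL.bs.tr h
theorem ilu (X : Cx j n a k v) {z : M} (h : sub z (W (2*n) (Vf a))) : IL v z := X.il (mem_pw.2 h)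
theorem ilr (X : Cx j n a k v) {r : M} (h : sub r (cp (W (2*n) (Vf a)) (W (2*n) (Vf a)))) : IL v r := by
  rw [X.vW]; exact rel_in X.gd h
theorem lu (X : Cx j n a k v) : sub (scn (2*n) a) (W (2*n) (Vf a)) := by
  rw [← Vf_scn X.aL.1]; exact Vf_on (scn_on X.aL.1 _)
theorem ku (X : Cx j n a k v) : sub k (W (2*n) (Vf a)) := fun x hx => X.lu _ ((scn_on X.aL.1 _).1 _ X.kl _ hx)
theorem nu (X : Cx j n a k v) : ∃ ν, ν ε k ∧ Lim ν ∧ ¬ Cof om ν := by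
  have T := LL_tri v
  let k' : LL v := ⟨k, IL.on X.ko⟩
  have h1 : ¬ Cof om k' := by
    rintro ⟨r, hr⟩
    have hj := ((emb_elm X.h).d3 rfl Cfr _ _ _).1 hr
    have e : X.h.t om = om := Subtype.ext (by rw [T.om]; show j (om : LL v).1 = om; rw [T.om, j_om X.h])
    rw [e] at hj
    obtain ⟨z, hz, hn⟩ := hj.2.1 k' X.kj
    obtain ⟨x, hx, hp⟩ := hr.1 z hz
    have hzk : z.1 ε k := X.ko.1 _ X.omk _ (by rw [← T.om]; exact hz)
    have hp' := (emb_elm X.h).mem.2 hp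
    rw [(emb_elm X.h).f2 rfl kp, show X.h.t z = z from Subtype.ext (X.kf _ hzk), show X.h.t x = x from Subtype.ext (X.kf _ hx)] at hp'
    exact hn (hj.2.2 z z x k' hz X.kj hp' (.inr rfl) (.inl hx))
  let R (x : LL v) : Prop := ∃ y, y ε x ∧ Lim y ∧ ¬ Cof om y
  have dR : D1 Bt R := by unfold R; infer_instance
  obtain ⟨y, hy, hl, hc⟩ := ((emb_elm X.h).d1 rfl R k').2 ⟨k', X.kj, T.lim.1 X.kL, h1⟩
  refine ⟨y.1, hy, T.lim.2 hl, fun h => hc ?_⟩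
  obtain ⟨r, hs, h1, h2, h3⟩ := h.int om_spec.1.1 (X.ko.mem hy)
  have hr : IL v r := X.ilr fun z hz => by
    obtain ⟨p, q, hp, hq, rfl⟩ := mem_cp.1 (hs z hz)
    exact mem_cp.2 ⟨p, q, X.ku _ (X.ko.1 _ X.omk _ hp), X.ku _ (X.ko.1 _ hy _ hq), rfl⟩
  have eo : ∀ z : LL v, z ε om ↔ z.1 ε om := fun z => by rw [← T.om]; exact Iff.rfl
  have el : ∀ x y : LL v, le x y → le x.1 y.1 := fun x y h => h.imp id (congrArg Subtype.val)
  refine ⟨⟨r, hr⟩, fun z hz => ?_, fun x hx => ?_, fun z z' x x' hz hx' hk l1 l2 => ?_⟩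
  · obtain ⟨x, hx, hk⟩ := h1 z.1 ((eo z).1 hz)
    exact ⟨⟨x, y.2.tr hx⟩, hx, (T.e _ _).1 (by rw [T.kp]; exact hk)⟩
  · obtain ⟨z, hz, hk⟩ := h2 x.1 hx
    exact ⟨⟨z, IL.on (om_spec.1.1.mem hz)⟩, (eo _).2 hz, fun hh => hk (by have := (T.e _ _).2 hh; rwa [T.kp] at this)⟩
  · refine (T.e _ _).1 ?_
    have := (T.e _ _).2 hk
    rw [T.kp] at this ⊢
    exact h3 _ _ _ _ ((eo z).1 hz) hx' this (el _ _ l1) (el _ _ l2)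
theorem hn (X : Cx j n a k v) : ∀ d, On d → ∃ n', Lim n' ∧ ¬ Cof d n' ∧ j n' = n' ∧ (∀ x, x ε n' → j x = x) ∧ ∀ r, sub r (cp (W (2*n) (Vf a)) n') → IL v r := by
  intro d hd
  have key : ∀ y, y ε k → Lim y → ¬ Cof d y → _ := fun y hy hl hc => (⟨y, hl, hc, X.kf y hy, fun x hx => X.kf x (X.ko.1 _ hy _ hx), fun r hr => X.ilr fun z hz => by
    obtain ⟨p, q, hp, hq, rfl⟩ := mem_cp.1 (hr z hz)
    exact mem_cp.2 ⟨p, q, hp, X.ku _ (X.ko.1 _ hy _ hq), rfl⟩⟩ : ∃ n', Lim n' ∧ ¬ Cof d n' ∧ j n' = n' ∧ (∀ x, x ε n' → j x = x) ∧ ∀ r, sub r (cp (W (2*n) (Vf a)) n') → IL v r)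
  by_cases h : Cof d om
  · obtain ⟨y, hy, hl, hc⟩ := X.nu
    exact key y hy hl fun h' => hc (h.tr hd om_spec.1.1 hl.1 h')
  · exact key om X.omk om_spec.1 h
theorem jVf (X : Cx j n a k v) {c : M} (hc : On c) (h1 : le c (scn (2*n+1) a)) (h2 : le (j c) (scn (2*n+1) a)) : j (Vf c) = Vf (j c) := by
  have T := LL_tri v
  have hl := scn_on X.aL.1 (2*n+1)
  let c' : LL v := ⟨c, IL.on hc⟩
  have e1 : (Vf c').1 = Vf c := LL_Vf c' (T.on.1 hc) fun z hz => by
    have := Vf_le hc hl h1 z hz; rw [← X.hv] at this; exact IL.bs.tr this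
  have oj := X.h.on hc
  have e2 : (Vf (X.h.t c')).1 = Vf (j c) := LL_Vf (X.h.t c') (T.on.1 oj) fun z hz => by
    have := Vf_le oj hl h2 z hz; rw [← X.hv] at this; exact IL.bs.tr this
  have := congrArg Subtype.val ((emb_elm X.h).f1 rfl Vf c')
  rw [e2] at this
  rw [← this, ← e1]; rfl
end Cx
end
noncomputable section
variable [ZM M] {v w : M} {j : M → M} {n : ℕ} {a k : M}
def pq : Bool → ℕ → M → M → M
  | true, m => pm m
  | false, m => fun x y => pm m y x
def pg (i : Bool) (m : ℕ) (u : M) : M := sep (cp u u) (fun z => ∃ y, y ε u ∧ fst z = pq i m (snd z) y)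
def cd (m : ℕ) (u X : M) : M := sep u (fun z => ∃ x y, z = pm m x y ∧ kp x y ε X)
open Classical in
def A2 (n : ℕ) (v' w' c' x : M) : M := if x = v' then v' else Kf n w' c' x
end
section
variable [ZM M]
instance pq.f {S} (i : Bool) (m : ℕ) : F2 S (pq i m : M → M → M) := by
  cases i
  · show F2 S (fun x y : M => pm m y x); infer_instance
  · show F2 S (pm m : M → M → M); infer_instance
instance pg.f {S} (i : Bool) (m : ℕ) : F1 S (pg i m : M → M) := by unfold pg; infer_instance
instance cd.f {S} (m : ℕ) : F2 S (cd m : M → M → M) := by unfold cd; infer_instance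
instance A2.f (n : ℕ) (v' w' c' : M) : F1 Tp (A2 n v' w' c') := by unfold A2; infer_instance
end
noncomputable section
variable [ZM M] {v w : M} {j : M → M} {n : ℕ} {a k : M}
theorem mem_cd {m : ℕ} {u X x y : M} : pm m x y ε cd m u X ↔ pm m x y ε u ∧ kp x y ε X := by
  rw [cd, mem_sep]
  refine and_congr_right fun _ => ⟨?_, fun h => ⟨x, y, rfl, h⟩⟩
  rintro ⟨x', y', e, h⟩
  rw [pm_eq] at e; rwa [e.1, e.2]
theorem mem_pg {i : Bool} {m : ℕ} {u z : M} : z ε pg i m u ↔ ∃ p x y, p ε u ∧ x ε u ∧ y ε u ∧ p = pq i m x y ∧ z = kp p x := by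
  rw [pg, mem_sep, mem_cp]
  constructor
  · rintro ⟨⟨p, x, hp, hx, rfl⟩, y, hy, e⟩
    rw [fst_kp, snd_kp] at e; exact ⟨p, x, y, hp, hx, hy, e, rfl⟩
  · rintro ⟨p, x, y, hp, hx, hy, e, rfl⟩
    exact ⟨⟨p, x, hp, hx, rfl⟩, y, hy, by rw [fst_kp, snd_kp]; exact e⟩
theorem pq_eq {i : Bool} {m : ℕ} {x y x' y' : M} (h : pq i m x y = pq i m x' y') : x = x' := by
  cases i <;> (simp only [pq] at h; rw [pm_eq] at h; tauto)
theorem ap_pg {i : Bool} {m : ℕ} {u x y : M} (hx : x ε u) (hy : y ε u) (hp : pq i m x y ε u) : ap (pg i m u) (pq i m x y) = x :=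
  ap_eq (mem_pg.2 ⟨_, x, y, hp, hx, hy, rfl, rfl⟩) fun z hz => by
    obtain ⟨p, x', y', -, -, -, e, e'⟩ := mem_pg.1 hz
    rw [kp_eq] at e'
    rw [e'.2]; exact (pq_eq (e'.1.trans e)).symm
theorem LL_pq {i : Bool} {m : ℕ} (x y : LL v) : (pq i m x y).1 = pq i m x.1 y.1 := by
  cases i <;> exact LL_pm _ _
theorem LL_pg {i : Bool} {m : ℕ} (u : LL v) : (pg i m u).1 = pg i m u.1 := by
  have T := LL_tri v
  refine T.eq (fun z => ?_) (fun z hz => ?_)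
  · rw [mem_pg, mem_pg]; constructor
    · rintro ⟨p, x, y, hp, hx, hy, e, e'⟩
      exact ⟨⟨p, u.2.tr hp⟩, ⟨x, u.2.tr hx⟩, ⟨y, u.2.tr hy⟩, hp, hx, hy, Subtype.ext (by rw [LL_pq]; exact e), Subtype.ext (by rw [T.kp]; exact e')⟩
    · rintro ⟨p, x, y, hp, hx, hy, e, rfl⟩
      exact ⟨p.1, x.1, y.1, hp, hx, hy, by rw [e, LL_pq], T.kp _ _⟩
  · obtain ⟨p, x, y, hp, hx, hy, e, rfl⟩ := mem_pg.1 hz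
    exact ⟨kp ⟨p, u.2.tr hp⟩ ⟨x, u.2.tr hx⟩, by rw [T.kp]⟩
namespace Cx
theorem jW (X : Cx j n a k v) (hj : j v = v) : ∀ d i : ℕ, i + d = 2*n+1 → j (W i (Vf a)) = W i (Vf a)
  | 0, i, e => by
    have : i = 2*n+1 := by omega
    subst this
    rw [← X.vW, hj]
  | d+1, i, e => by
    have ih := jW X hj d (i+1) (by omega)
    have h1 : un (W (i+1) (Vf a)) = W i (Vf a) := un_pw _
    rw [← h1, j_un X.h, ih]
    have h0 : ∀ d i : ℕ, i + d = 2*n+1 → IL v (W i (Vf a)) := fun d => by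
      induction d with
      | zero => intro i e; have : i = 2*n+1 := by omega
                subst this; rw [← X.vW]; exact IL.bs
      | succ d ih => intro i e; exact (ih (i+1) (by omega)).tr (mem_pw.2 fun _ h => h)
    exact h0 d (i+1) (by omega)
theorem main (X : Cx j n a k v) (hj : j v = v) {A : M} (hA : A ε v) : ∃ e, F1 Tp e ∧ Emb A A e ∧ (∃ c, On c ∧ e c ≠ c) ∧
    ∀ b, On b → le b (scn (2*n) a) → e b = b := by
  have dj := X.d
  have T := LL_tri v
  have gd := X.gd
  obtain ⟨w, hw⟩ : ∃ w, w = Vf a := ⟨_, rfl⟩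
  obtain ⟨u, hu⟩ : ∃ u, u = W (2*n) w := ⟨_, rfl⟩
  have jw : j w = w := by rw [hw]; exact X.jW hj (2*n+1) 0 (by omega)
  have ju : j u = u := by rw [hu, hw]; exact X.jW hj 1 (2*n) (by omega)
  have vu : v = pw u := by rw [hu, hw]; exact X.vW
  have il : ∀ {z}, z ε v → IL v z := fun hz => IL.bs.tr hz
  have uv : u ε v := by rw [vu]; exact mem_pw.2 fun _ h => h
  have tu : Tr u := by rw [hu, hw]; exact gd.tr _
  have upm : ∀ {x y}, x ε u → y ε u → pm (2*n) x y ε u := fun hx hy => by rw [hu, hw] at *; exact gd.pm hx hy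
  have e1 : sg emp ε u := by rw [hu, hw]; exact gd.e1 _
  have upq : ∀ i {x y}, x ε u → y ε u → pq i (2*n) x y ε u := fun i x y hx hy => by
    cases i
    · exact upm hy hx
    · exact upm hx hy
  have ilu := il uv
  have ilA := il hA
  obtain ⟨b, hb⟩ : ∃ b, b = kp u A := ⟨_, rfl⟩
  have ilb : IL v b := by rw [hb]; exact ilu.kp ilA
  obtain ⟨bu', bA⟩ : IL b u ∧ IL b A := kpl (by rw [← hb]; exact IL.bs)
  have jb : j b = kp u (j A) := by rw [hb, X.h.kp ilu ilA, ju]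
  have sA : sub (j A) u := by
    have := (X.h.mem ilA IL.bs).2 hA
    rw [hj, vu] at this; exact mem_pw.1 this
  have hr := X.h.res ilb
  have hD : sub u (j u) := fun z hz => by rw [ju]; exact hz
  have pb : ∀ i, IL b (pg i (2*n) u) := fun i => by
    have := (pg i (2*n) (⟨u, bu'⟩ : LL b)).2
    rwa [LL_pg] at this
  have jp : ∀ i, j (pg i (2*n) u) = pg i (2*n) u := fun i => by
    have := congrArg Subtype.val ((emb_elm X.h).f1 rfl (pg i (2*n)) ⟨u, ilu⟩)
    rw [LL_pg, show (X.h.t (pg i (2*n) ⟨u, ilu⟩)).1 = j (pg i (2*n) (⟨u, ilu⟩ : LL v)).1 from rfl, LL_pg] at this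
    rw [show (X.h.t ⟨u, ilu⟩).1 = j u from rfl, ju] at this
    exact this
  have hS : Seed b j u := ⟨⟨_, e1⟩, fun x x' hx hx' => ⟨pm (2*n) x x', _, _, upm hx hx', pb true, pb false, by
    rw [jp]; exact (ap_pg hx hx' (upq true hx hx')).symm, by rw [jp]; exact (ap_pg (i := false) hx' hx (upq false hx' hx)).symm⟩⟩
  have hjx : ∀ {x}, IL b x → hul b j u (j x) := fun hx => emb_cn (a := sg emp) hr bu' hD e1 hx
  have hux : ∀ {x}, x ε u → hul b j u x := fun {x} hx => ⟨_, pm (2*n) x x, pb true, upm hx hx, by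
    rw [jp]; exact (ap_pg hx hx (upq true hx hx)).symm⟩
  have hz : ∀ x, x ε L0 (j b) → hul b j u x := fun x hx => by
    rw [L0, mem_bu, mem_sg] at hx
    rcases hx with hx | rfl
    · have hx := trc_least (t := bu u (bu (pr (sg u) (pr u (j A))) (pr u (j A)))) (fun z hz => by
        rw [jb] at hz; rw [mem_bu, mem_bu]; exact .inr (.inl hz)) (fun y hy z hz => by
        simp only [mem_bu, mem_pr] at hy ⊢
        rcases hy with hy | (rfl | rfl) | (rfl | rfl)
        · exact .inl (tu _ hy _ hz)
        · rw [mem_sg] at hz; tauto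
        · rw [mem_pr] at hz; tauto
        · exact .inl hz
        · exact .inl (sA _ hz)) x hx
      simp only [mem_bu, mem_pr] at hx
      rcases hx with hx | (hx | hx) | (hx | hx)
      · exact hux hx
      · have : x = j (pr u u) := by rw [hx, show j (pr u u) = pr (j u) (j u) from X.h.gop 0 ilu ilu, ju]; rfl
        rw [this]; exact hjx (bu'.gop 0 bu')
      · have : x = j (pr u A) := by rw [hx, show j (pr u A) = pr (j u) (j A) from X.h.gop 0 ilu ilA, ju]
        rw [this]; exact hjx (bu'.gop 0 bA)
      · have h5 := hjx bu'
        rw [ju] at h5; rw [hx]; exact h5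
      · rw [hx]; exact hjx bA
    · exact hjx IL.bs
  have mL : ∀ y z, y ε pr u z → y ε L0 (kp u z) := fun y z hy =>
    tr_L0 _ _ (tr_L0 _ _ (mem_L0 _) (pr u z) (by simp [kp])) _ hy
  have hD0 : sub u (L0 (j b)) := fun z hz => by
    rw [jb]; exact tr_L0 _ _ (mL u _ (by simp)) _ hz
  by_cases hm : ∃ a0, On a0 ∧ unc (hul b j u) a0 ≠ a0
  · obtain ⟨a0, h0, hm⟩ := hm
    obtain ⟨e, de, he, hf, hc⟩ := mainA X.h ilb bu' hD hS hz hD0 (by rw [hu, hw]; exact X.hn) h0 hm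
    have h1 := he.res bA
    have eA : e A = A := hf A (by rw [hb]; exact mL _ _ (by simp))
    have eu : e u = u := hf u (by rw [hb]; exact mL _ _ (by simp))
    have ux : ∀ z, z ε u → e z = z := fun z hz => hf z (by rw [hb]; exact tr_L0 _ _ (mL u _ (by simp)) _ hz)
    rw [eA] at h1
    have ol := scn_on X.aL.1 (2*n)
    have lu : sub (scn (2*n) a) u := by rw [hu, hw]; exact X.lu
    refine ⟨e, de, h1, hc, fun c hc hl => ?_⟩
    rcases hl with hl | rfl
    · exact ux c (lu c hl)
    · rcases he.ge ol with h2 | h2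
      · have h3 := ((emb_elm he).d2 rfl sub ⟨_, IL.on ol⟩ ⟨u, bu'⟩).1 ((LL_tri b).sub.1 lu)
        have h4 := (LL_tri b).sub.2 h3 _ h2
        have h4 : scn (2*n) a ε u := eu ▸ h4
        rw [hu, hw, ← Vf_scn X.aL.1] at h4
        exact (nmem_self (on_Vf ol ol h4)).elim
      · exact h2.symm
  · push Not at hm
    exfalso
    obtain ⟨f1, f2, f3, f4, f5⟩ := emb_fact hr bu' hD hS hz
    have hcol : ∀ c, On c → col (hul b j u) (j c) = j c := fun c hc => by
      have := f5 c (IL.on hc)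
      rwa [hm _ (f3.on hc)] at this
    let w' : LL v := ⟨w, by rw [← jw]; exact X.h.mp _ (X.il (by
      have h0 : ∀ k : ℕ, w ε W (k+1) (Vf a) := fun k => by
        rw [← hw]
        induction k with
        | zero => exact mem_pw.2 fun _ h => h
        | succ k ih => exact (hw ▸ gd : Gd w).up _ ih
      exact h0 _))⟩
    let u' : LL v := ⟨u, ilu⟩
    let v' : LL v := ⟨v, IL.bs⟩
    have gw : Gd w := by rw [hw]; exact gd
    have vW : v = W (2*n+1) w := by rw [hw]; exact X.vW
    have hWu : W (2*n) w' = u' := Subtype.ext (by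
      rw [LL_W w' (fun z hz => il (by rw [vW]; exact gw.up z hz)) gw]; exact hu.symm)
    have hWv : W (2*n+1) w' = v' := Subtype.ext (by
      rw [LL_W w' (fun z hz => il (by rw [vW]; exact hz)) gw]; exact vW.symm)
    have tw : X.h.t w' = w' := Subtype.ext jw
    have tu' : X.h.t u' = u' := Subtype.ext ju
    obtain ⟨c, hc⟩ : ∃ c, ∀ z, z ε c ↔ ∃ x, x ε u ∧ z = pm (2*n) x (j x) := ⟨img u (fun x => pm (2*n) x (j x)), fun z => mem_img⟩
    have juu : ∀ x, x ε u → j x ε u := fun x hx => by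
      have := (X.h.mem (ilu.tr hx) ilu).2 hx; rwa [ju] at this
    have inv : ∀ {z}, sub z u → z ε v := fun {z} hz => by rw [vu]; exact mem_pw.2 hz
    have hcv : c ε v := by
      rw [vu]; refine mem_pw.2 fun z hz => ?_
      obtain ⟨x, hx, rfl⟩ := (hc z).1 hz
      exact upm hx (juu x hx)
    let c' : LL v := ⟨c, il hcv⟩
    have hK : ∀ Y : LL v, Y ε v' → Kf n w' c' Y = X.h.t Y := fun Y hY => by
      refine even (emb_elm X.h) rfl (LL_gd w' gw) tw (fun y hy => ?_) n c' (fun e => ?_) Y (by rw [hWv]; exact hY)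
      · have hy' : y.1 ε Vf a := hw ▸ hy
        obtain ⟨d, hd, hs⟩ := (mem_Vf X.aL.1).1 hy'
        have hd1 := X.aL.2.2 d hd
        have od := X.aL.1.mem hd1
        have hla : ∀ m : ℕ, le a (scn m a) := fun m => by
          induction m with
          | zero => exact .inr rfl
          | succ m ih => rw [scn_s]; exact .inl (mem_sc_le.2 ih)
        have hle : ∀ x, x ε a → le x (scn (2*n+1) a) := fun x hx => .inl (lt_of_lt_of_le' (scn_on X.aL.1 _) hx (hla _))
        have iw : IL v w := w'.2
        have hdw : ∀ x, x ε a → x ε w := fun x hx => by rw [hw]; exact Vf_on X.aL.1 x hx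
        have h1 : j (sc d) ε w := by
          have := (X.h.mem (IL.on od) iw).2 (hdw _ hd1); rwa [jw] at this
        have h2 : j (sc d) ε a := on_Vf X.aL.1 (X.h.on od) (hw ▸ h1)
        have h3 := X.jVf od (hle _ hd1) (hle _ h2)
        have h4 : Vf (sc d) ε w := by
          rw [hw]; exact (mem_Vf X.aL.1).2 ⟨_, hd1, fun _ h => h⟩
        refine ⟨⟨_, iw.tr h4⟩, h4, ?_⟩
        show y.1 ε j (Vf (sc d))
        rw [h3]
        refine Vf_le od (X.h.on od) (X.h.ge od) _ ?_
        rw [Vf_sc (X.aL.1.mem hd)]; exact mem_pw.2 hs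
      · rw [hWu]
        show e.1 ε c ↔ _
        rw [hc]; constructor
        · rintro ⟨x, hx, e'⟩; exact ⟨⟨x, ilu.tr hx⟩, hx, Subtype.ext (by rw [LL_pm]; exact e')⟩
        · rintro ⟨x, hx, rfl⟩; exact ⟨x.1, hx, LL_pm _ _⟩
    let q (Y p r : LL v) : Prop := pm (2*n) p r ε Kf n w' c' (cd (2*n) u' Y)
    have dq : D3 Tp q := by unfold q; infer_instance
    obtain ⟨B, dB, hB⟩ := st7 X.h (b := ⟨b, ilb⟩) (s := u') (D := u') (a0 := ⟨_, ilu.tr e1⟩) (q := q) bu' (fun p hp => by rw [tu']; exact hp) e1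
      (fun Y p r hY hp hr => by
        show pm (2*n) r p ε Kf n w' c' (cd (2*n) u' Y) ↔ _
        rw [hK _ (by
          show (cd (2*n) u' Y).1 ε v
          have hs : sub (cd (2*n) u' Y) u' := fun z hz => (mem_sep.1 hz).1
          exact inv (T.sub.2 hs)), (emb_elm X.h).f2 rfl (cd (2*n)), tu', mem_cd]
        exact and_iff_right ((T.e _ _).1 (by rw [LL_pm]; exact upm hr hp)))
    have hfin := sz9 X.h (by rw [hj]; exact IL.bs) (A := A2 n v' w' c') (B := B) (fun x hx => by
      by_cases hxv : x = v'
      · simp only [A2, hxv, if_true]; exact hj.symm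
      · simp only [A2, hxv, if_false]
        rw [hK]
        · rfl
        · have : x.1 ε bu v (sg v) := by
            rw [L0, mem_bu] at hx
            rw [mem_bu]
            refine hx.imp (fun hx => trc_least (fun _ h => h) ?_ _ hx) id
            rw [vW]; exact gw.tr _
          rw [mem_bu, mem_sg] at this
          rcases this with h | h
          · exact h
          · exact (hxv (Subtype.ext h)).elim) (fun x hx => by rw [hB x hx]; exact hcol _ (T.on.2 hx)) X.ko
    exact X.km hfin
end Cx
end
noncomputable section
variable [ZM M] {v w b : M} {j : M → M} {n : ℕ} {a k : M}
theorem W_up (h : Gd w) (i : ℕ) : ∀ d : ℕ, sub (W i w) (W (i+d) w)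
  | 0 => fun _ h => h
  | d+1 => fun z hz => h.up _ (W_up h i d z hz)
theorem gr_t (h : Emb b b j) (t : LL b → LL b) [F1 Bt t] [F1 Tp t] (s c : LL b) (hc : c.1 ε j s.1) : (t c).1 = ap (j (gr s t).1) c.1 := by
  have := (emb_elm h).f1 rfl (fun s => gr s t) s
  rw [← show (ap (h.t (gr s t)) c).1 = _ from h.apt _ _, this, ap_gr (show c ε h.t s from hc)]
def q0 (t : M) : Prop := ∀ x, IL (Vf t) x
def q1 (t : M) : Prop := Lim t ∧ q0 t
end
section
variable [ZM M]
instance q0.f {S} : D1 S (q0 : M → Prop) := by unfold q0; infer_instance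
instance q1.f {S} : D1 S (q1 : M → Prop) := by unfold q1; infer_instance
end
noncomputable section
variable [ZM M] {v w b : M} {j : M → M} {n : ℕ} {a k : M}
theorem le_scn (ha : On a) (m : ℕ) : le a (scn m a) := by
  induction m with
  | zero => exact .inr rfl
  | succ m ih => rw [scn_s]; exact .inl (mem_sc_le.2 ih)
theorem Cx.tau (X : Cx j n a k v) (hj : j v ≠ v) : ∃ t, t ε a ∧ Lim t ∧ j t = t ∧ ∀ x, IL v x → IL (Vf t) x := by
  have T := LL_tri v
  have ol := scn_on X.aL.1 (2*n+1)
  have oa := X.aL.1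
  have ja : j a ≠ a := fun e => hj (by
    have e1 := j_scn X.h oa (2*n+1)
    rw [e] at e1
    rw [X.hv, X.jVf ol (.inr rfl) (.inr e1), e1])
  have js : ∀ (d m : ℕ), j (scn m a) ≠ scn m a := fun d m => by
    induction m with
    | zero => exact ja
    | succ m ih =>
      intro e
      rw [scn_s, j_sc X.h (IL.on (scn_on oa m))] at e
      refine ih (?_)
      have h1 : j (scn m a) ε sc (scn m a) := by rw [← e]; simp
      have h2 : scn m a ε sc (j (scn m a)) := by rw [e]; simp
      rw [mem_sc] at h1 h2
      rcases h1 with h1 | h1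
      · rcases h2 with h2 | h2
        · exact (nmem2 h1 h2).elim
        · exact h2.symm
      · exact h1
  have LV : ∀ c : LL v, On c → le c.1 (scn (2*n+1) a) → (Vf c).1 = Vf c.1 := fun c hc hl => LL_Vf c hc fun z hz => by
    have := Vf_le (T.on.2 hc) ol hl z hz; rw [← X.hv] at this; exact IL.bs.tr this
  have small : ∀ (t : LL v), On t → X.h.t t = t → ∀ m : ℕ, le t.1 (scn m a) → t.1 ε a := fun t ot ft m => by
    induction m with
    | zero => exact fun hl => hl.elim id fun e => (ja (by
        have : j t.1 = t.1 := congrArg Subtype.val ft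
        rw [e] at this; exact this)).elim
    | succ m ih =>
      rintro (hl | e)
      · rw [scn_s] at hl; exact ih (mem_sc_le.1 hl)
      · exact (js 0 (m+1) (by
          have : j t.1 = t.1 := congrArg Subtype.val ft
          rwa [e] at this)).elim
  let l' : LL v := ⟨_, IL.on ol⟩
  have h0 : On l' ∧ q0 l' := ⟨T.on.1 ol, LL_V _ (by rw [LV l' (T.on.1 ol) (.inr rfl)]; exact X.hv.symm)⟩
  obtain ⟨o0, s0, m0⟩ := lo_spec q0 ⟨l', h0⟩
  have t0 := small _ o0 ((emb_elm X.h).ff rfl (t := fun _ : Fin 0 → LL v => lo q0) inferInstance ![]) (2*n+1)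
    ((m0 _ h0.1 h0.2).imp id (congrArg Subtype.val))
  let a' : LL v := ⟨a, IL.on oa⟩
  have oa' : On a' := T.on.1 oa
  have ha : On a' ∧ q1 a' := ⟨oa', T.lim.1 X.aL, fun x => by
    refine IL.up ?_ (s0 x)
    refine IL.bs.tr ((mem_Vf oa').2 ⟨lo q0, t0, fun _ h => h⟩)⟩
  obtain ⟨o1, s1, m1⟩ := lo_spec q1 ⟨a', ha⟩
  have ft := (emb_elm X.h).ff rfl (t := fun _ : Fin 0 → LL v => lo q1) inferInstance ![]
  have t1 := small _ o1 ft 0 ((m1 _ ha.1 ha.2).imp id (congrArg Subtype.val))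
  refine ⟨_, t1, T.lim.2 s1.1, congrArg Subtype.val ft, fun x hx => ?_⟩
  have := LL_IL.2 (s1.2 ⟨x, hx⟩)
  rwa [LV _ o1 (.inl (lt_of_lt_of_le' ol t1 (le_scn oa _)))] at this
end
noncomputable section
variable [ZM M] {v w b : M} {j : M → M} {n : ℕ} {a k : M}
theorem Cx.case2 (X : Cx j n a k v) (hj : j v ≠ v) : False := by
  have dj := X.d
  obtain ⟨t, ta, tL, jt, hI⟩ := X.tau hj
  have oa := X.aL.1
  have ol := scn_on oa (2*n+1)
  have gd := X.gd
  have tle : le t (scn (2*n+1) a) := .inl (lt_of_lt_of_le' ol ta (le_scn oa _))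
  obtain ⟨b, hb⟩ : ∃ b, b = Vf t := ⟨_, rfl⟩
  have jb : j b = b := by rw [hb, X.jVf tL.1 tle (by rw [jt]; exact tle), jt]
  have gb : Gd b := by rw [hb]; exact gd_Vf tL
  rw [← hb] at hI
  have bw : b ε Vf a := by rw [hb]; exact (mem_Vf oa).2 ⟨t, ta, fun _ h => h⟩
  have ilb : IL v b := X.il (by
    have := W_up gd 0 (2*n+1) _ bw
    rwa [Nat.zero_add] at this)
  have h := X.h.res ilb
  rw [jb] at h
  have T := LL_tri b
  have ik : IL b k := IL.on X.ko
  let b' : LL b := ⟨b, IL.bs⟩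
  let k' : LL b := ⟨k, ik⟩
  have ib : ∀ {x}, x ε b → IL b x := fun hx => IL.bs.tr hx
  obtain ⟨s, hs⟩ : ∃ s, s = cp b k := ⟨_, rfl⟩
  obtain ⟨D, hD⟩ : ∃ D, D = cp b (sg k) := ⟨_, rfl⟩
  have ils : IL b s := by rw [hs]; exact IL.bs.gop 1 ik
  have ilD : IL b D := by rw [hD]; exact IL.bs.gop 1 (ik.gop 0 ik)
  have js : j s = cp b (j k) := by rw [hs]; have := h.gop 1 IL.bs ik; rw [jb] at this; exact this
  have mD : ∀ z, z ε D ↔ ∃ x, x ε b ∧ z = kp x k := fun z => by rw [hD, mem_cp]; simp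
  have sD : sub D (j s) := fun z hz => by
    obtain ⟨x, hx, rfl⟩ := (mD z).1 hz
    rw [js]; exact mem_cp.2 ⟨x, k, hx, X.kj, rfl⟩
  let s' : LL b := ⟨s, ils⟩
  let D' : LL b := ⟨D, ilD⟩
  let el (x : LL b) : LL b := kp x k'
  have mD' : ∀ z, z ε D' ↔ ∃ x, x ε b' ∧ z = kp x k' := fun z => by
    show z.1 ε D ↔ _
    rw [mD]; constructor
    · rintro ⟨x, hx, e⟩; exact ⟨⟨x, ib hx⟩, hx, Subtype.ext (by rw [T.kp]; exact e)⟩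
    · rintro ⟨x, hx, rfl⟩; exact ⟨x.1, hx, T.kp _ _⟩
  have kb : ∀ {x y : LL b}, x ε b' → y ε b' → kp x y ε b' := fun hx hy => (T.e _ _).1 (by rw [T.kp]; exact gb.k _ _ hx hy)
  have hgr : ∀ (f : LL b → LL b) [F1 Bt f] [F1 Tp f] (c : LL b), c ε D' → (f c).1 = ap (j (gr s' f).1) c.1 := fun f _ _ c hc =>
    gr_t h f s' c (sD _ hc)
  have e0 : (emp : LL b) ε b' := (T.e _ _).1 (by rw [T.emp]; exact gb.t _ gb.e _ (by simp))
  have d0 : kp emp k' ε D' := (mD' _).2 ⟨_, e0, rfl⟩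
  have hS : Seed b j D := by
    refine ⟨⟨_, d0⟩, fun p p' hp hp' => ?_⟩
    obtain ⟨x, hx, e⟩ := (mD' ⟨p, ilD.tr hp⟩).1 hp
    obtain ⟨x', hx', e'⟩ := (mD' ⟨p', ilD.tr hp'⟩).1 hp'
    have hc := (mD' _).2 ⟨_, kb hx hx', rfl⟩
    refine ⟨_, _, _, hc, (gr s' (fun z => kp (fst (fst z)) (snd z))).2, (gr s' (fun z => kp (snd (fst z)) (snd z))).2, ?_, ?_⟩
    · rw [← hgr _ _ hc]; simp only [fst_kp, snd_kp]; rw [← e]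
    · rw [← hgr _ _ hc]; simp only [fst_kp, snd_kp]; rw [← e']
  have hjx : ∀ {x}, IL b x → hul b j D (j x) := fun hx => emb_cn (a := (kp emp k').1) h ils sD d0 hx
  have L0b : ∀ x, x ε L0 b → x ε b ∨ x = b := fun x hx => by
    rw [L0, mem_bu, mem_sg] at hx
    exact hx.imp (fun hx => trc_least (fun _ h => h) gb.t _ hx) id
  have hz : ∀ x, x ε L0 b → hul b j D x := fun x hx => by
    rcases L0b x hx with hx | rfl
    · have hc := (mD' _).2 ⟨⟨x, ib hx⟩, hx, rfl⟩
      refine ⟨_, _, (gr s' fst).2, hc, ?_⟩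
      rw [← hgr _ _ hc, fst_kp]
    · have := hjx (x := x) IL.bs
      rwa [jb] at this
  obtain ⟨f1, f2, f3, f4, f5⟩ := emb_fact h ils sD hS hz
  obtain ⟨H, hH⟩ : ∃ H, H = hul b j D := ⟨_, rfl⟩
  have dH : D1 Tp H := by rw [hH]; infer_instance
  rw [← hH] at f1 f2 f3 f4 f5 hz
  obtain ⟨i, hi⟩ : ∃ i : M → M, i = fun x => col H (j x) := ⟨_, rfl⟩
  have di : F1 Tp i := by rw [hi]; infer_instance
  rw [← hi] at f3
  have hkH : ∀ x, x ε sc k → H x := fun x hx => by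
    rw [hH]
    rcases mem_sc.1 hx with hx | rfl
    · have := hjx (IL.on (b := b) (X.ko.mem hx))
      rwa [X.kf x hx] at this
    · refine ⟨_, _, (gr s' snd).2, d0, ?_⟩
      rw [← hgr _ _ d0, snd_kp]
  have ck : col H k = k := f1.fix X.ko.sc.1 hkH (by simp)
  have hki : k ε i k := by
    have := (f1.colm (hkH k (by simp)) (by rw [hH]; exact hjx ik : H (j k))).2 X.kj
    rw [ck] at this; rw [hi]; exact this
  have ibb : i b = b := by rw [hi]; show col H (j b) = b; rw [jb]; exact f1.fix (tr_L0 b) hz (mem_L0 b)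
  obtain ⟨m, hm, hX⟩ : ∃ m : ℕ, m ≤ 2*n ∧ ∀ Y, sub Y (cp s s) → Y ε W m (Vf a) := by
    rcases X.ka with hk | ⟨hk, hn⟩
    · refine ⟨0, by omega, fun Y hY => gd.s _ _ ?_ hY⟩
      have : s ε Vf a := by
        rw [hs]; exact Vf_cp X.aL bw (Vf_on oa k hk)
      exact Vf_cp X.aL this this
    · refine ⟨1, by omega, fun Y hY => mem_pw.2 fun z hz => ?_⟩
      have sw : ∀ z, z ε s → z ε Vf a := fun z hz => by
        rw [hs] at hz
        obtain ⟨x, y, hx, hy, rfl⟩ := mem_cp.1 hz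
        exact gd.k _ _ (gd.t _ bw _ hx) (Vf_on oa y (hk ▸ hy))
      obtain ⟨x, y, hx, hy, rfl⟩ := mem_cp.1 (hY z hz)
      exact gd.k _ _ (sw x hx) (sw y hy)
  let Q (z : M) : Prop := ∃ Y x x', sub Y (cp s s) ∧ x ε b ∧ x' ε b ∧ kp (kp x' k) (kp x k) ε j Y ∧ z = pm m Y (kp x' x)
  have dQ : D1 Tp Q := by unfold Q; infer_instance
  obtain ⟨q', hq'⟩ := sepx Q (W m (Vf a))
  have up1 : ∀ z, z ε W (m+1) (Vf a) → IL v z := fun z hz => X.il (by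
    have := W_up gd (m+1) (2*n-m) z hz
    rwa [show m+1+(2*n-m) = 2*n+1 by omega] at this)
  have iq : IL b q' := hI _ (up1 _ (mem_pw.2 fun z hz => ((hq' z).1 hz).1))
  let qq : LL b := ⟨q', iq⟩
  let q (Y p r : LL b) : Prop := pm m Y (kp (fst p) (fst r)) ε qq
  have dq : D3 Tp q := by unfold q; infer_instance
  obtain ⟨B, dB, hB⟩ := st7 h (b := b') (s := s') (D := D') (a0 := kp emp k') (q := q) ils (fun p hp => sD _ hp) d0
    (fun Y p r hY hp hr => by
      obtain ⟨x, hx, rfl⟩ := (mD' p).1 hp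
      obtain ⟨x', hx', rfl⟩ := (mD' r).1 hr
      show pm m Y (kp (fst (kp x' k')) (fst (kp x k'))) ε qq ↔ _
      rw [fst_kp, fst_kp]
      have hY' : sub Y.1 (cp s s) := by
        have := T.sub.2 hY
        rwa [T.cp] at this
      show (pm m Y (kp x' x)).1 ε q' ↔ (kp (kp x' k') (kp x k')).1 ε j Y.1
      rw [LL_pm, hq', T.kp, T.kp, T.kp, T.kp]
      constructor
      · rintro ⟨-, Y1, x1, x1', h1, h2, h3, h4, e⟩
        rw [pm_eq, kp_eq] at e
        rw [e.1, e.2.1, e.2.2]; exact h4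
      · intro hh
        refine ⟨gd.pm (hX _ hY') ?_, Y.1, x.1, x'.1, hY', hx, hx', hh, rfl⟩
        have := W_up gd 0 m _ (gd.k _ _ (gd.t _ bw _ hx') (gd.t _ bw _ hx))
        rwa [Nat.zero_add] at this)
  have iL : i (L0 b) = L0 b := by rw [L0_j f3 IL.bs, ibb]
  have st : sc t ε a := X.aL.2.2 t ta
  have Lw : ∀ x, x ε L0 b → x ε Vf (sc t) := fun x hx => by
    rw [Vf_sc tL.1, mem_pw, ← hb]
    rcases L0b x hx with hx | rfl
    · exact gb.t _ hx
    · exact fun _ h => h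
  have ig : IL b (gr (L0 b) i) := by
    have h1 : Vf (sc t) ε Vf a := (mem_Vf oa).2 ⟨_, st, fun _ h => h⟩
    have h2 : gr (L0 b) i ε Vf a := gd.s _ _ (Vf_cp X.aL h1 h1) fun z hz => by
      obtain ⟨x, hx, rfl⟩ := mem_gr.1 hz
      refine mem_cp.2 ⟨x, i x, Lw x hx, Lw _ ?_, rfl⟩
      have := (f3.mem (IL.l0 hx) IL.l0').2 hx
      rwa [iL] at this
    have := W_up gd 0 (2*n+1) _ h2
    rw [Nat.zero_add] at this
    exact hI _ (X.il this)
  let g : LL b := ⟨_, ig⟩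
  have hfin := sz9 f3 (by rw [ibb]; exact IL.bs) (A := fun x => ap g x) (B := B) (fun x hx => by
    show (ap g x).1 = _
    rw [T.ap]; exact ap_gr hx) (fun x hx => by rw [hB x hx, hi, hH]) X.ko
  rw [hfin] at hki
  exact nmem_self hki
theorem Cx.core (X : Cx j n a k v) {A : M} (hA : A ε v) : ∃ e, F1 Tp e ∧ Emb A A e ∧ (∃ c, On c ∧ e c ≠ c) ∧
    ∀ b, On b → le b (scn (2*n) a) → e b = b :=
  X.main (by_contra fun hj => X.case2 hj) hA
end
section
variable [ZM M]
instance : D1 Tp (ZM.P : M → Prop) := ⟨Df.vaux 0⟩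
noncomputable def jf (x : M) : M := the (fun y => ZM.P (kp x y))
instance jf_f1 : F1 Tp (jf : M → M) := by unfold jf; infer_instance
theorem wrap (J : M → M → Prop) (l v1 : M) (hJ : ∀ x y : M, ZM.P (kp x y) ↔ J x y)
    (hev : IsEvenOrd ZM.E l) (hv1 : VAt ZM.E l 1 v1) (hI0 : I0Emb ZM.E l v1 J) :
    ∀ A, ZM.E A v1 → ∃ (JA : M → M → Prop) (rho : M), IsRankOf ZM.E A rho ∧
      ElemOn ZM.E (InL ZM.E A) JA ∧ NontrivialRel JA ∧
      ∀ b, IsOrd ZM.E b → (ZM.E b rho ∨ b = rho) → JA b b := by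
  have eIL : ∀ b : M, InL ZM.E b = IL b := fun b => by funext x; exact propext InL_iff
  obtain ⟨a, n, ha, hl⟩ := hev
  rw [zero_iff, lim_iff] at ha
  rw [it_iff] at hl
  have hao : On a := ha.elim (fun h => h ▸ on_emp) (fun h => h.1)
  have hlo : On l := hl ▸ scn_on hao _
  obtain ⟨s, hs, hv⟩ := hv1
  rw [it_iff] at hs
  have hs : s = sc l := hs
  rw [VS_iff] at hv
  obtain ⟨⟨⟨t1, t2, t3⟩, el⟩, k, hk, hkl, hkn, hkf⟩ := hI0
  rw [eIL] at t1 t2 el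
  have jJ : ∀ x, IL v1 x → J x (jf x) := fun x hx => by
    obtain ⟨y, hy⟩ := t1 x hx
    have : jf x = y := the_eq ((hJ _ _).2 hy) fun z hz => t3 x z y ((hJ _ _).1 hz) hy
    rw [this]; exact hy
  have X : Cx (jf : M → M) n a k v1 := by
    refine ⟨inferInstance, ha, ?_, ⟨fun x hx => (t2 _ _ (jJ x hx)).2, fun m f v => ?_⟩, hk, hl ▸ hkl, fun e => hkn ?_, fun x hx => ?_⟩
    · rw [hv.2, hs, scn_s, hl]
    · exact (ev_sub f v).trans ((el f _ _ fun i => jJ _ (v i).2).trans (ev_sub (C := IL v1) f (fun i => ⟨jf (v i).1, (t2 _ _ (jJ _ (v i).2)).2⟩)).symm)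
    · have := jJ k (IL.on hk); rwa [e] at this
    · have := hkf x (On.mem hk hx) hx
      exact t3 x _ _ (jJ x (t2 _ _ this).1) this
  intro A hA
  obtain ⟨e, he, hE, ⟨c, hc, hcn⟩, hb⟩ := X.core hA
  have hAl : sub A (Vf l) := by
    have := hA
    rw [hv.2, hs, Vf_sc hlo, mem_pw] at this
    exact this
  obtain ⟨r, hr, hro, hrl⟩ := ex_rank hlo hAl
  refine ⟨fun x y => IL A x ∧ y = e x, r, hr, ?_, ⟨c, e c, ⟨IL.on hc, rfl⟩, fun h => hcn h.symm⟩, fun b hbo hbr => ⟨IL.on hbo, ?_⟩⟩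
  · rw [eIL]
    refine ⟨⟨fun x hx => ⟨_, hx, rfl⟩, ?_, ?_⟩, fun {m} f v w hvw => ?_⟩
    · rintro x y ⟨hx, rfl⟩; exact ⟨hx, hE.mp x hx⟩
    · rintro x y y' ⟨_, rfl⟩ ⟨_, rfl⟩; rfl
    · have hw : w = fun i => e (v i) := funext fun i => (hvw i).2
      subst hw
      have := hE.el f (fun i => ⟨v i, (hvw i).1⟩)
      exact (ev_sub (C := IL A) f (fun i => ⟨v i, (hvw i).1⟩)).symm.trans (this.trans (ev_sub (C := IL A) f _))
  · exact (hb b hbo (hl ▸ le_trans' hlo hbr hrl)).symm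
end
theorem stmt18_aux (E J : M → M → Prop) (l v1 : M)
    (hZF : SatZF E (JPred E J)) (hev : IsEvenOrd E l)
    (hv1 : VAt E l 1 v1) (hI0 : I0Emb E l v1 J) :
    ∀ A, E A v1 → ∃ (JA : M → M → Prop) (rho : M), IsRankOf E A rho ∧
      ElemOn E (InL E A) JA ∧ NontrivialRel JA ∧
      ∀ b, IsOrd E b → (E b rho ∨ b = rho) → JA b b := by
  letI I : ZM M := ⟨E, JPred E J, hZF⟩
  refine @wrap M I J l v1 (fun x y => ?_) hev hv1 hI0
  constructor
  · rintro ⟨x', y', h, h'⟩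
    have := kp_eq.1 ((kp_iff (p := kp x y)).1 h)
    rw [this.1, this.2]; exact h'
  · exact fun h => ⟨x, y, kp_iff.2 rfl, h⟩
theorem stmt_18 {M : Type} (E J : M → M → Prop) (l v1 : M)
    (hZF : SatZF E (JPred E J)) (hev : IsEvenOrd E l)
    (hv1 : VAt E l 1 v1) (hI0 : I0Emb E l v1 J) :
    ∀ A, E A v1 → ∃ (JA : M → M → Prop) (rho : M), IsRankOf E A rho ∧
      ElemOn E (InL E A) JA ∧ NontrivialRel JA ∧
      ∀ b, IsOrd E b → (E b rho ∨ b = rho) → JA b b := by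
  exact stmt18_aux E J l v1 hZF hev hv1 hI0
end ZFI0
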